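/- arXiv:2410.12065 — 5 statements merged into one kernel-verified Lean document; each statement's English description precedes it below -/
import Mathlib

section
/- Let Λ and Γ be closed discrete subsets of ℝ (closed sets all of whose points are isolated). Then there exist Schwartz functions f, g : ℝ → ℂ such that |f(λ)| = |g(λ)| for every λ ∈ Λ and |𝓕f(γ)| = |𝓕g(γ)| for every γ ∈ Γ, and yet there exist points x₀, ξ₀ ∈ ℝ with |f(x₀)| ≠ |g(x₀)| and |𝓕f(ξ₀)| ≠ |𝓕g(ξ₀)|. -/
open MeasureTheory Filter Real
open scoped FourierTransform

/-- A closed discrete subset of `ℝ` is not all of `ℝ`. -/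
theorem exists_notMem_of_discreteTopology (S : Set ℝ) (hS : DiscreteTopology ↥S) :
    ∃ a, a ∉ S := by
  by_contra! h
  have hc : S.Countable := Set.countable_coe_iff.1 countable_of_Lindelof_of_discrete
  rw [Set.eq_univ_of_forall h] at hc
  exact Set.not_countable_univ hc

/-- A modulated bump function supported off a closed set, with prescribed phases at a point `a`
and, on the Fourier side, at a point `b`. -/
theorem exists_schwartzMap_eqOn_zero_fourier_pos {S : Set ℝ} (hS : IsClosed S) {a : ℝ}
    (ha : a ∉ S) (b : ℝ) :
    ∃ u : SchwartzMap ℝ ℂ, (∀ x ∈ S, u x = 0) ∧ u a = (𝐞 (a * b) : ℂ) ∧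
      ∃ r : ℝ, 0 < r ∧ 𝓕 (⇑u) b = r := by
  obtain ⟨φ, hsub, hcpt, hsmooth, hrange, hφa⟩ :=
    exists_contDiff_tsupport_subset (n := (⊤ : ℕ∞)) (hS.isOpen_compl.mem_nhds ha)
  have hcont : ContDiff ℝ (⊤ : ℕ∞) fun x : ℝ => (𝐞 (x * b) : ℂ) * (φ x : ℂ) := by
    simp only [Real.fourierChar_apply]
    have := Complex.ofRealCLM.contDiff.comp hsmooth
    have h2 : ContDiff ℝ (⊤ : ℕ∞) fun x : ℝ => ((2 * π * (x * b) : ℝ) : ℂ) :=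
      Complex.ofRealCLM.contDiff.comp
        (contDiff_const.mul (contDiff_id.mul contDiff_const))
    exact ((h2.mul contDiff_const).cexp).mul this
  have hcpt' : HasCompactSupport fun x : ℝ => (𝐞 (x * b) : ℂ) * (φ x : ℂ) :=
    (hcpt.comp_left (g := fun t : ℝ => (t : ℂ)) Complex.ofReal_zero).mul_left
  refine ⟨hcpt'.toSchwartzMap hcont, fun x hx => ?_, ?_, ∫ x, φ x, ?_, ?_⟩
  · have : φ x = 0 := image_eq_zero_of_notMem_tsupport fun h => hsub h hx
    simp [this]
  · simp [hφa]
  · exact hsmooth.continuous.integral_pos_of_hasCompactSupport_nonneg_nonzero hcpt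
      (fun x => (hrange ⟨x, rfl⟩).1) (x := a) (by simp [hφa])
  · rw [Real.fourier_real_eq, ← integral_complex_ofReal]
    congr 1 with x
    simp [Circle.smul_def, AddChar.map_neg_eq_inv]

/-- The sum and the difference of two nonzero complex numbers with the same argument have distinct
absolute values. -/
theorem norm_mul_add_ne_norm_mul_sub (c : Circle) {s t : ℝ} (hs : 0 < s) (ht : 0 < t) :
    ‖(c : ℂ) * s + c * t‖ ≠ ‖(c : ℂ) * s - c * t‖ := by
  rw [← mul_add, ← mul_sub, norm_mul, norm_mul, Circle.norm_coe, one_mul, one_mul,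
    ← Complex.ofReal_add, ← Complex.ofReal_sub, Complex.norm_real, Complex.norm_real,
    Real.norm_eq_abs, Real.norm_eq_abs, abs_of_pos (add_pos hs ht)]
  exact (abs_lt.2 ⟨by linarith, by linarith⟩).ne'

/-- For any closed discrete sets `Λ, Γ ⊆ ℝ` there are Schwartz functions
`f, g` agreeing in absolute value on `Λ` (and their Fourier transforms on `Γ`) which are
nevertheless not Pauli partners. -/
theorem discrete_pauli_counterexample (Λ Γ : Set ℝ)
    (hΛclosed : IsClosed Λ) (hΓclosed : IsClosed Γ)
    (hΛdisc : DiscreteTopology ↥Λ) (hΓdisc : DiscreteTopology ↥Γ) :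
    ∃ f g : SchwartzMap ℝ ℂ,
      (∀ lam ∈ Λ, ‖f lam‖ = ‖g lam‖) ∧
      (∀ gam ∈ Γ, ‖𝓕 (⇑f) gam‖ = ‖𝓕 (⇑g) gam‖) ∧
      (∃ x₀ : ℝ, ‖f x₀‖ ≠ ‖g x₀‖) ∧
      (∃ ξ₀ : ℝ, ‖𝓕 (⇑f) ξ₀‖ ≠ ‖𝓕 (⇑g) ξ₀‖) := by
  obtain ⟨a, ha⟩ := exists_notMem_of_discreteTopology Λ hΛdisc
  obtain ⟨b, hb⟩ := exists_notMem_of_discreteTopology Γ hΓdisc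
  obtain ⟨u, hu, hua, r, hr, hur⟩ := exists_schwartzMap_eqOn_zero_fourier_pos hΛclosed ha b
  obtain ⟨w, hw, hwb, s, hs, hws⟩ := exists_schwartzMap_eqOn_zero_fourier_pos hΓclosed hb (-a)
  set c : Circle := 𝐞 (a * b) with hc
  set v : SchwartzMap ℝ ℂ := (c : ℂ) • 𝓕⁻ w with hv
  have hFv : 𝓕 v = (c : ℂ) • w := by
    rw [hv, FourierTransform.fourier_smul, FourierTransform.fourier_fourierInv_eq]
  have hva : v a = c * s := by
    rw [hv, _root_.smul_apply, SchwartzMap.fourierInv_coe, Real.fourierInv_eq_fourier_neg,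
      hws, smul_eq_mul]
  have hFadd (ξ : ℝ) : 𝓕 (⇑(u + v)) ξ = 𝓕 (⇑u) ξ + c * w ξ := by
    rw [← SchwartzMap.fourier_coe, FourierTransform.fourier_add, hFv]
    rfl
  have hFsub (ξ : ℝ) : 𝓕 (⇑(u - v)) ξ = 𝓕 (⇑u) ξ - c * w ξ := by
    rw [← SchwartzMap.fourier_coe, sub_eq_add_neg u v, FourierTransform.fourier_add,
      FourierTransform.fourier_neg, hFv, ← sub_eq_add_neg]
    rfl
  have hcw : (c : ℂ) * w b = 1 := by
    rw [hwb, hc, ← Circle.coe_mul, ← AddChar.map_add_eq_mul]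
    simp [mul_comm]
  refine ⟨u + v, u - v, fun x hx => ?_, fun ξ hξ => ?_, ⟨a, ?_⟩, ⟨b, ?_⟩⟩
  · simp [hu x hx]
  · rw [hFadd, hFsub, hw ξ hξ, mul_zero, add_zero, sub_zero]
  · have := norm_mul_add_ne_norm_mul_sub c one_pos hs
    simpa [hua, hva] using this
  · rw [hFadd, hFsub, hcw, hur]
    simpa using norm_mul_add_ne_norm_mul_sub 1 hr one_pos
end

section
/- Let (λ_i)_{i∈ℤ} and (γ_i)_{i∈ℤ} be strictly increasing real sequences with λ_i → ±∞ and γ_i → ±∞ as i → ±∞, satisfying the supercritical density conditions liminf_{i→±∞}(λ_{i+1}−λ_i)|λ_i| > 1/2 and liminf_{i→±∞}(γ_{i+1}−γ_i)|γ_i| > 1/2. Then there exists a₀ > 0 such that for every α ∈ (0, a₀) there is an infinite-dimensional complex subspace E_α of the Schwartz space 𝓢(ℝ) such that every f ∈ E_α satisfies f(λ_i) = 0 and 𝓕f(γ_i) = 0 for all i ∈ ℤ, and |f(x)| + |𝓕f(x)| ≤ C_f e^{−αx²} for all x ∈ ℝ (for some constant C_f depending on f). In particular there exist f, g ∈ E_α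 with |f(λ_i)| = |g(λ_i)| and |𝓕f(γ_i)| = |𝓕g(γ_i)| for all i ∈ ℤ, but |f| is not identically equal to |g| and |𝓕f| is not identically equal to |𝓕g|. -/
open MeasureTheory Filter Real
open scoped FourierTransform

theorem fourier_continuous_of_integrable {f : ℝ → ℂ} (hf : Integrable f) : Continuous (𝓕 f) :=
  VectorFourier.fourierIntegral_continuous (μ := volume) Real.continuous_fourierChar
    (L := innerₗ ℝ) (by exact continuous_inner) hf

theorem norm_fourier_le_integral_norm (f : ℝ → ℂ) (x : ℝ) : ‖𝓕 f x‖ ≤ ∫ t, ‖f t‖ :=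
  VectorFourier.norm_fourierIntegral_le_integral_norm _ _ _ _ _

/-- A column-summable perturbation of the identity on a weighted `ℓ¹` space, of size at most
`1/2`, is surjective onto the unit vectors. -/
theorem exists_weighted_solution {I : Type*} [DecidableEq I] (K : I → I → ℂ) (w : I → ℝ)
    (hw : ∀ i, 0 < w i) (hs : ∀ j, Summable fun i => ‖K i j‖ * w i)
    (hK : ∀ j, ∑' i, ‖K i j‖ * w i ≤ w j / 2) (i₀ : I) :
    ∃ c : I → ℂ, (Summable fun i => ‖c i‖ * w i) ∧
      ∀ i, c i + ∑' j, c j * K i j = if i = i₀ then 1 else 0 := by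
  have hwC : ∀ i, (w i : ℂ) ≠ 0 := fun i => by exact_mod_cast (hw i).ne'
  have nrm : ∀ x : lp (fun _ : I => ℂ) 1, ‖x‖ = ∑' i, ‖x i‖ := fun x => by
    have := lp.norm_eq_tsum_rpow (p := 1) (by simp) x
    simpa using this
  have smb : ∀ x : lp (fun _ : I => ℂ) 1, Summable fun i => ‖x i‖ := fun x => by
    have := (lp.hasSum_norm (p := 1) (by simp) x).summable
    simpa using this
  have hval : ∀ i j, ‖K i j * w i / w j‖ = ‖K i j‖ * w i / w j := fun i j => by
    rw [norm_div, norm_mul, Complex.norm_real, Complex.norm_real, norm_of_nonneg (hw i).le,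
      norm_of_nonneg (hw j).le]
  have hmem : ∀ j, Memℓp (fun i => K i j * w i / w j : I → ℂ) 1 := fun j => by
    refine memℓp_gen ?_
    simp only [hval, ENNReal.toReal_one, rpow_one]
    exact (hs j).div_const _
  let T : I → lp (fun _ : I => ℂ) 1 := fun j => ⟨_, hmem j⟩
  have hT : ∀ i j, T j i = K i j * w i / w j := fun i j => rfl
  have hTn : ∀ j, ‖T j‖ ≤ 1 / 2 := fun j => by
    rw [nrm]
    simp only [hT, hval]
    rw [tsum_div_const, div_le_iff₀ (hw j)]
    linarith [hK j]
  have hsn : ∀ x : lp (fun _ : I => ℂ) 1, Summable fun j => ‖x j • T j‖ := fun x => by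
    refine Summable.of_nonneg_of_le (fun _ => norm_nonneg _) (fun j => ?_)
      ((smb x).mul_right (1 / 2))
    rw [norm_smul]
    exact mul_le_mul_of_nonneg_left (hTn j) (norm_nonneg _)
  have hsum : ∀ x : lp (fun _ : I => ℂ) 1, Summable fun j => x j • T j := fun x => by
    exact (hsn x).of_norm
  let S : lp (fun _ : I => ℂ) 1 →ₗ[ℂ] lp (fun _ : I => ℂ) 1 :=
    { toFun := fun x => ∑' j, x j • T j
      map_add' := fun x y => by
        rw [← (hsum x).tsum_add (hsum y)]
        simp only [lp.coeFn_add, Pi.add_apply, add_smul]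
      map_smul' := fun a x => by
        rw [RingHom.id_apply, ← (hsum x).tsum_const_smul a]
        simp only [lp.coeFn_smul, Pi.smul_apply, smul_assoc] }
  have hSb : ∀ x : lp (fun _ : I => ℂ) 1, ‖S x‖ ≤ 1 / 2 * ‖x‖ := fun x => by
    refine (norm_tsum_le_tsum_norm (hsn x)).trans ?_
    rw [nrm x, ← tsum_mul_left]
    refine (hsn x).tsum_le_tsum (fun j => ?_) ((smb x).mul_left _)
    rw [norm_smul, mul_comm]
    exact mul_le_mul_of_nonneg_right (hTn j) (norm_nonneg _)
  let A : lp (fun _ : I => ℂ) 1 →L[ℂ] lp (fun _ : I => ℂ) 1 := S.mkContinuous (1 / 2) hSb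
  have hA : ‖-A‖ < 1 := by
    rw [norm_neg]
    exact (S.mkContinuous_norm_le (by norm_num) hSb).trans_lt (by norm_num)
  obtain ⟨B, hB⟩ := (isUnit_one_sub_of_norm_lt_one hA).exists_right_inv
  let e : lp (fun _ : I => ℂ) 1 := lp.single 1 i₀ (w i₀ : ℂ)
  let b : lp (fun _ : I => ℂ) 1 := B e
  have hb : b + A b = e := by
    have := congrArg (fun L : lp (fun _ : I => ℂ) 1 →L[ℂ] lp (fun _ : I => ℂ) 1 => L e) hB
    simpa [sub_neg_eq_add] using this
  have hAi : ∀ i, (A b) i = ∑' j, b j * (K i j * w i / w j) := fun i => by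
    have h1 : A b = ∑' j, b j • T j := rfl
    have h2 : HasSum (fun j => (b j • T j) i) ((∑' j, b j • T j : lp (fun _ : I => ℂ) 1) i) :=
      (hsum b).hasSum.map (lp.evalCLM ℂ (fun _ : I => ℂ) 1 i)
        (lp.evalCLM ℂ (fun _ : I => ℂ) 1 i).continuous
    rw [h1, ← h2.tsum_eq]
    simp [hT]
  refine ⟨fun i => b i / w i, ?_, fun i => ?_⟩
  · refine (smb b).congr fun i => ?_
    rw [norm_div, Complex.norm_real, norm_of_nonneg (hw i).le, div_mul_cancel₀ _ (hw i).ne']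
  · have h3 : b i + (A b) i = e i := by rw [← hb]; simp
    rw [hAi] at h3
    have h4 : ∑' j, b j / w j * K i j = (∑' j, b j * (K i j * w i / w j)) / w i := by
      rw [← tsum_div_const]
      refine tsum_congr fun j => ?_
      field_simp [hwC i, hwC j]
    change b i / w i + ∑' j, b j / w j * K i j = _
    rw [h4, ← add_div, h3]
    by_cases h : i = i₀
    · subst h
      simp [e, hwC]
    · simp [e, h]

/-- Decay faster than every power. -/
def RapidDecay (g : ℝ → ℂ) : Prop :=
  ∀ m : ℕ, ∃ C : ℝ, ∀ x, (1 + |x|) ^ m * ‖g x‖ ≤ C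

theorem rapidDecay_of_gaussian {g : ℝ → ℂ} {a A : ℝ} (ha : 0 < a)
    (hg : ∀ x, ‖g x‖ ≤ A * exp (-a * x ^ 2)) : RapidDecay g := by
  intro m
  have hA : 0 ≤ A := by simpa using (norm_nonneg _).trans (hg 0)
  refine ⟨A * exp (m ^ 2 / (4 * a)), fun x => ?_⟩
  have h1 : (1 + |x|) ^ m ≤ exp (m * |x|) := by
    rw [exp_nat_mul]
    exact pow_le_pow_left₀ (by positivity) (by linarith [add_one_le_exp |x|]) m
  have h2 : (m : ℝ) * |x| + -a * x ^ 2 ≤ m ^ 2 / (4 * a) := by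
    rw [le_div_iff₀ (by positivity), ← sq_abs x]
    nlinarith [sq_nonneg ((m : ℝ) - 2 * a * |x|)]
  calc (1 + |x|) ^ m * ‖g x‖ ≤ exp (m * |x|) * (A * exp (-a * x ^ 2)) :=
        mul_le_mul h1 (hg x) (norm_nonneg _) (exp_pos _).le
    _ = A * exp (m * |x| + -a * x ^ 2) := by rw [exp_add]; ring
    _ ≤ _ := by gcongr

theorem RapidDecay.integrable_pow_mul {g : ℝ → ℂ} (hg : RapidDecay g) (hc : Continuous g) (n : ℕ) :
    Integrable fun x : ℝ => x ^ n • g x := by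
  obtain ⟨C, hC⟩ := hg (n + 2)
  refine (integrable_inv_one_add_sq.const_mul C).mono' (by fun_prop) (ae_of_all _ fun x => ?_)
  rw [norm_smul, norm_pow, norm_eq_abs, ← div_eq_mul_inv, le_div_iff₀ (by positivity)]
  refine le_trans ?_ (hC x)
  have h1 : |x| ^ n ≤ (1 + |x|) ^ n := by gcongr; linarith
  have h2 : 1 + x ^ 2 ≤ (1 + |x|) ^ 2 := by
    rw [← sq_abs x]; nlinarith [abs_nonneg x]
  calc |x| ^ n * ‖g x‖ * (1 + x ^ 2) = |x| ^ n * (1 + x ^ 2) * ‖g x‖ := by ring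
    _ ≤ (1 + |x|) ^ n * (1 + |x|) ^ 2 * ‖g x‖ := by gcongr
    _ = _ := by ring

theorem RapidDecay.deriv {g g' g'' : ℝ → ℂ} (hg : RapidDecay g)
    (h1 : ∀ x, HasDerivAt g (g' x) x) (h2 : ∀ x, HasDerivAt g' (g'' x) x) {B : ℝ}
    (hB : ∀ x, ‖g'' x‖ ≤ B) : RapidDecay g' := by
  intro m
  obtain ⟨C, hC⟩ := hg (2 * m)
  refine ⟨B + 2 ^ (2 * m) * C + C, fun x => ?_⟩
  have hp : 0 < (1 + |x|) ^ m := by positivity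
  set s : ℝ := ((1 + |x|) ^ m)⁻¹ with hs
  have hs0 : 0 < s := by positivity
  have hs1 : s ≤ 1 := inv_le_one_of_one_le₀ (one_le_pow₀ (by linarith [abs_nonneg x]))
  have e1 : ∀ t ∈ Set.Icc x (x + s), ‖g' t - g' x‖ ≤ B * s := fun t ht => by
    have := convex_univ.norm_image_sub_le_of_norm_hasDerivWithin_le (f := g') (f' := g'') (C := B)
      (fun y _ => (h2 y).hasDerivWithinAt) (fun y _ => hB y) (Set.mem_univ x) (Set.mem_univ t)
    refine this.trans ?_
    have hB0 : 0 ≤ B := (norm_nonneg _).trans (hB 0)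
    rw [norm_of_nonneg (by linarith [ht.1])]
    gcongr
    linarith [ht.2]
  have e2 := (convex_Icc x (x + s)).norm_image_sub_le_of_norm_hasDerivWithin_le
    (f := fun t : ℝ => g t - t • g' x) (f' := fun t => g' t - g' x) (C := B * s)
    (fun y _ => by
      have := (h1 y).sub ((hasDerivAt_id y).smul_const (g' x))
      simp only [one_smul] at this
      exact this.hasDerivWithinAt) e1
    (Set.left_mem_Icc.2 (by linarith)) (Set.right_mem_Icc.2 (by linarith))
  have e3 : s * ‖g' x‖ ≤ B * s * s + ‖g (x + s)‖ + ‖g x‖ := by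
    have e4 : s • g' x = g (x + s) - g x - (g (x + s) - (x + s) • g' x - (g x - x • g' x)) := by
      rw [add_smul]; abel
    have e5 : ‖s • g' x‖ = s * ‖g' x‖ := by rw [norm_smul, norm_of_nonneg hs0.le]
    rw [← e5, e4]
    refine (norm_sub_le _ _).trans ?_
    have := norm_sub_le (g (x + s)) (g x)
    rw [add_sub_cancel_left, norm_of_nonneg hs0.le] at e2
    linarith
  have e6 : (1 + |x|) ≤ 2 * (1 + |x + s|) := by
    have := abs_sub_abs_le_abs_sub x (x + s)
    rw [sub_add_cancel_left, abs_neg, abs_of_pos hs0] at this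
    linarith [abs_nonneg (x + s)]
  have e7 : (1 + |x|) ^ (2 * m) * ‖g (x + s)‖ ≤ 2 ^ (2 * m) * C := by
    calc (1 + |x|) ^ (2 * m) * ‖g (x + s)‖ ≤ (2 * (1 + |x + s|)) ^ (2 * m) * ‖g (x + s)‖ := by gcongr
      _ = 2 ^ (2 * m) * ((1 + |x + s|) ^ (2 * m) * ‖g (x + s)‖) := by rw [mul_pow, mul_assoc]
      _ ≤ _ := by gcongr; exact hC _
  have e8 := hC x
  have hps : (1 + |x|) ^ m * s = 1 := mul_inv_cancel₀ hp.ne'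
  have e9 : (1 + |x|) ^ (2 * m) = (1 + |x|) ^ m * (1 + |x|) ^ m := by rw [two_mul, pow_add]
  rw [e9] at e7 e8
  set P := (1 + |x|) ^ m
  have e10 := mul_le_mul_of_nonneg_left e3 (mul_pos hp hp).le
  have e11 : P * P * (s * ‖g' x‖) = P * ‖g' x‖ := by
    linear_combination (P * ‖g' x‖) * hps
  have e12 : P * P * (B * s * s + ‖g (x + s)‖ + ‖g x‖) =
      B + P * P * ‖g (x + s)‖ + P * P * ‖g x‖ := by
    linear_combination (B * (P * s + 1)) * hps
  rw [e11, e12] at e10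
  linarith

/-- A continuous function with Gaussian decay in space and frequency is a Schwartz function. -/
theorem exists_schwartzMap_of_gaussian {u : ℝ → ℂ} {a A : ℝ} (ha : 0 < a) (hc : Continuous u)
    (hu : ∀ x, ‖u x‖ ≤ A * exp (-a * x ^ 2)) (hv : ∀ x, ‖𝓕 u x‖ ≤ A * exp (-a * x ^ 2)) :
    ∃ h : SchwartzMap ℝ ℂ, ⇑h = u := by
  have hur := rapidDecay_of_gaussian ha hu
  have hui : Integrable u := by simpa using hur.integrable_pow_mul hc 0
  have hFc := fourier_continuous_of_integrable hui
  have hFi : Integrable (𝓕 u) := by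
    simpa using (rapidDecay_of_gaussian ha hv).integrable_pow_mul hFc 0
  set v : ℝ → ℂ := fun x => 𝓕 u (-x) with hvdef
  have huv : 𝓕 v = u := by
    rw [← Real.fourierInv_eq_fourier_comp_neg, hc.fourierInv_fourier_eq hui hFi]
  have hvc : Continuous v := hFc.comp continuous_neg
  have hvr : RapidDecay v := rapidDecay_of_gaussian ha (A := A) fun x => by
    simpa using hv (-x)
  have hvi := fun n => hvr.integrable_pow_mul hvc n
  have hsmooth : ContDiff ℝ (⊤ : ℕ∞) u := by
    rw [← huv]
    refine Real.contDiff_fourier fun n _ => ?_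
    simpa [norm_smul] using (hvi n).norm
  have hbd : ∀ n : ℕ, ∃ B, ∀ x, ‖iteratedDeriv n u x‖ ≤ B := fun n => by
    refine ⟨∫ x : ℝ, ‖(-2 * π * Complex.I * x) ^ n • v x‖, fun x => ?_⟩
    rw [← huv, Real.iteratedDeriv_fourier (N := ⊤) (fun k _ => hvi k) (by simp)]
    exact norm_fourier_le_integral_norm _ _
  have hder : ∀ n x, HasDerivAt (iteratedDeriv n u) (iteratedDeriv (n + 1) u x) x := fun n x => by
    rw [iteratedDeriv_succ]
    refine DifferentiableAt.hasDerivAt ?_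
    exact (hsmooth.differentiable_iteratedDeriv n (by exact_mod_cast WithTop.coe_lt_top _)) x
  have hrd : ∀ n, RapidDecay (iteratedDeriv n u) := fun n => by
    induction n with
    | zero => simpa using hur
    | succ n ih =>
      obtain ⟨B, hB⟩ := hbd (n + 2)
      exact ih.deriv (hder n) (hder (n + 1)) hB
  refine ⟨⟨u, hsmooth, fun k n => ?_⟩, rfl⟩
  obtain ⟨C, hC⟩ := hrd n k
  refine ⟨C, fun x => le_trans ?_ (hC x)⟩
  rw [norm_iteratedFDeriv_eq_norm_iteratedDeriv, norm_eq_abs]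
  gcongr
  linarith

/-- The cosine window: an Ingham-type kernel of bandwidth `c` centred at `y`. -/
theorem exists_bandlimited_kernel {c : ℝ} (hc : 0 < c) (y : ℝ) :
    ∃ m : ℝ → ℂ, Integrable m ∧ (∀ t, c / 2 < |t| → m t = 0) ∧ (∫ t, ‖m t‖) ≤ 2 ∧ 𝓕 m y = 1 ∧
      ∀ x, 1 < 4 * c ^ 2 * (x - y) ^ 2 → ‖𝓕 m x‖ ≤ 1 / (4 * c ^ 2 * (x - y) ^ 2 - 1) := by
  set B : ℝ := π / c with hB
  have hB0 : 0 < B := by positivity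
  have hBc : B * (c / 2) = π / 2 := by rw [hB]; field_simp
  let k : ℝ → ℂ := fun t => (B / 2 : ℝ) * (Real.cos (B * t) : ℂ) *
    Complex.exp (2 * π * t * y * Complex.I)
  have hk : Continuous k := by fun_prop
  have hkn : ∀ t, ‖k t‖ ≤ B / 2 := fun t => by
    have h1 : ‖Complex.exp (2 * π * t * y * Complex.I)‖ = 1 := by
      have := Complex.norm_exp_ofReal_mul_I (2 * π * t * y)
      push_cast at this
      exact this
    simp only [k]
    rw [norm_mul, norm_mul, h1, mul_one, Complex.norm_real, Complex.norm_real,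
      norm_of_nonneg (by positivity : (0 : ℝ) ≤ B / 2), norm_eq_abs]
    exact mul_le_of_le_one_right (by positivity) (abs_cos_le_one _)
  have hle : -(c / 2) ≤ c / 2 := by linarith
  have hF : ∀ x, B ^ 2 - (2 * π * (y - x)) ^ 2 ≠ 0 →
      𝓕 (Set.indicator (Set.Ioc (-(c / 2)) (c / 2)) k) x =
      B ^ 2 / (B ^ 2 - (2 * π * (y - x)) ^ 2 : ℝ) * Real.cos (2 * π * (y - x) * (c / 2)) := by
    intro x hx
    set A : ℝ := 2 * π * (y - x) with hA
    have hx' : ((B : ℂ) ^ 2 - (A : ℂ) ^ 2) ≠ 0 := by exact_mod_cast hx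
    rw [Real.fourier_real_eq_integral_exp_smul]
    have e1 : (fun v : ℝ => Complex.exp (↑(-2 * π * v * x) * Complex.I) •
        Set.indicator (Set.Ioc (-(c / 2)) (c / 2)) k v) =
        Set.indicator (Set.Ioc (-(c / 2)) (c / 2)) (fun t : ℝ => (B / 2 : ℂ) *
          (Complex.cos (B * t) * Complex.exp (A * t * Complex.I))) := by
      ext t
      by_cases ht : t ∈ Set.Ioc (-(c / 2)) (c / 2)
      · simp only [Set.indicator_of_mem ht, k, smul_eq_mul, hA]
        have : Complex.exp (↑(2 * π * (y - x)) * t * Complex.I) =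
            Complex.exp (↑(-2 * π * t * x) * Complex.I) *
              Complex.exp (2 * π * t * y * Complex.I) := by
          rw [← Complex.exp_add]; congr 1; push_cast; ring
        rw [this]; push_cast; ring
      · simp [Set.indicator_of_notMem ht]
    rw [e1, integral_indicator measurableSet_Ioc, ← intervalIntegral.integral_of_le hle]
    have hd : ∀ t ∈ Set.uIcc (-(c / 2)) (c / 2), HasDerivAt (fun t : ℝ => (B / 2 : ℂ) *
        (Complex.exp (A * t * Complex.I) * (Complex.I * A * Complex.cos (B * t) +
          B * Complex.sin (B * t)) / (B ^ 2 - A ^ 2)))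
        ((B / 2 : ℂ) * (Complex.cos (B * t) * Complex.exp (A * t * Complex.I))) t := by
      intro t _
      have hz : HasDerivAt (fun t : ℝ => (t : ℂ)) 1 t := by
        simpa using (hasDerivAt_id t).ofReal_comp
      have d1 := ((hz.const_mul (A : ℂ)).mul_const Complex.I).cexp
      have d2 := (Complex.hasDerivAt_cos (B * t)).comp t (hz.const_mul (B : ℂ))
      have d3 := (Complex.hasDerivAt_sin (B * t)).comp t (hz.const_mul (B : ℂ))
      have d4 := ((d1.mul ((d2.const_mul (Complex.I * A)).add (d3.const_mul (B : ℂ)))).div_const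
        ((B : ℂ) ^ 2 - A ^ 2)).const_mul (B / 2 : ℂ)
      refine HasDerivAt.congr_deriv d4 ?_
      simp only [Pi.add_apply, Function.comp_apply]
      field_simp
      linear_combination (B * A ^ 2 * Complex.cos (B * t)) * Complex.I_sq
    rw [intervalIntegral.integral_eq_sub_of_hasDerivAt hd
      (Continuous.intervalIntegrable (by fun_prop) _ _)]
    have c1 : (B : ℂ) * ((c / 2 : ℝ) : ℂ) = π / 2 := by exact_mod_cast hBc
    have c2 : (B : ℂ) * ((-(c / 2) : ℝ) : ℂ) = -(π / 2) := by
      rw [← c1]; push_cast; ring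
    have c3 : Complex.exp (A * ((-(c / 2) : ℝ) : ℂ) * Complex.I) =
        Complex.cos (A * ((c / 2 : ℝ) : ℂ)) - Complex.sin (A * ((c / 2 : ℝ) : ℂ)) * Complex.I := by
      rw [Complex.exp_mul_I, Complex.ofReal_neg, mul_neg, Complex.cos_neg, Complex.sin_neg]; ring
    simp only [c1, c2, c3, Complex.exp_mul_I, Complex.cos_neg, Complex.sin_neg,
      Complex.cos_pi_div_two, Complex.sin_pi_div_two]
    push_cast
    field_simp
    ring
  refine ⟨Set.indicator (Set.Ioc (-(c / 2)) (c / 2)) k, ?_, fun t ht => ?_, ?_, ?_, fun x hx => ?_⟩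
  · rw [integrable_indicator_iff measurableSet_Ioc]
    exact (hk.integrableOn_Icc).mono_set Set.Ioc_subset_Icc_self
  · refine Set.indicator_of_notMem (fun h => ?_) _
    exact absurd ht (not_lt.2 (abs_le.2 ⟨h.1.le, h.2⟩))
  · simp_rw [norm_indicator_eq_indicator_norm]
    rw [integral_indicator measurableSet_Ioc]
    have h1 := norm_setIntegral_le_of_norm_le_const (μ := volume) (s := Set.Ioc (-(c / 2)) (c / 2))
      (f := fun t => ‖k t‖) (C := B / 2) (by simp) (fun t _ => by simpa using hkn t)
    rw [Real.volume_real_Ioc_of_le hle, norm_eq_abs] at h1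
    refine (le_abs_self _).trans (h1.trans ?_)
    have : B / 2 * (c / 2 - -(c / 2)) = B * (c / 2) := by ring
    rw [this, hBc]
    linarith [pi_le_four]
  · rw [hF y (by simp [hB0.ne'])]
    simp [hB0.ne']
  · have hAB : (2 * π * (y - x)) ^ 2 = B ^ 2 * (4 * c ^ 2 * (x - y) ^ 2) := by
      rw [hB]; field_simp; ring
    have hpos : 0 < 4 * c ^ 2 * (x - y) ^ 2 - 1 := by linarith
    have hfac : B ^ 2 - (2 * π * (y - x)) ^ 2 = -(B ^ 2 * (4 * c ^ 2 * (x - y) ^ 2 - 1)) := by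
      rw [hAB]; ring
    rw [hF x (by rw [hfac]; exact neg_ne_zero.2 (by positivity)), hfac, norm_mul, norm_div,
      Complex.norm_real, Complex.norm_real, norm_neg, norm_pow, Complex.norm_real,
      norm_of_nonneg hB0.le, norm_of_nonneg (by positivity : (0 : ℝ) ≤ B ^ 2 * _), norm_eq_abs]
    have : B ^ 2 / (B ^ 2 * (4 * c ^ 2 * (x - y) ^ 2 - 1)) = 1 / (4 * c ^ 2 * (x - y) ^ 2 - 1) := by
      field_simp
    rw [this]
    exact mul_le_of_le_one_right (by positivity) (abs_cos_le_one _)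

/-- A Gaussian times a band-limited function. -/
theorem bandlimited_mul_gaussian {m : ℝ → ℂ} (hm : Integrable m) {R : ℝ}
    (hR : ∀ t, R < |t| → m t = 0) (l : ℝ) :
    Continuous (fun x : ℝ => 𝓕 m x * (exp (-π * (x - l) ^ 2) : ℝ)) ∧
    (∀ x : ℝ, ‖𝓕 m x * (exp (-π * (x - l) ^ 2) : ℝ)‖ ≤ (∫ t, ‖m t‖) * exp (-π * (x - l) ^ 2)) ∧
    ∀ ξ E : ℝ, (∀ t, |t| ≤ R → exp (-π * (t + ξ) ^ 2) ≤ E) →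
      ‖𝓕 (fun x : ℝ => 𝓕 m x * (exp (-π * (x - l) ^ 2) : ℝ)) ξ‖ ≤ (∫ t, ‖m t‖) * E := by
  have hFc := fourier_continuous_of_integrable hm
  refine ⟨by fun_prop, fun x => ?_, fun ξ E hE => ?_⟩
  · rw [norm_mul, Complex.norm_real, norm_of_nonneg (exp_pos _).le]
    gcongr
    exact norm_fourier_le_integral_norm m x
  · let φ : ℝ → ℂ := fun x => Complex.exp (-π * l ^ 2) *
      Complex.exp (-π * 1 * x ^ 2 + 2 * π * (l - ξ * Complex.I) * x)
    have hφ : Integrable φ := by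
      have := (integrable_cexp_quadratic (b := π) (by simpa using pi_pos)
        (2 * π * (l - ξ * Complex.I)) 0).const_mul (Complex.exp (-π * l ^ 2))
      simpa [φ] using this
    have hφF : ∀ t, ‖𝓕 φ t‖ = exp (-π * (t + ξ) ^ 2) := fun t => by
      have h1 : 𝓕 φ t = Complex.exp (-π * l ^ 2) * 𝓕 (fun x : ℝ =>
          Complex.exp (-π * 1 * x ^ 2 + 2 * π * (l - ξ * Complex.I) * x)) t := by
        simp only [Real.fourier_real_eq_integral_exp_smul, φ, smul_eq_mul]
        rw [← integral_const_mul]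
        congr 1; ext x; ring
      rw [h1, fourier_gaussian_pi' (by simp)]
      simp only [Complex.one_cpow, div_one, one_mul]
      rw [← Complex.exp_add, Complex.norm_exp]
      congr 1
      have : -(π : ℂ) * l ^ 2 + -π * (t + Complex.I * (l - ξ * Complex.I)) ^ 2 =
          ((-π * (t + ξ) ^ 2 : ℝ) : ℂ) + ((-π * (2 * (t + ξ) * l) : ℝ) : ℂ) * Complex.I := by
        push_cast
        linear_combination (-(π : ℂ) * l ^ 2 + 2 * π * (t + ξ + l * Complex.I) * ξ
          - π * ξ ^ 2 * (Complex.I ^ 2 + 1)) * Complex.I_sq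
      rw [this]
      simp only [Complex.add_re, Complex.ofReal_re, Complex.re_ofReal_mul, Complex.I_re, mul_zero,
        add_zero]
    have h2 : 𝓕 (fun x : ℝ => 𝓕 m x * (exp (-π * (x - l) ^ 2) : ℝ)) ξ = ∫ x, 𝓕 m x • φ x := by
      rw [Real.fourier_real_eq_integral_exp_smul]
      congr 1; ext x
      simp only [smul_eq_mul, φ]
      rw [← Complex.exp_add, mul_left_comm, Complex.ofReal_exp, ← Complex.exp_add]
      congr 2
      push_cast; ring
    have h3 : ∫ x, 𝓕 m x • φ x = ∫ t, m t • 𝓕 φ t := by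
      have := VectorFourier.integral_fourierIntegral_smul_eq_flip (μ := volume) (ν := volume)
        (L := innerₗ ℝ) Real.continuous_fourierChar (by exact continuous_inner) hm hφ
      rw [flip_innerₗ] at this
      exact this
    rw [h2, h3, ← integral_mul_const]
    refine norm_integral_le_of_norm_le (hm.norm.mul_const E) (ae_of_all _ fun t => ?_)
    rw [norm_smul, hφF]
    by_cases ht : |t| ≤ R
    · exact mul_le_mul_of_nonneg_left (hE t ht) (norm_nonneg _)
    · simp [hR t (not_le.1 ht)]

/-- Sums over `1`-separated points are dominated by sums over the integers. -/
theorem sum_floor_le {ι : Type*} (T : Finset ι) (v : ι → ℝ) (hv : ∀ t ∈ T, 0 ≤ v t)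
    (hs : ∀ t ∈ T, ∀ t' ∈ T, t ≠ t' → 1 ≤ |v t - v t'|) {φ : ℕ → ℝ} (hφ : ∀ n, 0 ≤ φ n) {S : ℝ}
    (hS : ∀ N, ∑ k ∈ Finset.range N, φ k ≤ S) : ∑ t ∈ T, φ ⌊v t⌋₊ ≤ S := by
  classical
  have hinj : ∀ t ∈ T, ∀ t' ∈ T, ⌊v t⌋₊ = ⌊v t'⌋₊ → t = t' := fun t ht t' ht' h => by
    by_contra hne
    have h1 := hs t ht t' ht' hne
    have h2 := Nat.floor_le (hv t ht)
    have h3 := Nat.floor_le (hv t' ht')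
    have h4 := Nat.lt_floor_add_one (v t)
    have h5 := Nat.lt_floor_add_one (v t')
    rw [h] at h2 h4
    exact absurd h1 (not_le.2 (abs_lt.2 ⟨by linarith, by linarith⟩))
  obtain ⟨N, hN⟩ := (T.image fun t => ⌊v t⌋₊).exists_nat_subset_range
  rw [← Finset.sum_image (f := φ) (g := fun t => ⌊v t⌋₊) hinj]
  exact (Finset.sum_le_sum_of_subset_of_nonneg hN fun i _ _ => hφ i).trans (hS N)

/-- Points of equal sign have `b`-separated squares. -/
def SqSep (b : ℝ) (X : Set ℝ) : Prop :=
  ∀ x ∈ X, ∀ y ∈ X, x ≠ y → 0 < x * y → b ≤ |x ^ 2 - y ^ 2|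

theorem sum_gaussian_le {b : ℝ} (hb : 1 ≤ b) {X : Set ℝ} (hX : SqSep b X) (h0 : ∀ x ∈ X, x ≠ 0)
    {η : ℝ} (hη : 0 < η) (T : Finset ℝ) (hT : ↑T ⊆ X) :
    ∑ x ∈ T, exp (-η * x ^ 2) ≤ 2 / (1 - exp (-η)) := by
  have hq1 : exp (-η) < 1 := by simpa using hη
  have half : ∀ T' : Finset ℝ, ↑T' ⊆ X → (∀ x ∈ T', ∀ y ∈ T', 0 < x * y) →
      ∑ x ∈ T', exp (-η * x ^ 2) ≤ 1 / (1 - exp (-η)) := fun T' hT' hpos => by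
    have h1 := sum_floor_le T' (fun x => x ^ 2) (fun x _ => sq_nonneg x)
      (fun x hx y hy hne => hb.trans (hX x (hT' hx) y (hT' hy) hne (hpos x hx y hy)))
      (φ := fun n => exp (-η) ^ n) (fun n => by positivity) (S := 1 / (1 - exp (-η))) fun N => by
        rw [geom_sum_eq hq1.ne, ← neg_div_neg_eq, neg_sub, neg_sub]
        have := pow_pos (exp_pos (-η)) N
        exact div_le_div_of_nonneg_right (by linarith) (by linarith)
    refine (Finset.sum_le_sum fun x _ => ?_).trans h1
    have := Nat.floor_le (sq_nonneg x)
    rw [← exp_nat_mul, exp_le_exp]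
    nlinarith
  rw [← Finset.sum_filter_add_sum_filter_not T (fun x => 0 < x), show
    2 / (1 - exp (-η)) = 1 / (1 - exp (-η)) + 1 / (1 - exp (-η)) by ring]
  refine add_le_add (half _ (fun x hx => hT (by simp_all)) fun x hx y hy => ?_)
    (half _ (fun x hx => hT (by simp_all)) fun x hx y hy => ?_)
  · exact mul_pos (Finset.mem_filter.1 hx).2 (Finset.mem_filter.1 hy).2
  · obtain ⟨h1, h2⟩ := Finset.mem_filter.1 hx
    obtain ⟨h3, h4⟩ := Finset.mem_filter.1 hy
    exact mul_pos_of_neg_of_neg (lt_of_le_of_ne (not_lt.1 h2) (h0 x (hT h1)))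
      (lt_of_le_of_ne (not_lt.1 h4) (h0 y (hT h3)))

theorem exists_window {b : ℝ} (hb : 1 ≤ b) {X : Set ℝ} (hX : SqSep b X) (l r : ℝ) :
    ∃ W : Finset ℝ, (∀ x, x ∈ W ↔ x ∈ X ∧ 0 < x * l ∧ |x| ≤ r) ∧ (W.card : ℝ) ≤ r ^ 2 + 1 := by
  set V : Set ℝ := {x | x ∈ X ∧ 0 < x * l ∧ |x| ≤ r} with hV
  have hsep : ∀ x ∈ V, ∀ y ∈ V, x ≠ y → 1 ≤ |x ^ 2 - y ^ 2| := fun x hx y hy hne => by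
    refine hb.trans (hX x hx.1 y hy.1 hne ?_)
    have h1 : 0 < x * y * l ^ 2 := by nlinarith [mul_pos hx.2.1 hy.2.1]
    exact pos_of_mul_pos_left h1 (sq_nonneg l)
  have hmaps : ∀ x ∈ V, ⌊x ^ 2⌋₊ < ⌊r ^ 2⌋₊ + 1 := fun x hx => by
    refine Nat.lt_succ_of_le (Nat.floor_le_floor ?_)
    rw [← sq_abs x]
    exact pow_le_pow_left₀ (abs_nonneg x) hx.2.2 2
  have hinj : Set.InjOn (fun x : ℝ => ⌊x ^ 2⌋₊) V := fun x hx y hy h => by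
    by_contra hne
    have h1 := hsep x hx y hy hne
    have h2 := Nat.floor_le (sq_nonneg x)
    have h3 := Nat.floor_le (sq_nonneg y)
    have h4 := Nat.lt_floor_add_one (x ^ 2)
    have h5 := Nat.lt_floor_add_one (y ^ 2)
    dsimp only at h
    rw [h] at h2 h4
    exact absurd h1 (not_le.2 (abs_lt.2 ⟨by linarith, by linarith⟩))
  have hfin : V.Finite := by
    refine Set.Finite.of_finite_image ((Finset.range (⌊r ^ 2⌋₊ + 1)).finite_toSet.subset ?_) hinj
    rintro _ ⟨x, hx, rfl⟩
    simpa using Nat.lt_succ_iff.1 (hmaps x hx)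
  refine ⟨hfin.toFinset, fun x => hfin.mem_toFinset, ?_⟩
  have h1 := Finset.card_le_card_of_injOn (s := hfin.toFinset)
    (t := Finset.range (⌊r ^ 2⌋₊ + 1)) (fun x : ℝ => ⌊x ^ 2⌋₊)
    (fun x hx => by simpa using Nat.lt_succ_iff.1 (hmaps x (by simpa using hx)))
    (by simpa using hinj)
  rw [Finset.card_range] at h1
  have h2 := Nat.floor_le (sq_nonneg r)
  have h3 : (hfin.toFinset.card : ℝ) ≤ ⌊r ^ 2⌋₊ + 1 := by exact_mod_cast h1
  linarith

theorem fourier_finset_sum {ι : Type*} (T : Finset ι) (d : ι → ℂ) (m : ι → ℝ → ℂ)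
    (hm : ∀ i, Integrable (m i)) (x : ℝ) :
    𝓕 (fun t => ∑ i ∈ T, d i * m i t) x = ∑ i ∈ T, d i * 𝓕 (m i) x := by
  simp only [Real.fourier_real_eq, Circle.smul_def, smul_eq_mul, Finset.mul_sum]
  rw [integral_finsetSum]
  · refine Finset.sum_congr rfl fun i _ => ?_
    rw [← integral_const_mul]
    congr 1; ext t; ring
  · intro i _
    have := (Real.fourierIntegral_convergent_iff x).2 ((hm i).const_mul (d i))
    simpa [Circle.smul_def, mul_comm] using this

/-- Dominated row sums for the interpolation matrix. -/
theorem sum_ingham_le {s : ℝ} (hs : 1 < s) (W : Finset ℝ)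
    (hsep : ∀ x ∈ W, ∀ y ∈ W, x ≠ y → s ^ 3 ≤ |x ^ 2 - y ^ 2|) (x : ℝ) (hx : x ∈ W) (g : ℝ → ℝ)
    (hg : ∀ y ∈ W, y ≠ x → ∀ u, 1 ≤ u → u * s ^ 3 ≤ |x ^ 2 - y ^ 2| →
      g y ≤ 1 / (s ^ 2 * (4 * u ^ 2 - 1))) :
    ∑ y ∈ W.erase x, g y ≤ 1 / s ^ 2 := by
  have hs0 : 0 < s := by linarith
  have half : ∀ T ⊆ W.erase x, ((∀ y ∈ T, x ^ 2 ≤ y ^ 2) ∨ ∀ y ∈ T, y ^ 2 ≤ x ^ 2) →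
      ∑ y ∈ T, g y ≤ 1 / s ^ 2 * (1 / 2) := fun T hT hsg => by
    have hu : ∀ y ∈ T, 1 ≤ |x ^ 2 - y ^ 2| / s ^ 3 := fun y hy => by
      rw [one_le_div (by positivity)]
      exact hsep x hx y (Finset.mem_of_mem_erase (hT hy)) (Finset.ne_of_mem_erase (hT hy)).symm
    have h1 := sum_floor_le T (fun y => |x ^ 2 - y ^ 2| / s ^ 3 - 1)
      (fun y hy => by linarith [hu y hy]) (fun y hy y' hy' hne => ?_)
      (φ := fun k : ℕ => 1 / (4 * ((k : ℝ) + 1) ^ 2 - 1)) (fun k => ?_) (S := 1 / 2) fun N => ?_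
    · calc ∑ y ∈ T, g y ≤ ∑ y ∈ T, 1 / s ^ 2 *
            (1 / (4 * ((⌊|x ^ 2 - y ^ 2| / s ^ 3 - 1⌋₊ : ℝ) + 1) ^ 2 - 1)) := by
            refine Finset.sum_le_sum fun y hy => ?_
            rw [one_div_mul_one_div]
            refine hg y (Finset.mem_of_mem_erase (hT hy)) (Finset.ne_of_mem_erase (hT hy)) _
              (by simp) ?_
            rw [← le_div_iff₀ (by positivity)]
            linarith [Nat.floor_le (sub_nonneg.2 (hu y hy))]
        _ ≤ _ := by
          rw [← Finset.mul_sum]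
          gcongr
    · rw [show |x ^ 2 - y ^ 2| / s ^ 3 - 1 - (|x ^ 2 - y' ^ 2| / s ^ 3 - 1) =
        (|x ^ 2 - y ^ 2| - |x ^ 2 - y' ^ 2|) / s ^ 3 by ring, abs_div, abs_of_pos (pow_pos hs0 3),
        one_le_div (by positivity)]
      refine (hsep y (Finset.mem_of_mem_erase (hT hy)) y' (Finset.mem_of_mem_erase (hT hy'))
        hne).trans (le_of_eq ?_)
      rcases hsg with h | h
      · rw [abs_of_nonpos (sub_nonpos.2 (h y hy)), abs_of_nonpos (sub_nonpos.2 (h y' hy'))]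
        congr 1; ring
      · rw [abs_of_nonneg (sub_nonneg.2 (h y hy)), abs_of_nonneg (sub_nonneg.2 (h y' hy')),
          abs_sub_comm]
        congr 1; ring
    · have : (0 : ℝ) < 4 * ((k : ℝ) + 1) ^ 2 - 1 := by
        have : (0 : ℝ) ≤ k := k.cast_nonneg
        nlinarith
      positivity
    · have : ∑ k ∈ Finset.range N, 1 / (4 * ((k : ℝ) + 1) ^ 2 - 1) =
          1 / 2 - 1 / (2 * (2 * (N : ℝ) + 1)) := by
        induction N with
        | zero => norm_num
        | succ n ih =>
          rw [Finset.sum_range_succ, ih]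
          have : (0 : ℝ) ≤ n := n.cast_nonneg
          have h1 : (4 * ((n : ℝ) + 1) ^ 2 - 1) = (2 * n + 1) * (2 * n + 3) := by ring
          rw [h1]
          push_cast
          have h3 : (2 * ((n : ℝ) + 1) + 1) = 2 * n + 3 := by ring
          rw [h3]
          field_simp
          ring
      rw [this]
      have : (0 : ℝ) ≤ 1 / (2 * (2 * (N : ℝ) + 1)) := by positivity
      linarith
  rw [← Finset.sum_filter_add_sum_filter_not (W.erase x) (fun y => x ^ 2 ≤ y ^ 2)]
  have h1 := half _ (Finset.filter_subset (fun y => x ^ 2 ≤ y ^ 2) _)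
    (Or.inl fun y hy => (Finset.mem_filter.1 hy).2)
  have h2 := half _ (Finset.filter_subset (fun y => ¬ x ^ 2 ≤ y ^ 2) _)
    (Or.inr fun y hy => (not_le.1 (Finset.mem_filter.1 hy).2).le)
  linarith

theorem exists_local_interpolant {s r : ℝ} (hs : 1 < s) (hr : 0 < r) (W : Finset ℝ)
    (hsep : ∀ x ∈ W, ∀ y ∈ W, x ≠ y → s ^ 3 ≤ |x ^ 2 - y ^ 2|) (hb : ∀ x ∈ W, |x| ≤ s * r)
    {l : ℝ} (hl : l ∈ W) :
    ∃ m : ℝ → ℂ, Integrable m ∧ (∀ t, r / s < |t| → m t = 0) ∧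
      (∫ t, ‖m t‖) ≤ 2 * (1 / (1 - 1 / s ^ 2)) * W.card ∧ 𝓕 m l = 1 ∧
      ∀ x ∈ W, x ≠ l → 𝓕 m x = 0 := by
  have hs0 : 0 < s := by linarith
  have hs1 : 1 / s ^ 2 < 1 := by
    rw [div_lt_one (by positivity)]; nlinarith
  choose m hmi hms hmn hm1 hmd using
    exists_bandlimited_kernel (c := 2 * r / s) (by positivity)
  have hrow : ∀ x ∈ W, ∑ y ∈ W.erase x, ‖𝓕 (m y) x‖ ≤ 1 / s ^ 2 := fun x hx => by
    refine sum_ingham_le hs W hsep x hx _ fun y hy hne u hu hux => ?_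
    have h1 : |x ^ 2 - y ^ 2| ≤ 2 * s * r * |x - y| := by
      rw [show x ^ 2 - y ^ 2 = (x + y) * (x - y) by ring, abs_mul]
      gcongr
      linarith [abs_add_le x y, hb x hx, hb y hy]
    have h2 : s * u ≤ 2 * r / s * |x - y| := by
      rw [div_mul_eq_mul_div, le_div_iff₀ hs0]
      refine le_of_mul_le_mul_left ?_ hs0
      linarith
    have h3 : s ^ 2 * u ^ 2 ≤ (2 * r / s) ^ 2 * (x - y) ^ 2 := by
      rw [← mul_pow, ← sq_abs (x - y), ← mul_pow]
      exact pow_le_pow_left₀ (by positivity) h2 2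
    have h4 : s ^ 2 * (4 * u ^ 2 - 1) ≤ 4 * (2 * r / s) ^ 2 * (x - y) ^ 2 - 1 := by nlinarith
    have h5 : 0 < s ^ 2 * (4 * u ^ 2 - 1) := mul_pos (by positivity) (by nlinarith)
    exact (hmd y x (by linarith)).trans (one_div_le_one_div_of_le h5 h4)
  let A : Matrix W W ℂ := fun x y => 𝓕 (m y) x
  have hA1 : ∀ x, A x x = 1 := fun x => hm1 x
  have hArow : ∀ x : W, ∑ y ∈ Finset.univ.erase x, ‖A x y‖ ≤ 1 / s ^ 2 := fun x => by
    refine le_of_eq_of_le ?_ (hrow x x.2)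
    have h1 := Finset.sum_erase_eq_sub (f := fun y => ‖A x y‖) (Finset.mem_univ x)
    have h2 := Finset.sum_erase_eq_sub (f := fun y => ‖𝓕 (m y) x‖) x.2
    rw [h1, h2, Finset.univ_eq_attach, Finset.sum_attach W fun y => ‖𝓕 (m y) x‖]
  have hdet : A.det ≠ 0 := det_ne_zero_of_sum_row_lt_diag fun x => by
    rw [hA1, norm_one]; exact (hArow x).trans_lt hs1
  set d : W → ℂ := A⁻¹.mulVec (Pi.single ⟨l, hl⟩ 1) with hd
  have hAd : A.mulVec d = Pi.single ⟨l, hl⟩ 1 := by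
    rw [hd, Matrix.mulVec_mulVec, Matrix.mul_nonsing_inv _ (isUnit_iff_ne_zero.2 hdet),
      Matrix.one_mulVec]
  have hdn : ∀ y, ‖d y‖ ≤ 1 / (1 - 1 / s ^ 2) := by
    obtain ⟨x, -, hx⟩ := Finset.exists_max_image Finset.univ (fun y => ‖d y‖)
      ⟨⟨l, hl⟩, Finset.mem_univ _⟩
    refine fun y => (hx y (Finset.mem_univ y)).trans ?_
    rw [le_div_iff₀ (by linarith)]
    have h1 : d x = (Pi.single ⟨l, hl⟩ 1 : W → ℂ) x - ∑ y ∈ Finset.univ.erase x, A x y * d y := by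
      rw [← hAd, Matrix.mulVec, dotProduct, ← Finset.add_sum_erase _ _ (Finset.mem_univ x), hA1]
      ring
    have h2 : ‖(Pi.single ⟨l, hl⟩ 1 : W → ℂ) x‖ ≤ 1 := by
      by_cases h : x = ⟨l, hl⟩
      · subst h; simp
      · simp [h]
    have h3 : ‖∑ y ∈ Finset.univ.erase x, A x y * d y‖ ≤ 1 / s ^ 2 * ‖d x‖ := by
      refine (norm_sum_le _ _).trans (le_trans ?_
        (mul_le_mul_of_nonneg_right (hArow x) (norm_nonneg (d x))))
      rw [Finset.sum_mul]
      refine Finset.sum_le_sum fun y _ => ?_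
      rw [norm_mul]
      exact mul_le_mul_of_nonneg_left (hx y (Finset.mem_univ y)) (norm_nonneg _)
    have h4 := norm_sub_le ((Pi.single ⟨l, hl⟩ 1 : W → ℂ) x)
      (∑ y ∈ Finset.univ.erase x, A x y * d y)
    rw [← h1] at h4
    linarith
  have hF : ∀ x : W, 𝓕 (fun t => ∑ y : W, d y * m y t) x =
      (Pi.single ⟨l, hl⟩ 1 : W → ℂ) x := fun x => by
    rw [fourier_finset_sum _ _ _ (fun y : W => hmi y), ← hAd, Matrix.mulVec, dotProduct]
    exact Finset.sum_congr rfl fun y _ => mul_comm _ _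
  have hInt : Integrable fun t => ∑ y : W, d y * m y t :=
    integrable_finsetSum _ fun y _ => (hmi y).const_mul _
  refine ⟨fun t => ∑ y : W, d y * m y t, hInt, fun t ht => ?_, ?_, ?_, fun x hx hxl => ?_⟩
  · refine Finset.sum_eq_zero fun y _ => ?_
    rw [hms y t (by rwa [mul_div_assoc, mul_div_cancel_left₀ _ two_ne_zero]), mul_zero]
  · have h1 : ∀ t, ‖∑ y : W, d y * m y t‖ ≤ ∑ y : W, ‖d y‖ * ‖m y t‖ := fun t =>
      (norm_sum_le _ _).trans_eq (Finset.sum_congr rfl fun y _ => norm_mul _ _)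
    refine (integral_mono hInt.norm (integrable_finsetSum Finset.univ fun (y : W) _ =>
      (hmi y).norm.const_mul ‖d y‖) h1).trans ?_
    rw [integral_finsetSum _ fun (y : W) _ => (hmi y).norm.const_mul _]
    have h2 : ∀ y ∈ (Finset.univ : Finset W), ∫ t, ‖d y‖ * ‖m y t‖ ≤
        1 / (1 - 1 / s ^ 2) * 2 := fun y _ => by
      rw [integral_const_mul]
      exact mul_le_mul (hdn y) (hmn y) (integral_nonneg fun _ => norm_nonneg _)
        (one_div_nonneg.2 (by linarith))
    refine (Finset.sum_le_sum h2).trans (le_of_eq ?_)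
    simp
    ring
  · simpa using hF ⟨l, hl⟩
  · have := hF ⟨x, hx⟩
    rwa [Pi.single_eq_of_ne (by simpa using hxl)] at this

/-- For each node there is a function equal to `1` there, tiny at all other nodes of the same
family and with Gaussian decay in space and frequency. -/
theorem exists_atom {s : ℝ} (hs : 1 < s) : ∃ p ρ a D : ℝ, 0 < p ∧ p < ρ ∧ 0 < a ∧ 0 < D ∧
    ∀ X : Set ℝ, SqSep (s ^ 3) X → (∀ x ∈ X, x ≠ 0) → ∀ l ∈ X, ∃ f : ℝ → ℂ, Continuous f ∧
      f l = 1 ∧ (∀ x, ‖f x‖ ≤ D * (l ^ 2 + 1) * exp (p * l ^ 2 - a * x ^ 2)) ∧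
      (∀ x, ‖𝓕 f x‖ ≤ D * (l ^ 2 + 1) * exp (p * l ^ 2 - a * x ^ 2)) ∧
      (∀ x ∈ X, x ≠ l → ‖f x‖ ≤ D * (l ^ 2 + 1) * exp (p * l ^ 2 - ρ * x ^ 2)) ∧
      ∀ x, ‖𝓕 f x‖ ≤ D * (l ^ 2 + 1) * exp (p * l ^ 2 - ρ * x ^ 2) := by
  have hs0 : 0 < s := by linarith
  have hs1 : 1 / s ^ 2 < 1 := by
    rw [div_lt_one (by positivity)]; nlinarith
  obtain ⟨θ, hθ⟩ : ∃ θ, θ = 1 / s := ⟨_, rfl⟩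
  have hθ0 : 0 < θ := by rw [hθ]; positivity
  have hθ1 : θ < 1 := by rw [hθ, div_lt_one hs0]; exact hs
  have hθs : θ * s = 1 := by rw [hθ]; field_simp
  have hθ2 : (1 - θ) ^ 2 ≤ 1 - θ := by nlinarith
  have hd : 0 < 1 - θ := by linarith
  obtain ⟨ρ, hρ⟩ : ∃ ρ, ρ = π * (1 - θ) ^ 2 := ⟨_, rfl⟩
  have hρ0 : 0 < ρ := by rw [hρ]; have := pi_pos; positivity
  obtain ⟨p, hp⟩ : ∃ p, p = θ * ρ := ⟨_, rfl⟩
  have hp0 : 0 < p := by rw [hp]; positivity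
  obtain ⟨β, hβ⟩ : ∃ β, β = π * p / (π + p) := ⟨_, rfl⟩
  have hpp : 0 < π + p := by have := pi_pos; positivity
  have hβ0 : 0 < β := by rw [hβ]; have := pi_pos; positivity
  have hD : 0 < 2 * (1 / (1 - 1 / s ^ 2)) := by
    have : 0 < 1 - 1 / s ^ 2 := by linarith
    positivity
  refine ⟨p, ρ, min β ρ, 2 * (1 / (1 - 1 / s ^ 2)) * s ^ 2, hp0, by rw [hp]; nlinarith,
    lt_min hβ0 hρ0, by positivity, fun X hX h0 l hl => ?_⟩
  have hl0 : 0 < |l| := abs_pos.2 (h0 l hl)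
  have hs3 : 1 ≤ s ^ 3 := one_le_pow₀ hs.le
  obtain ⟨W, hW, hWc⟩ := exists_window hs3 hX l (s * |l|)
  have hlW : l ∈ W := (hW l).2 ⟨hl, mul_self_pos.2 (h0 l hl), by nlinarith⟩
  obtain ⟨m, hmi, hms, hmn, hm1, hm0⟩ := exists_local_interpolant hs hl0 W
    (fun x hx y hy hne => by
      obtain ⟨h1, h2, -⟩ := (hW x).1 hx
      obtain ⟨h3, h4, -⟩ := (hW y).1 hy
      refine hX x h1 y h3 hne ?_
      have h5 : 0 < x * y * l ^ 2 := by nlinarith [mul_pos h2 h4]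
      exact pos_of_mul_pos_left h5 (sq_nonneg l)) (fun x hx => ((hW x).1 hx).2.2) hlW
  have hP : (∫ t, ‖m t‖) ≤ 2 * (1 / (1 - 1 / s ^ 2)) * s ^ 2 * (l ^ 2 + 1) := by
    refine hmn.trans ?_
    rw [mul_assoc _ (s ^ 2)]
    gcongr
    refine hWc.trans ?_
    rw [mul_pow, sq_abs]
    nlinarith
  obtain ⟨hc, hf, hF⟩ := bandlimited_mul_gaussian hmi hms l
  have hfb : ∀ x E, -π * (x - l) ^ 2 ≤ E → ‖𝓕 m x * (exp (-π * (x - l) ^ 2) : ℝ)‖ ≤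
      2 * (1 / (1 - 1 / s ^ 2)) * s ^ 2 * (l ^ 2 + 1) * exp E := fun x E hE => by
    refine (hf x).trans ?_
    gcongr
  have hFb : ∀ x, ‖𝓕 (fun x : ℝ => 𝓕 m x * (exp (-π * (x - l) ^ 2) : ℝ)) x‖ ≤
      2 * (1 / (1 - 1 / s ^ 2)) * s ^ 2 * (l ^ 2 + 1) * exp (p * l ^ 2 - ρ * x ^ 2) := fun x => by
    refine (hF x (exp (p * l ^ 2 - ρ * x ^ 2)) fun t ht => ?_).trans ?_
    · rw [exp_le_exp]
      have h1 : t ^ 2 ≤ θ ^ 2 * l ^ 2 := by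
        rw [← sq_abs t, ← sq_abs l, ← mul_pow, hθ, div_mul_eq_mul_div, one_mul]
        exact pow_le_pow_left₀ (abs_nonneg _) ht 2
      have h2 : (1 - θ) * (x ^ 2 - θ * l ^ 2) ≤ (t + x) ^ 2 := by
        have h3 : θ * ((t + x) ^ 2 - (1 - θ) * (x ^ 2 - θ * l ^ 2)) =
          (θ * x + t) ^ 2 + (1 - θ) * (θ ^ 2 * l ^ 2 - t ^ 2) := by ring
        have h4 : 0 ≤ θ * ((t + x) ^ 2 - (1 - θ) * (x ^ 2 - θ * l ^ 2)) := by
          rw [h3]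
          exact add_nonneg (sq_nonneg _) (mul_nonneg hd.le (by linarith))
        linarith [nonneg_of_mul_nonneg_right h4 hθ0]
      have h3 : (1 - θ) ^ 2 * (x ^ 2 - θ * l ^ 2) ≤ (t + x) ^ 2 := by
        rcases le_total 0 (x ^ 2 - θ * l ^ 2) with h | h
        · exact (mul_le_mul_of_nonneg_right hθ2 h).trans h2
        · exact (mul_nonpos_of_nonneg_of_nonpos (sq_nonneg _) h).trans (sq_nonneg _)
      have h4 := mul_le_mul_of_nonneg_left h3 pi_pos.le
      rw [hp, hρ]
      linarith
    · gcongr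
  refine ⟨_, hc, by simp [hm1], fun x => hfb x _ ?_, fun x => (hFb x).trans ?_,
    fun x hx hxl => ?_, hFb⟩
  · have h1 : β * x ^ 2 ≤ π * (x - l) ^ 2 + p * l ^ 2 := by
      rw [hβ, div_mul_eq_mul_div, div_le_iff₀ hpp]
      nlinarith [sq_nonneg (π * x - (π + p) * l)]
    nlinarith [min_le_left β ρ, sq_nonneg x]
  · gcongr
    exact min_le_right _ _
  · by_cases hxW : x ∈ W
    · rw [hm0 x hxW hxl, zero_mul, norm_zero]
      positivity
    refine hfb x _ ?_
    have h1 : (1 - θ) ^ 2 * x ^ 2 ≤ (x - l) ^ 2 := by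
      by_cases hxl0 : 0 < x * l
      · have h2 : s * |l| < |x| := by
          by_contra h
          exact hxW ((hW x).2 ⟨hx, hxl0, not_lt.1 h⟩)
        have h3 : |l| ≤ θ * |x| := by nlinarith
        rw [← sq_abs x, ← mul_pow, ← sq_abs (x - l)]
        refine pow_le_pow_left₀ (by positivity) ?_ 2
        linarith [abs_sub_abs_le_abs_sub x l]
      · nlinarith [sq_nonneg x, sq_nonneg l]
    have h4 := mul_le_mul_of_nonneg_left h1 pi_pos.le
    rw [hρ]
    nlinarith [mul_nonneg hp0.le (sq_nonneg l)]

/-- Absolutely convergent superposition of functions with uniform Gaussian decay. -/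
theorem exists_schwartzMap_tsum {I : Type*} [Countable I] {f : I → SchwartzMap ℝ ℂ} {w : I → ℝ}
    {a : ℝ} (ha : 0 < a) (hf : ∀ i x, ‖f i x‖ ≤ w i * exp (-a * x ^ 2))
    (hF : ∀ i x, ‖𝓕 (⇑(f i)) x‖ ≤ w i * exp (-a * x ^ 2)) {c : I → ℂ}
    (hc : Summable fun i => ‖c i‖ * w i) :
    ∃ h : SchwartzMap ℝ ℂ, (∀ x, HasSum (fun i => c i * f i x) (h x)) ∧
      (∀ x, HasSum (fun i => c i * 𝓕 (⇑(f i)) x) (𝓕 (⇑h) x)) ∧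
      ∃ C, ∀ x, ‖h x‖ + ‖𝓕 (⇑h) x‖ ≤ C * exp (-a * x ^ 2) := by
  have hw : ∀ i, 0 ≤ w i := fun i => by simpa using (norm_nonneg _).trans (hf i 0)
  have hsx : ∀ x : ℝ, Summable fun i => ‖c i‖ * w i * exp (-a * x ^ 2) := fun x => hc.mul_right _
  have b1 : ∀ i x, ‖c i * f i x‖ ≤ ‖c i‖ * w i * exp (-a * x ^ 2) := fun i x => by
    rw [norm_mul, mul_assoc]; gcongr; exact hf i x
  have b2 : ∀ i x, ‖c i * 𝓕 (⇑(f i)) x‖ ≤ ‖c i‖ * w i * exp (-a * x ^ 2) := fun i x => by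
    rw [norm_mul, mul_assoc]; gcongr; exact hF i x
  have s1 : ∀ x, HasSum (fun i => c i * f i x) (∑' i, c i * f i x) := fun x =>
    (Summable.of_norm_bounded (hsx x) fun i => b1 i x).hasSum
  have s2 : ∀ x, HasSum (fun i => c i * 𝓕 (⇑(f i)) x) (𝓕 (fun x => ∑' i, c i * f i x) x) := by
    intro x
    have e1 : ∀ t : ℝ, ‖Complex.exp (↑(-2 * π * t * x) * Complex.I)‖ = 1 := fun t =>
      Complex.norm_exp_ofReal_mul_I _
    have hn : ∀ i (t : ℝ), ‖Complex.exp (↑(-2 * π * t * x) * Complex.I) * (c i * f i t)‖ =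
        ‖c i * f i t‖ := fun i t => by rw [norm_mul, e1, one_mul]
    have hfi : ∀ i, Integrable fun t => c i * f i t := fun i => (f i).integrable.const_mul (c i)
    have h1 := hasSum_integral_of_summable_integral_norm (μ := volume)
      (F := fun i (t : ℝ) => Complex.exp (↑(-2 * π * t * x) * Complex.I) * (c i * f i t))
      (fun i => (hfi i).norm.mono' (by fun_prop) (ae_of_all _ fun t => (hn i t).le)) ?_
    · have h2 : ∀ i, c i * 𝓕 (⇑(f i)) x =
          ∫ t : ℝ, Complex.exp (↑(-2 * π * t * x) * Complex.I) * (c i * f i t) := fun i => by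
        rw [Real.fourier_real_eq_integral_exp_smul, ← integral_const_mul]
        congr 1; ext t; simp only [smul_eq_mul]; ring
      simp only [h2]
      rw [Real.fourier_real_eq_integral_exp_smul]
      simpa only [smul_eq_mul, tsum_mul_left] using h1
    · simp only [hn]
      refine Summable.of_nonneg_of_le (fun i => integral_nonneg fun _ => norm_nonneg _)
        (fun i => ?_) (hc.mul_right (∫ x : ℝ, exp (-a * x ^ 2)))
      rw [← integral_const_mul]
      exact integral_mono (hfi i).norm ((integrable_exp_neg_mul_sq ha).const_mul _) (b1 i)
  have n1 : ∀ x, ‖∑' i, c i * f i x‖ ≤ (∑' i, ‖c i‖ * w i) * exp (-a * x ^ 2) := fun x => by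
    rw [← tsum_mul_right]
    exact tsum_of_norm_bounded (hsx x).hasSum fun i => b1 i x
  have n2 : ∀ x, ‖𝓕 (fun x => ∑' i, c i * f i x) x‖ ≤
      (∑' i, ‖c i‖ * w i) * exp (-a * x ^ 2) := fun x => by
    rw [← tsum_mul_right, ← (s2 x).tsum_eq]
    exact tsum_of_norm_bounded (hsx x).hasSum fun i => b2 i x
  have hcont : Continuous fun x => ∑' i, c i * f i x :=
    continuous_tsum (fun i => continuous_const.mul (f i).continuous) hc fun i x =>
      (b1 i x).trans (mul_le_of_le_one_right (mul_nonneg (norm_nonneg _) (hw i))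
        (exp_le_one_iff.2 (by nlinarith [sq_nonneg x])))
  obtain ⟨h, hh⟩ := exists_schwartzMap_of_gaussian ha hcont n1 n2
  refine ⟨h, ?_, ?_, 2 * ∑' i, ‖c i‖ * w i, ?_⟩
  · intro x; rw [hh]; exact s1 x
  · intro x; rw [hh]; exact s2 x
  · intro x; rw [hh]; linarith [n1 x, n2 x]

theorem exists_dual_function {s : ℝ} (hs : 1 < s) : ∃ R₀ a : ℝ, 0 < R₀ ∧ 0 < a ∧
    ∀ X Y : Set ℝ, X.Countable → Y.Countable → SqSep (s ^ 3) X → SqSep (s ^ 3) Y →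
      (∀ x ∈ X, R₀ ≤ |x|) → (∀ y ∈ Y, R₀ ≤ |y|) → ∀ x₀ ∈ X, ∃ h : SchwartzMap ℝ ℂ, h x₀ = 1 ∧
        (∀ x ∈ X, x ≠ x₀ → h x = 0) ∧ (∀ y ∈ Y, 𝓕 (⇑h) y = 0) ∧
        ∃ C, ∀ x, ‖h x‖ + ‖𝓕 (⇑h) x‖ ≤ C * exp (-a * x ^ 2) := by
  obtain ⟨p, ρ, a, D, hp, hpρ, ha, hD, hatom⟩ := exists_atom hs
  obtain ⟨η, hη⟩ : ∃ η, η = (ρ - p) / 2 := ⟨_, rfl⟩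
  have hη0 : 0 < η := by rw [hη]; linarith
  obtain ⟨M, hM⟩ : ∃ M, M = 2 / (1 - exp (-η)) := ⟨_, rfl⟩
  have hq : 0 < 1 - exp (-η) := by simpa using hη0
  have hM1 : 1 ≤ M := by
    rw [hM, one_le_div hq]; linarith [exp_pos (-η)]
  have hR : 0 < 8 * (4 * D * M) / η ^ 2 := by positivity
  have hs3 : 1 ≤ s ^ 3 := one_le_pow₀ hs.le
  have hbig : ∀ l : ℝ, 1 + 8 * (4 * D * M) / η ^ 2 ≤ |l| →
      4 * D * M * (l ^ 2 + 1) ≤ exp (η * l ^ 2) := fun l hl => by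
    have h1 : 1 + 8 * (4 * D * M) / η ^ 2 ≤ l ^ 2 := by
      rw [← sq_abs l]; nlinarith
    have h2 : 8 * (4 * D * M) ≤ η ^ 2 * l ^ 2 := by
      rw [← div_le_iff₀' (by positivity)]; linarith
    have h3 : (η * l ^ 2 / 2) ^ 2 ≤ exp (η * l ^ 2) := by
      rw [show η * l ^ 2 = (2 : ℕ) * (η * l ^ 2 / 2) by push_cast; ring, exp_nat_mul]
      have h0 : 0 ≤ η * l ^ 2 := by positivity
      refine pow_le_pow_left₀ (by positivity) ?_ 2
      have := add_one_le_exp (η * l ^ 2 / 2)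
      push_cast
      linarith
    refine le_trans ?_ h3
    have h4 : 4 * D * M * (l ^ 2 + 1) ≤ 4 * D * M * (2 * l ^ 2) := by
      gcongr; linarith
    nlinarith [sq_nonneg l]
  have hgauss : ∀ X : Set ℝ, SqSep (s ^ 3) X → (∀ x ∈ X, x ≠ 0) → ∀ T : Finset X,
      ∑ x ∈ T, exp (-η * (x : ℝ) ^ 2) ≤ M := fun X hX h0 T => by
    have := sum_gaussian_le hs3 hX h0 hη0 (T.map (Function.Embedding.subtype _)) (by simp)
    rwa [Finset.sum_map, ← hM] at this
  have hschw : ∀ X : Set ℝ, SqSep (s ^ 3) X → (∀ x ∈ X, x ≠ 0) → ∀ l : X,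
      ∃ f : SchwartzMap ℝ ℂ, f l = 1 ∧
      (∀ x, ‖f x‖ ≤ D * ((l : ℝ) ^ 2 + 1) * exp (p * (l : ℝ) ^ 2) * exp (-a * x ^ 2)) ∧
      (∀ x, ‖𝓕 (⇑f) x‖ ≤ D * ((l : ℝ) ^ 2 + 1) * exp (p * (l : ℝ) ^ 2) * exp (-a * x ^ 2)) ∧
      (∀ x ∈ X, x ≠ l → ‖f x‖ ≤ D * ((l : ℝ) ^ 2 + 1) * exp (p * (l : ℝ) ^ 2 - ρ * x ^ 2)) ∧
      ∀ x, ‖𝓕 (⇑f) x‖ ≤ D * ((l : ℝ) ^ 2 + 1) * exp (p * (l : ℝ) ^ 2 - ρ * x ^ 2) := by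
    intro X hX h0 l
    obtain ⟨f, hc, h1, h2, h3, h4, h5⟩ := hatom X hX h0 l l.2
    simp only [sub_eq_add_neg _ (a * _), exp_add, ← mul_assoc, ← neg_mul] at h2 h3
    obtain ⟨F, rfl⟩ := exists_schwartzMap_of_gaussian ha hc h2 h3
    exact ⟨F, h1, h2, h3, h4, h5⟩
  refine ⟨1 + 8 * (4 * D * M) / η ^ 2, a, by positivity, ha,
    fun X Y hXc hYc hX hY hXR hYR x₀ hx₀ => ?_⟩
  have hne : ∀ x, 1 + 8 * (4 * D * M) / η ^ 2 ≤ |x| → x ≠ 0 := fun x hx h => by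
    rw [h, abs_zero] at hx; linarith
  have := hXc.to_subtype
  have := hYc.to_subtype
  classical
  choose f f1 f2 f3 f4 f5 using hschw X hX fun x hx => hne x (hXR x hx)
  choose g g1 g2 g3 g4 g5 using hschw Y hY fun x hx => hne x (hYR x hx)
  have gi : ∀ y x, (𝓕⁻ (g y) : SchwartzMap ℝ ℂ) x = 𝓕 (⇑(g y)) (-x) := fun y x => by
    rw [SchwartzMap.fourierInv_coe, Real.fourierInv_eq_fourier_neg]
  have gf : ∀ y x, 𝓕 (⇑(𝓕⁻ (g y) : SchwartzMap ℝ ℂ)) x = g y x := fun y x => by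
    rw [← SchwartzMap.fourier_coe, FourierTransform.fourier_fourierInv_eq]
  let r : X ⊕ Y → ℝ := Sum.elim Subtype.val Subtype.val
  let F : X ⊕ Y → SchwartzMap ℝ ℂ := Sum.elim f fun y => 𝓕⁻ (g y)
  let ev : X ⊕ Y → SchwartzMap ℝ ℂ → ℂ := fun i h =>
    Sum.elim (fun x : X => h x) (fun y : Y => 𝓕 (⇑h) y) i
  let K : X ⊕ Y → X ⊕ Y → ℂ := fun i j => if i = j then 0 else ev i (F j)
  let w : X ⊕ Y → ℝ := fun i => exp ((p + η) * r i ^ 2)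
  have hrR : ∀ i, 1 + 8 * (4 * D * M) / η ^ 2 ≤ |r i| := by
    rintro (x | y)
    · exact hXR x x.2
    · exact hYR y y.2
  have hQ : ∀ i, 4 * M * (D * (r i ^ 2 + 1) * exp (p * r i ^ 2)) ≤ w i := fun i => by
    have := mul_le_mul_of_nonneg_right (hbig _ (hrR i)) (exp_pos (p * r i ^ 2)).le
    rw [← exp_add] at this
    refine le_trans (le_of_eq ?_) (this.trans (le_of_eq ?_))
    · ring
    · simp only [w]; ring_nf
  have hQ1 : ∀ i, D * (r i ^ 2 + 1) * exp (p * r i ^ 2) ≤ w i := fun i => by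
    have h0 : 0 ≤ D * (r i ^ 2 + 1) * exp (p * r i ^ 2) := by positivity
    nlinarith [hQ i]
  have hev : ∀ i, ev i (F i) = 1 := by
    rintro (x | y)
    · exact f1 x
    · exact (gf y y).trans (g1 y)
  have hKb : ∀ i j, ‖K i j‖ ≤ D * (r j ^ 2 + 1) * exp (p * r j ^ 2 - ρ * r i ^ 2) := by
    intro i j
    by_cases hij : i = j
    · simp only [K, if_pos hij, norm_zero]; positivity
    simp only [K, if_neg hij]
    rcases i with x | y <;> rcases j with x' | y'
    · exact f4 x' x x.2 fun h => hij (by rw [Subtype.ext h])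
    · refine (congrArg norm (gi y' x)).trans_le ((g5 y' (-x)).trans_eq ?_)
      simp [r]
    · exact f5 x' y
    · exact (congrArg norm (gf y' y)).trans_le (g4 y' y y.2 fun h => hij (by rw [Subtype.ext h]))
  have hsumT : ∀ T : Finset (X ⊕ Y), ∑ i ∈ T, exp (-η * r i ^ 2) ≤ 2 * M := fun T => by
    rw [← T.toLeft_disjSum_toRight, Finset.sum_disjSum, two_mul]
    exact add_le_add (hgauss X hX (fun x hx => hne x (hXR x hx)) _)
      (hgauss Y hY (fun x hx => hne x (hYR x hx)) _)
  have hKw : ∀ j i, ‖K i j‖ * w i ≤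
      D * (r j ^ 2 + 1) * exp (p * r j ^ 2) * exp (-η * r i ^ 2) := fun j i => by
    refine (mul_le_mul_of_nonneg_right (hKb i j) (exp_pos _).le).trans_eq ?_
    rw [mul_assoc, mul_assoc (D * _), ← exp_add, ← exp_add]
    congr 2
    rw [hη]; ring
  have hKT : ∀ j (T : Finset (X ⊕ Y)), ∑ i ∈ T, ‖K i j‖ * w i ≤ w j / 2 := fun j T => by
    refine (Finset.sum_le_sum fun i _ => hKw j i).trans ?_
    rw [← Finset.mul_sum]
    have := mul_le_mul_of_nonneg_left (hsumT T)
      (by positivity : 0 ≤ D * (r j ^ 2 + 1) * exp (p * r j ^ 2))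
    linarith [hQ j]
  have hpos : ∀ j i, 0 ≤ ‖K i j‖ * w i := fun j i => mul_nonneg (norm_nonneg _) (exp_pos _).le
  obtain ⟨c, hc, hcK⟩ := exists_weighted_solution K w (fun i => exp_pos _)
    (fun j => summable_of_sum_le (hpos j) (hKT j))
    (fun j => Real.tsum_le_of_sum_le (hpos j) (hKT j)) (Sum.inl ⟨x₀, hx₀⟩)
  have hF1 : ∀ i x, ‖F i x‖ ≤ w i * exp (-a * x ^ 2) := fun i x => by
    refine le_trans ?_ (mul_le_mul_of_nonneg_right (hQ1 i) (exp_pos _).le)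
    rcases i with x' | y
    · exact f2 x' x
    · refine (congrArg norm (gi y x)).trans_le ((g3 y (-x)).trans_eq ?_)
      simp [r]
  have hF2 : ∀ i x, ‖𝓕 (⇑(F i)) x‖ ≤ w i * exp (-a * x ^ 2) := fun i x => by
    refine le_trans ?_ (mul_le_mul_of_nonneg_right (hQ1 i) (exp_pos _).le)
    rcases i with x' | y
    · exact f3 x' x
    · exact (congrArg norm (gf y x)).trans_le (g2 y x)
  obtain ⟨h, hh, hhF, hC⟩ := exists_schwartzMap_tsum ha hF1 hF2 hc
  have hval : ∀ i, ev i h = if i = Sum.inl ⟨x₀, hx₀⟩ then 1 else 0 := fun i => by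
    have h1 : HasSum (fun j => c j * ev i (F j)) (ev i h) := by
      rcases i with x | y
      · exact hh x
      · exact hhF y
    have h2 : HasSum (fun j => if j = i then c i else 0) (c i) :=
      hasSum_ite_eq i (c i)
    have h3 := (h1.sub h2).tsum_eq
    rw [← hcK i, add_comm, ← sub_eq_iff_eq_add, ← h3]
    refine tsum_congr fun j => ?_
    by_cases hij : i = j
    · subst hij; simp [K, hev]
    · simp [K, hij, Ne.symm hij]
  refine ⟨h, ?_, fun x hx hxx => ?_, fun y hy => ?_, hC⟩
  · exact (hval (Sum.inl ⟨x₀, hx₀⟩)).trans (if_pos rfl)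
  · exact (hval (Sum.inl ⟨x, hx⟩)).trans (if_neg (by simpa using hxx))
  · exact (hval (Sum.inr ⟨y, hy⟩)).trans (if_neg (by simp))

theorem exists_eventually_le_of_lt_liminf {ι : Type*} {F : Filter ι} {u : ι → ℝ} {c₀ : ℝ}
    (h0 : 0 ≤ c₀) (h : c₀ < liminf u F) : ∃ c, c₀ < c ∧ ∀ᶠ i in F, c ≤ u i := by
  rw [liminf_eq] at h
  rcases Set.eq_empty_or_nonempty {a | ∀ᶠ i in F, a ≤ u i} with he | he
  · rw [he, Real.sSup_empty] at h
    exact absurd h h0.not_gt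
  · obtain ⟨c, hc, hlt⟩ := exists_lt_of_lt_csSup he h
    exact ⟨c, hlt, hc⟩

/-- A supercritical sequence has squares growing faster than the index, on both sides. -/
theorem exists_sq_growth {Λ : ℤ → ℝ} (hmono : StrictMono Λ)
    (hd1 : 1 / 2 < liminf (fun i : ℤ => (Λ (i + 1) - Λ i) * |Λ i|) atTop)
    (hd2 : 1 / 2 < liminf (fun i : ℤ => (Λ (i + 1) - Λ i) * |Λ i|) atBot) :
    ∃ b R : ℝ, 1 < b ∧ 0 < R ∧ ∀ (i : ℤ) (n : ℕ),
      (R ≤ Λ i → b * n ≤ Λ (i + n) ^ 2 - Λ i ^ 2) ∧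
      (Λ (i + n) ≤ -R → b * n ≤ Λ i ^ 2 - Λ (i + n) ^ 2) := by
  obtain ⟨c₁, hc₁, h1⟩ := exists_eventually_le_of_lt_liminf (by norm_num) hd1
  obtain ⟨c₂, hc₂, h2⟩ := exists_eventually_le_of_lt_liminf (by norm_num) hd2
  obtain ⟨N₁, hN₁⟩ := eventually_atTop.1 h1
  obtain ⟨N₂, hN₂⟩ := eventually_atBot.1 h2
  obtain ⟨b, hb⟩ : ∃ b, b = min (2 * c₁) (c₂ + 1 / 2) := ⟨_, rfl⟩
  have hb1 : b ≤ 2 * c₁ := hb ▸ min_le_left _ _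
  have hb2 : b ≤ c₂ + 1 / 2 := hb ▸ min_le_right _ _
  obtain ⟨R, hR1, hRc, hRN₁, hRN₂⟩ : ∃ R : ℝ, 1 ≤ R ∧ c₂ ^ 2 / (c₂ - 1 / 2) ≤ R ∧
      Λ N₁ ≤ R ∧ -Λ N₂ ≤ R := by
    refine ⟨max (max 1 (c₂ ^ 2 / (c₂ - 1 / 2))) (max (Λ N₁) (-Λ N₂)), ?_, ?_, ?_, ?_⟩ <;> simp
  have hpos : ∀ i, R ≤ Λ i → b ≤ Λ (i + 1) ^ 2 - Λ i ^ 2 := fun i hi => by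
    have hd := hN₁ i (hmono.le_iff_le.1 (hRN₁.trans hi))
    have hlt := hmono (Int.lt_add_one_iff.2 le_rfl : i < i + 1)
    rw [abs_of_pos (by linarith)] at hd
    nlinarith
  have hneg : ∀ i, Λ (i + 1) ≤ -R → b ≤ Λ i ^ 2 - Λ (i + 1) ^ 2 := fun i hi => by
    have hlt := hmono (Int.lt_add_one_iff.2 le_rfl : i < i + 1)
    have hd := hN₂ i (hmono.le_iff_le.1 (by linarith))
    rw [abs_of_neg (by linarith)] at hd
    obtain ⟨A, hA⟩ : ∃ A, A = -Λ i := ⟨_, rfl⟩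
    obtain ⟨e, he⟩ : ∃ e, e = c₂ / A := ⟨_, rfl⟩
    have hAR : R ≤ A := by linarith
    have hA0 : 0 < A := by linarith
    have heA : e * A = c₂ := by rw [he]; field_simp
    have h3 : e ≤ Λ (i + 1) - Λ i := by
      rw [he, div_le_iff₀ hA0, hA]; exact hd
    have h4 : e ^ 2 ≤ c₂ - 1 / 2 := by
      rw [div_le_iff₀ (by linarith)] at hRc
      rw [he, div_pow, div_le_iff₀ (by positivity)]
      have : R ≤ A ^ 2 := by nlinarith
      nlinarith
    have h5 : 0 ≤ (Λ (i + 1) - Λ i - e) * (2 * A - (Λ (i + 1) - Λ i) - e) :=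
      mul_nonneg (by linarith) (by linarith)
    have h6 : Λ i = -A := by linarith
    rw [h6] at h5 ⊢
    nlinarith
  refine ⟨b, R, hb ▸ lt_min (by linarith) (by linarith), by linarith, fun i n => ?_⟩
  induction n with
  | zero => simp
  | succ n ih =>
    have hle : Λ i ≤ Λ (i + n) := hmono.monotone (by simp)
    have hle' : Λ (i + n) ≤ Λ (i + n + 1) := hmono.monotone (by simp)
    push_cast
    rw [← add_assoc, mul_add, mul_one]
    refine ⟨fun h => ?_, fun h => ?_⟩
    · linarith [ih.1 h, hpos (i + n) (h.trans hle)]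
    · linarith [ih.2 (hle'.trans h), hneg (i + n) h]

theorem sqSep_of_sq_growth {Λ : ℤ → ℝ} {b R : ℝ} (hb : 0 ≤ b)
    (h : ∀ (i : ℤ) (n : ℕ), (R ≤ Λ i → b * n ≤ Λ (i + n) ^ 2 - Λ i ^ 2) ∧
      (Λ (i + n) ≤ -R → b * n ≤ Λ i ^ 2 - Λ (i + n) ^ 2)) :
    SqSep b {x | R ≤ |x| ∧ x ∈ Set.range Λ} := by
  have key : ∀ (i : ℤ) (n : ℕ), R ≤ |Λ i| → R ≤ |Λ (i + n)| → n ≠ 0 → 0 < Λ i * Λ (i + n) →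
      b ≤ |Λ i ^ 2 - Λ (i + n) ^ 2| := fun i n hi hj hn hp => by
    have hbn : b ≤ b * n := le_mul_of_one_le_right hb (by exact_mod_cast Nat.one_le_iff_ne_zero.2 hn)
    rcases pos_and_pos_or_neg_and_neg_of_mul_pos hp with ⟨h1, -⟩ | ⟨-, h2⟩
    · rw [abs_of_pos h1] at hi
      rw [abs_sub_comm]
      exact hbn.trans (((h i n).1 hi).trans (le_abs_self _))
    · rw [abs_of_neg h2] at hj
      exact hbn.trans (((h i n).2 (by linarith)).trans (le_abs_self _))
  rintro _ ⟨hx, i, rfl⟩ _ ⟨hy, j, rfl⟩ hne hp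
  rcases le_total i j with hij | hij
  · obtain ⟨n, rfl⟩ := Int.le.dest hij
    exact key i n hx hy (by rintro rfl; simp at hne) hp
  · obtain ⟨n, rfl⟩ := Int.le.dest hij
    rw [abs_sub_comm]
    exact key j n hy hx (by rintro rfl; simp at hne) (by rwa [mul_comm])

/-- Discarding few indices leaves only nodes that are large, and very large on the right. -/
theorem exists_finset_card_le {Λ : ℤ → ℝ} {b R : ℝ} (hb : 0 < b) (hR : 0 < R)
    (hmono : StrictMono Λ) (htop : Tendsto Λ atTop atTop) (hbot : Tendsto Λ atBot atBot)
    (h : ∀ (i : ℤ) (n : ℕ), R ≤ Λ i → b * n ≤ Λ (i + n) ^ 2 - Λ i ^ 2) :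
    ∃ K : ℕ, ∀ t : ℝ, ∃ D : Finset ℤ, D.card ≤ K + ⌈t / b⌉₊ ∧
      ∀ i ∉ D, R ≤ |Λ i| ∧ (Λ i < 0 ∨ t ≤ Λ i ^ 2) := by
  obtain ⟨p, hp⟩ := (htop.eventually_ge_atTop R).exists
  obtain ⟨q, hq⟩ := (hbot.eventually_le_atBot (-R)).exists
  refine ⟨(p - q).toNat, fun t => ⟨Finset.Ioo q (p + ⌈t / b⌉₊), ?_, fun i hi => ?_⟩⟩
  · rw [Int.card_Ioo]; omega
  rw [Finset.mem_Ioo, not_and_or, not_lt, not_lt] at hi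
  rcases hi with hi | hi
  · have h1 := hmono.monotone hi
    rw [abs_of_neg (by linarith)]
    exact ⟨by linarith, Or.inl (by linarith)⟩
  · have h1 := hmono.monotone hi
    have h2 : Λ p ≤ Λ (p + ⌈t / b⌉₊) := hmono.monotone (by simp)
    have h3 := h p ⌈t / b⌉₊ hp
    have h4 : t ≤ b * ⌈t / b⌉₊ := by
      rw [← div_le_iff₀' hb]; exact Nat.le_ceil _
    rw [abs_of_pos (by linarith)]
    exact ⟨by linarith, Or.inr (by nlinarith)⟩

/-- Nodes on the positive half-line can be replaced by finitely many equally spaced squares. -/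
theorem SqSep.union_grid {q : ℝ} (hq : 0 < q) {X : Set ℝ} (hX : SqSep q X) (m n : ℕ)
    (hXm : ∀ x ∈ X, x < 0 ∨ q * (m + n) ≤ x ^ 2) :
    SqSep q (X ∪ Set.range fun k : Fin n => √(q * (m + (k : ℕ)))) := by
  have hsq : ∀ k : Fin n, √(q * (m + (k : ℕ))) ^ 2 = q * (m + (k : ℕ)) := fun k =>
    sq_sqrt (by positivity)
  have key : ∀ x ∈ X, ∀ k : Fin n, 0 < x * √(q * (m + (k : ℕ))) →
      q ≤ |x ^ 2 - √(q * (m + (k : ℕ))) ^ 2| := fun x hx k hp => by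
    have h1 : (k : ℝ) + 1 ≤ n := by exact_mod_cast k.2
    rcases hXm x hx with h | h
    · exact absurd hp (mul_nonpos_of_nonpos_of_nonneg h.le (sqrt_nonneg _)).not_gt
    · rw [hsq]
      refine le_trans ?_ (le_abs_self _)
      nlinarith
  rintro x (hx | ⟨k, rfl⟩) y (hy | ⟨l, rfl⟩) hne hp
  · exact hX x hx y hy hne hp
  · exact key x hx l hp
  · rw [abs_sub_comm]
    exact key y hy k (by rwa [mul_comm])
  · dsimp only
    rw [hsq, hsq, ← mul_sub, abs_mul, abs_of_pos hq, add_sub_add_left_eq_sub]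
    have hkl : ((k : ℕ) : ℤ) - (l : ℕ) ≠ 0 := fun h => hne (by
      rw [show k = l from Fin.ext (by omega)])
    exact le_mul_of_one_le_right hq.le (by exact_mod_cast Int.one_le_abs hkl)

theorem Submodule.not_finiteDimensional_of_forall {𝕜 V : Type*} [Field 𝕜] [AddCommGroup V]
    [Module 𝕜 V] (E : Submodule 𝕜 V)
    (h : ∀ d : ℕ, ∃ (n : ℕ) (ι : Type) (_ : Fintype ι) (S : (Fin n → 𝕜) →ₗ[𝕜] V)
      (L : V →ₗ[𝕜] ι → 𝕜), Function.Injective S ∧ Fintype.card ι + d < n ∧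
        ∀ c, L (S c) = 0 → S c ∈ E) : ¬ FiniteDimensional 𝕜 E := by
  intro hE
  obtain ⟨n, ι, _, S, L, hS, hn, hSE⟩ := h (Module.finrank 𝕜 E)
  have h1 := LinearMap.finrank_range_add_finrank_ker (L ∘ₗ S)
  have h2 := Submodule.finrank_le (LinearMap.range (L ∘ₗ S))
  have h3 : Module.finrank 𝕜 (LinearMap.ker (L ∘ₗ S)) ≤ Module.finrank 𝕜 E := by
    refine LinearMap.finrank_le_finrank_of_injective
      (f := (S.domRestrict (LinearMap.ker (L ∘ₗ S))).codRestrict E fun c => hSE c c.2) ?_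
    intro c c' hcc
    exact Subtype.ext (hS (congrArg Subtype.val hcc))
  rw [Module.finrank_fintype_fun_eq_card] at h2
  rw [Module.finrank_fin_fun] at h1
  omega

/-- Schwartz functions with Gaussian time-frequency decay vanishing on `Λ`, with Fourier transform
vanishing on `Γ`. -/
def nodalSpace (Λ Γ : ℤ → ℝ) (α : ℝ) : Submodule ℂ (SchwartzMap ℝ ℂ) where
  carrier := {f | (∀ i, f (Λ i) = 0) ∧ (∀ i, 𝓕 (⇑f) (Γ i) = 0) ∧
    ∃ C : ℝ, ∀ x, ‖f x‖ + ‖𝓕 (⇑f) x‖ ≤ C * exp (-α * x ^ 2)}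
  zero_mem' := by
    have h : ∀ x, 𝓕 (⇑(0 : SchwartzMap ℝ ℂ)) x = 0 := fun x => by
      rw [← SchwartzMap.fourier_coe, FourierTransform.fourier_zero, zero_apply]
    exact ⟨fun i => rfl, fun i => h _, 0, fun x => by rw [h]; simp⟩
  add_mem' := by
    rintro f g ⟨hf, hf', C, hC⟩ ⟨hg, hg', C', hC'⟩
    have h : ∀ x, 𝓕 (⇑(f + g)) x = 𝓕 (⇑f) x + 𝓕 (⇑g) x := fun x => by
      rw [← SchwartzMap.fourier_coe, FourierTransform.fourier_add, add_apply]
      rfl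
    refine ⟨fun i => by simp [hf, hg], fun i => by rw [h, hf', hg', add_zero], C + C', fun x => ?_⟩
    rw [h, add_apply, add_mul]
    linarith [hC x, hC' x, norm_add_le (f x) (g x), norm_add_le (𝓕 (⇑f) x) (𝓕 (⇑g) x)]
  smul_mem' := by
    rintro c f ⟨hf, hf', C, hC⟩
    have h : ∀ x, 𝓕 (⇑(c • f)) x = c * 𝓕 (⇑f) x := fun x => by
      rw [← SchwartzMap.fourier_coe, FourierTransform.fourier_smul, smul_apply]
      rfl
    refine ⟨fun i => by simp [hf], fun i => by rw [h, hf', mul_zero], ‖c‖ * C, fun x => ?_⟩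
    rw [h, smul_apply, smul_eq_mul, norm_mul, norm_mul, ← mul_add, mul_assoc]
    exact mul_le_mul_of_nonneg_left (hC x) (norm_nonneg c)

theorem exists_nodalSpace_not_finiteDimensional {Λ Γ : ℤ → ℝ} {b RΛ RΓ : ℝ} (hb : 1 < b)
    (hΛmono : StrictMono Λ) (hΛtop : Tendsto Λ atTop atTop) (hΛbot : Tendsto Λ atBot atBot)
    (hΓmono : StrictMono Γ) (hΓtop : Tendsto Γ atTop atTop) (hΓbot : Tendsto Γ atBot atBot)
    (hΛ : ∀ (i : ℤ) (n : ℕ), (RΛ ≤ Λ i → b * n ≤ Λ (i + n) ^ 2 - Λ i ^ 2) ∧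
      (Λ (i + n) ≤ -RΛ → b * n ≤ Λ i ^ 2 - Λ (i + n) ^ 2))
    (hΓ : ∀ (i : ℤ) (n : ℕ), (RΓ ≤ Γ i → b * n ≤ Γ (i + n) ^ 2 - Γ i ^ 2) ∧
      (Γ (i + n) ≤ -RΓ → b * n ≤ Γ i ^ 2 - Γ (i + n) ^ 2)) :
    ∃ a, 0 < a ∧ ∀ α, α < a → ¬ FiniteDimensional ℂ (nodalSpace Λ Γ α) := by
  obtain ⟨s, hs, hsb⟩ : ∃ s : ℝ, 1 < s ∧ s ^ 3 < b := by
    have h1 : 1 < √(√b) := by rwa [lt_sqrt zero_le_one, one_pow, lt_sqrt zero_le_one, one_pow]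
    refine ⟨√(√b), h1, ?_⟩
    have h4 : √(√b) ^ 4 = b := by
      rw [show 4 = 2 * 2 from rfl, pow_mul, sq_sqrt (sqrt_nonneg _), sq_sqrt (by linarith)]
    calc √(√b) ^ 3 < √(√b) ^ 4 := pow_lt_pow_right₀ h1 (by norm_num)
      _ = b := h4
  obtain ⟨R₀, a, hR₀, ha, hdual⟩ := exists_dual_function hs
  obtain ⟨q, hq⟩ : ∃ q, q = s ^ 3 := ⟨_, rfl⟩
  rw [← hq] at hsb hdual
  have hq0 : 0 < q := by rw [hq]; positivity
  obtain ⟨R, hRR, hRΛ, hRΓ⟩ : ∃ R, R₀ ≤ R ∧ RΛ ≤ R ∧ RΓ ≤ R :=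
    ⟨max R₀ (max RΛ RΓ), by simp, by simp, by simp⟩
  have hR : 0 < R := hR₀.trans_le hRR
  obtain ⟨m, hm⟩ := exists_nat_ge (R ^ 2 / q)
  rw [div_le_iff₀' hq0] at hm
  have hb0 : 0 < b := by linarith
  have hΛ' : ∀ (i : ℤ) (n : ℕ), (R ≤ Λ i → b * n ≤ Λ (i + n) ^ 2 - Λ i ^ 2) ∧
      (Λ (i + n) ≤ -R → b * n ≤ Λ i ^ 2 - Λ (i + n) ^ 2) := fun i n =>
    ⟨fun h => (hΛ i n).1 (hRΛ.trans h), fun h => (hΛ i n).2 (by linarith)⟩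
  have hΓ' : ∀ (i : ℤ) (n : ℕ), (R ≤ Γ i → b * n ≤ Γ (i + n) ^ 2 - Γ i ^ 2) ∧
      (Γ (i + n) ≤ -R → b * n ≤ Γ i ^ 2 - Γ (i + n) ^ 2) := fun i n =>
    ⟨fun h => (hΓ i n).1 (hRΓ.trans h), fun h => (hΓ i n).2 (by linarith)⟩
  obtain ⟨K₁, hK₁⟩ := exists_finset_card_le hb0 hR hΛmono hΛtop hΛbot fun i n => (hΛ' i n).1
  obtain ⟨K₂, hK₂⟩ := exists_finset_card_le hb0 hR hΓmono hΓtop hΓbot fun i n => (hΓ' i n).1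
  refine ⟨a, ha, fun α hα => Submodule.not_finiteDimensional_of_forall _ fun d => ?_⟩
  obtain ⟨n, hn⟩ : ∃ n : ℕ, (K₁ + ⌈q * (m + n) / b⌉₊) + K₂ + d < n := by
    obtain ⟨n, hn⟩ := exists_nat_gt ((K₁ + K₂ + d + 1 + q * m / b) / (1 - q / b))
    refine ⟨n, ?_⟩
    have hqb : q / b < 1 := by rwa [div_lt_one hb0]
    rw [div_lt_iff₀ (by linarith)] at hn
    have h1 := Nat.ceil_lt_add_one (by positivity : 0 ≤ q * (m + n) / b)
    have h2 : q * (m + n) / b = q * m / b + n * (q / b) := by ring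
    have h3 : ((K₁ + ⌈q * (m + n) / b⌉₊ + K₂ + d : ℕ) : ℝ) < n := by
      push_cast
      linarith
    exact_mod_cast h3
  obtain ⟨D₁, hD₁, hD₁'⟩ := hK₁ (q * (m + n))
  obtain ⟨D₂, hD₂, hD₂'⟩ := hK₂ 0
  have hX0 := sqSep_of_sq_growth hb0.le hΛ'
  have hY0 := sqSep_of_sq_growth hb0.le hΓ'
  obtain ⟨X₁, hX₁⟩ : ∃ X₁ : Set ℝ, X₁ = {x | R ≤ |x| ∧ x ∈ Set.range Λ} ∩
    {x | x < 0 ∨ q * (m + n) ≤ x ^ 2} := ⟨_, rfl⟩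
  obtain ⟨g, hg⟩ : ∃ g : Fin n → ℝ, g = fun k : Fin n => √(q * (m + (k : ℕ))) := ⟨_, rfl⟩
  have hg2 : ∀ k, g k ^ 2 = q * (m + (k : ℕ)) := fun k => by
    rw [hg]; exact sq_sqrt (by positivity)
  have hgR : ∀ k, R ≤ |g k| := fun k => by
    rw [← abs_of_pos hR, ← sq_le_sq, hg2]
    nlinarith [(Nat.cast_nonneg (k : ℕ) : (0 : ℝ) ≤ (k : ℕ))]
  have hginj : Function.Injective g := fun k l hkl => by
    have := hg2 k
    rw [hkl, hg2 l] at this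
    have h1 : ((l : ℕ) : ℝ) = (k : ℕ) := by
      have := mul_left_cancel₀ hq0.ne' this
      linarith
    exact Fin.ext (by exact_mod_cast h1.symm)
  have hXc : (X₁ ∪ Set.range g).Countable := by
    refine .union ?_ (Set.countable_range g)
    rw [hX₁]
    exact (Set.countable_range Λ).mono fun x hx => hx.1.2
  have hYc : {x | R ≤ |x| ∧ x ∈ Set.range Γ}.Countable :=
    (Set.countable_range Γ).mono fun x hx => hx.2
  have hXs : SqSep q (X₁ ∪ Set.range g) := by
    rw [hg]
    refine SqSep.union_grid hq0 (fun x hx y hy hne hp => ?_) m n fun x hx => ?_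
    · rw [hX₁] at hx hy
      exact hsb.le.trans (hX0 x hx.1 y hy.1 hne hp)
    · rw [hX₁] at hx
      exact hx.2
  have hXR : ∀ x ∈ X₁ ∪ Set.range g, R₀ ≤ |x| := by
    rintro x (hx | ⟨k, rfl⟩)
    · rw [hX₁] at hx
      exact hRR.trans hx.1.1
    · exact hRR.trans (hgR k)
  have hdual' := fun k : Fin n => hdual _ _ hXc hYc hXs
    (fun x hx y hy hne hp => hsb.le.trans (hY0 x hx y hy hne hp)) hXR
    (fun y hy => hRR.trans hy.1) (g k) (Or.inr ⟨k, rfl⟩)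
  choose h h1 h2 h3 h4 using hdual'
  have hbi : ∀ k l, h k (g l) = if k = l then 1 else 0 := fun k l => by
    split_ifs with hkl
    · rw [← hkl, h1]
    · exact h2 k _ (Or.inr ⟨l, rfl⟩) fun e => hkl (hginj e).symm
  let evΛ : ℝ → SchwartzMap ℝ ℂ →ₗ[ℂ] ℂ := fun x =>
    { toFun := fun f => f x, map_add' := fun _ _ => rfl, map_smul' := fun _ _ => rfl }
  let evΓ : ℝ → SchwartzMap ℝ ℂ →ₗ[ℂ] ℂ := fun x =>
    { toFun := fun f => (𝓕 f : SchwartzMap ℝ ℂ) x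
      map_add' := fun f g => by rw [FourierTransform.fourier_add, add_apply]
      map_smul' := fun c f => by
        rw [FourierTransform.fourier_smul, smul_apply, RingHom.id_apply] }
  let S := Fintype.linearCombination ℂ h
  have hSΛ : ∀ c x, S c x = ∑ k, c k * h k x := fun c x => by
    change evΛ x (S c) = _
    rw [Fintype.linearCombination_apply, map_sum]
    rfl
  have hSΓ : ∀ c x, 𝓕 (⇑(S c)) x = ∑ k, c k * 𝓕 (⇑(h k)) x := fun c x => by
    change evΓ x (S c) = _
    rw [Fintype.linearCombination_apply, map_sum]
    simp only [map_smul, smul_eq_mul]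
    rfl
  refine ⟨n, D₁ ⊕ D₂, inferInstance, S,
    LinearMap.pi (Sum.elim (fun i => evΛ (Λ i)) fun i => evΓ (Γ i)), ?_, ?_, fun c hc => ?_⟩
  · intro c c' hcc
    ext k
    have e : ∀ c : Fin n → ℂ, S c (g k) = c k := fun c => by
      simp [hSΛ, hbi]
    rw [← e c, hcc, e]
  · rw [Fintype.card_sum, Fintype.card_coe, Fintype.card_coe]
    rw [zero_div, Nat.ceil_zero] at hD₂
    omega
  refine ⟨fun i => ?_, fun i => ?_, ?_⟩
  · by_cases hi : i ∈ D₁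
    · exact congrFun hc (Sum.inl ⟨i, hi⟩)
    · rw [hSΛ]
      refine Finset.sum_eq_zero fun k _ => ?_
      obtain ⟨hi1, hi2⟩ := hD₁' i hi
      rw [h2 k _ (Or.inl (hX₁ ▸ ⟨⟨hi1, i, rfl⟩, hi2⟩)), mul_zero]
      intro e
      have h5 : (k : ℝ) + 1 ≤ n := by exact_mod_cast k.2
      rcases hi2 with h6 | h6
      · rw [e, hg] at h6
        exact (sqrt_nonneg _).not_gt h6
      · rw [e, hg2] at h6
        nlinarith
  · by_cases hi : i ∈ D₂
    · exact congrFun hc (Sum.inr ⟨i, hi⟩)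
    · rw [hSΓ]
      exact Finset.sum_eq_zero fun k _ => by
        rw [h3 k _ ⟨(hD₂' i hi).1, i, rfl⟩, mul_zero]
  · choose C hC using h4
    refine ⟨∑ k, ‖c k‖ * |C k|, fun x => ?_⟩
    rw [hSΛ, hSΓ, Finset.sum_mul]
    refine (add_le_add (norm_sum_le _ _) (norm_sum_le _ _)).trans ?_
    rw [← Finset.sum_add_distrib]
    refine Finset.sum_le_sum fun k _ => ?_
    rw [norm_mul, norm_mul, ← mul_add, mul_assoc]
    refine mul_le_mul_of_nonneg_left ((hC k x).trans ?_) (norm_nonneg _)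
    refine mul_le_mul (le_abs_self _) (exp_le_exp.2 ?_) (exp_pos _).le (abs_nonneg _)
    nlinarith [sq_nonneg x]

/-- Theorem 2(II): for supercritical sequences there is an
infinite-dimensional space of Schwartz functions with Gaussian space-frequency decay all
vanishing on the nodes; in particular there are discrete Pauli partners which are not
Pauli partners. -/
theorem supercritical_counterexample (Λ Γ : ℤ → ℝ)
    (hΛmono : StrictMono Λ) (hΛtop : Tendsto Λ atTop atTop) (hΛbot : Tendsto Λ atBot atBot)
    (hΓmono : StrictMono Γ) (hΓtop : Tendsto Γ atTop atTop) (hΓbot : Tendsto Γ atBot atBot)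
    (hΛd1 : 1 / 2 < liminf (fun i : ℤ => (Λ (i + 1) - Λ i) * |Λ i|) atTop)
    (hΛd2 : 1 / 2 < liminf (fun i : ℤ => (Λ (i + 1) - Λ i) * |Λ i|) atBot)
    (hΓd1 : 1 / 2 < liminf (fun i : ℤ => (Γ (i + 1) - Γ i) * |Γ i|) atTop)
    (hΓd2 : 1 / 2 < liminf (fun i : ℤ => (Γ (i + 1) - Γ i) * |Γ i|) atBot) :
    ∃ a₀ : ℝ, 0 < a₀ ∧
      ∀ α : ℝ, 0 < α → α < a₀ →
        ∃ E : Submodule ℂ (SchwartzMap ℝ ℂ),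
          ¬ FiniteDimensional ℂ ↥E ∧
          (∀ f ∈ E,
            (∀ i : ℤ, f (Λ i) = 0) ∧ (∀ i : ℤ, 𝓕 (⇑f) (Γ i) = 0) ∧
            ∃ Cf : ℝ, ∀ x : ℝ, ‖f x‖ + ‖𝓕 (⇑f) x‖ ≤ Cf * Real.exp (-α * x ^ 2)) ∧
          ∃ f ∈ E, ∃ g ∈ E,
            (∀ i : ℤ, ‖f (Λ i)‖ = ‖g (Λ i)‖) ∧
            (∀ i : ℤ, ‖𝓕 (⇑f) (Γ i)‖ = ‖𝓕 (⇑g) (Γ i)‖) ∧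
            ¬ (∀ x : ℝ, ‖f x‖ = ‖g x‖) ∧ ¬ (∀ ξ : ℝ, ‖𝓕 (⇑f) ξ‖ = ‖𝓕 (⇑g) ξ‖) := by
  obtain ⟨b₁, R₁, hb₁, hR₁, hΛ⟩ := exists_sq_growth hΛmono hΛd1 hΛd2
  obtain ⟨b₂, R₂, hb₂, hR₂, hΓ⟩ := exists_sq_growth hΓmono hΓd1 hΓd2
  have hmin₁ : ∀ n : ℕ, min b₁ b₂ * n ≤ b₁ * n := fun n => by gcongr; exact min_le_left _ _
  have hmin₂ : ∀ n : ℕ, min b₁ b₂ * n ≤ b₂ * n := fun n => by gcongr; exact min_le_right _ _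
  obtain ⟨a, ha, hE⟩ := exists_nodalSpace_not_finiteDimensional (lt_min hb₁ hb₂)
    hΛmono hΛtop hΛbot hΓmono hΓtop hΓbot
    (fun i n => ⟨fun h => (hmin₁ n).trans ((hΛ i n).1 h), fun h => (hmin₁ n).trans ((hΛ i n).2 h)⟩)
    (fun i n => ⟨fun h => (hmin₂ n).trans ((hΓ i n).1 h), fun h => (hmin₂ n).trans ((hΓ i n).2 h)⟩)
  refine ⟨a, ha, fun α _ hα => ⟨nodalSpace Λ Γ α, hE α hα, fun f hf => hf, ?_⟩⟩
  obtain ⟨f, hf, hf0⟩ := (nodalSpace Λ Γ α).ne_bot_iff.1 fun h => hE α hα (by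
    rw [h]; infer_instance)
  have hz := (nodalSpace Λ Γ α).zero_mem
  have hfz : ∀ x, 𝓕 (⇑(0 : SchwartzMap ℝ ℂ)) x = 0 := fun x => by
    rw [← SchwartzMap.fourier_coe, FourierTransform.fourier_zero, zero_apply]
  refine ⟨f, hf, 0, hz, fun i => by rw [hf.1, hz.1], fun i => by rw [hf.2.1, hz.2.1],
    fun h => hf0 ?_, fun h => hf0 ?_⟩
  · ext x
    simpa using h x
  · have h0 : (𝓕 f : SchwartzMap ℝ ℂ) = 0 := by
      ext x
      exact norm_eq_zero.1 ((h x).trans (by rw [hfz, norm_zero]))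
    rw [← FourierTransform.fourierInv_fourier_eq (F := SchwartzMap ℝ ℂ) f, h0,
      FourierTransform.fourierInv_zero]
end

section
/- Let d ≥ 1 and let (λ_i)_{i∈ℕ} and (γ_i)_{i∈ℕ} be strictly increasing sequences of positive reals tending to ∞ with liminf_{i→∞}(λ_{i+1}−λ_i)λ_i > 1/2 and liminf_{i→∞}(γ_{i+1}−γ_i)γ_i > 1/2. Then there exists a₀ > 0 such that for every α ∈ (0, a₀) there is an infinite-dimensional complex subspace E_α of the Schwartz space 𝓢(ℝ^d) such that every f ∈ E_α satisfies |f(x)| + |𝓕f(x)| ≤ C_f e^{−α|x|²} for all x ∈ ℝ^d (for some constant C_f depending on f), f(λ_i·u) = 0 and 𝓕f(γ_i·u) = 0 for every i ∈ ℕ and every unit vector u ∈ ℝ^d. In particular there exist f, g ∈ E_α with |f(λ_i·u)| = |g(λ_i·u)| and |𝓕f(γ_i·u)| = |𝓕g(γ_i·u)| for all i ∈ ℕ and all unit vectors u, but |f| is not identically equal to |g| and |𝓕f| is not identically equal to |𝓕g|. -/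
open MeasureTheory Filter Real
open scoped FourierTransform

/-- A matrix on `ℓ¹` whose columns are uniformly close to those of the identity hits every
basis vector. -/
lemma exists_summable_mulVec_eq_single {ι : Type*} [DecidableEq ι] (A : ι → ι → ℂ) {ρ : ℝ}
    (hρ : ρ < 1)
    (hsum : ∀ m, Summable fun j => ‖A j m - if j = m then 1 else 0‖)
    (hle : ∀ m, ∑' j, ‖A j m - if j = m then 1 else 0‖ ≤ ρ) (p : ι) :
    ∃ c : ι → ℂ, (Summable fun m => ‖c m‖) ∧
      ∀ j, ∑' m, c m * A j m = if j = p then 1 else 0 := by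
  have hρ0 : 0 ≤ ρ := (tsum_nonneg fun _ => norm_nonneg _).trans (hle p)
  let V := lp (fun _ : ι => ℂ) 1
  have hmem : ∀ m, Memℓp (fun j => A j m - if j = m then 1 else 0) 1 := fun m =>
    memℓp_gen (by simpa using hsum m)
  let col : ι → V := fun m => ⟨_, hmem m⟩
  have hcol : ∀ m, ‖col m‖ ≤ ρ := by
    intro m
    rw [lp.norm_eq_tsum_rpow (by simp)]
    simpa [col] using hle m
  have hV : ∀ c : V, Summable fun m => ‖c m‖ := fun c => by
    simpa using (lp.memℓp c).summable (by simp)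
  have hnV : ∀ c : V, ‖c‖ = ∑' m, ‖c m‖ := fun c => by
    rw [lp.norm_eq_tsum_rpow (by simp)]; simp
  have hb : ∀ (c : V) m, ‖c m • col m‖ ≤ ‖c m‖ * ρ := fun c m => by
    rw [norm_smul]; gcongr; exact hcol m
  have hS : ∀ c : V, Summable fun m => c m • col m := fun c =>
    Summable.of_norm_bounded ((hV c).mul_right ρ) (hb c)
  let L : V →ₗ[ℂ] V :=
    { toFun := fun c => ∑' m, c m • col m
      map_add' := fun c c' => by
        rw [← (hS c).tsum_add (hS c')]
        simp [add_smul]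
      map_smul' := fun a c => by
        rw [RingHom.id_apply, ← (hS c).tsum_const_smul]
        exact tsum_congr fun m => mul_smul a (c m) (col m) }
  let M : V →L[ℂ] V := L.mkContinuous ρ fun c => by
    refine (tsum_of_norm_bounded ((hV c).mul_right ρ).hasSum (hb c)).trans_eq ?_
    rw [tsum_mul_right, hnV, mul_comm]
  have hM : ‖-M‖ < 1 := by
    rw [norm_neg]
    exact (L.mkContinuous_norm_le hρ0 _).trans_lt hρ
  let U := Units.oneSub (-M) hM
  let e : V := lp.single 1 p 1
  let c : V := (↑U⁻¹ : V →L[ℂ] V) e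
  have hc : c + M c = e := by
    have h : ((U : V →L[ℂ] V) * (↑U⁻¹ : V →L[ℂ] V)) e = e := by rw [U.mul_inv]; rfl
    have hU : (U : V →L[ℂ] V) = 1 - -M := rfl
    rw [hU] at h
    simpa using h
  refine ⟨c, hV c, fun j => ?_⟩
  have hMj : (M c) j = ∑' m, c m * (A j m - if j = m then 1 else 0) := by
    have := (lp.evalCLM ℂ (fun _ : ι => ℂ) 1 j).map_tsum (hS c)
    exact this.trans (tsum_congr fun m => rfl)
  have hj := congrArg (fun v : V => v j) hc
  have hbd : ∀ m, ‖A j m - if j = m then 1 else 0‖ ≤ ρ := fun m =>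
    ((hsum m).le_tsum j fun _ _ => norm_nonneg _).trans (hle m)
  have hs1 : Summable fun m => c m * (A j m - if j = m then 1 else 0) :=
    Summable.of_norm_bounded ((hV c).mul_right ρ) fun m => by
      rw [norm_mul]; gcongr; exact hbd m
  have hs2 : HasSum (fun m => c m * if j = m then 1 else 0) (c j) := by
    convert hasSum_ite_eq j (c j) using 2 with m
    by_cases h : j = m
    · subst h; simp
    · simp [h, Ne.symm h]
  have hsplit : ∑' m, c m * A j m
      = ∑' m, c m * (A j m - if j = m then 1 else 0) + c j := by
    rw [← hs2.tsum_eq, ← hs1.tsum_add hs2.summable]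
    refine tsum_congr fun m => ?_
    ring
  rw [hsplit, ← hMj, add_comm]
  simpa [e, Pi.single_apply] using hj

/-- Telescoping bound: `∑_{j ≠ m} 1 / (4 (j - m)² - 1) ≤ 1`. -/
lemma sum_range_inv_four_sq_sub_one_le (m L : ℕ) (h : m < L) :
    ∑ j ∈ Finset.range L,
      (if j = m then (0 : ℝ) else 1 / (4 * ((j : ℝ) - m) ^ 2 - 1)) ≤ 1 := by
  let F : ℕ → ℝ := fun j => 1 / (2 * ((j : ℝ) - m) - 1) / 2
  have hF : ∀ j : ℕ, (if j = m then (0 : ℝ) else 1 / (4 * ((j : ℝ) - m) ^ 2 - 1))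
      = (F j - F (j + 1)) + if j = m then 1 else 0 := by
    intro j
    by_cases hj : j = m
    · subst hj; norm_num [F]
    · have h1 : (2 * ((j : ℝ) - m) - 1) ≠ 0 := by
        intro h0
        have : (2 * (j : ℤ) - 2 * m - 1 : ℤ) = 0 := by
          have : ((2 * (j : ℤ) - 2 * m - 1 : ℤ) : ℝ) = 0 := by push_cast; linarith
          exact_mod_cast this
        omega
      have h2 : (2 * ((j : ℝ) + 1 - m) - 1) ≠ 0 := by
        intro h0
        have : (2 * (j : ℤ) - 2 * m + 1 : ℤ) = 0 := by
          have : ((2 * (j : ℤ) - 2 * m + 1 : ℤ) : ℝ) = 0 := by push_cast; linarith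
          exact_mod_cast this
        omega
      have h3 : 4 * ((j : ℝ) - m) ^ 2 - 1
          = (2 * ((j : ℝ) - m) - 1) * (2 * ((j : ℝ) + 1 - m) - 1) := by ring
      simp only [hj, if_false, F, h3, Nat.cast_add, Nat.cast_one]
      field_simp
      ring
  rw [Finset.sum_congr rfl fun j _ => hF j, Finset.sum_add_distrib, Finset.sum_range_sub',
    Finset.sum_ite_eq' (Finset.range L) m, if_pos (Finset.mem_range.2 h)]
  have hL : (m : ℝ) + 1 ≤ L := by exact_mod_cast h
  have h0 : F 0 ≤ 0 := by
    have : 2 * (((0 : ℕ) : ℝ) - m) - 1 ≤ 0 := by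
      have : (0 : ℝ) ≤ m := by positivity
      push_cast; linarith
    have := one_div_nonpos.2 this
    simp only [F]; linarith
  have h1 : 0 ≤ F L := by
    have : 0 ≤ 2 * ((L : ℝ) - m) - 1 := by linarith
    simp only [F]; positivity
  linarith

/-- The profile `t ↦ ∫ k(s) exp (-π (η - i s) t) ds` of a superposition of complex Gaussians. -/
noncomputable def gaussMix (b η : ℝ) (k : ℝ → ℂ) (t : ℝ) : ℂ :=
  ∫ s in -b..b, k s * Complex.exp (-(π * (η - s * Complex.I)) * t)

lemma norm_cexp_gaussMix (η s t : ℝ) :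
    ‖Complex.exp (-(π * (η - s * Complex.I)) * t)‖ = Real.exp (-(π * η) * t) := by
  rw [Complex.norm_exp]
  congr 1
  simp

lemma norm_gaussMix_le {b η : ℝ} (hb : 0 ≤ b) (k : ℝ → ℂ) (t : ℝ) :
    ‖gaussMix b η k t‖ ≤ (∫ s in -b..b, ‖k s‖) * Real.exp (-(π * η) * t) := by
  refine (intervalIntegral.norm_integral_le_integral_norm (by linarith)).trans_eq ?_
  rw [← intervalIntegral.integral_mul_const]
  simp only [norm_mul, norm_cexp_gaussMix]

lemma hasDerivAt_gaussMix (b η : ℝ) {k : ℝ → ℂ} (hk : Continuous k) (t : ℝ) :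
    HasDerivAt (gaussMix b η k)
      (gaussMix b η (fun s => k s * -(π * (η - s * Complex.I))) t) t := by
  refine (intervalIntegral.hasDerivAt_integral_of_dominated_loc_of_deriv_le
    (x₀ := t) (s := Metric.ball t 1)
    (F := fun (t : ℝ) s => k s * Complex.exp (-(π * (η - s * Complex.I)) * t))
    (F' := fun (t : ℝ) s => k s * -(π * (η - s * Complex.I)) *
      Complex.exp (-(π * (η - s * Complex.I)) * t))
    (bound := fun s => ‖k s * -(π * (η - s * Complex.I))‖ * Real.exp (|π * η| * (|t| + 1)))
    (Metric.ball_mem_nhds t one_pos) (Eventually.of_forall fun x => ?_) ?_ ?_ ?_ ?_ ?_).2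
  · exact (by fun_prop : Continuous _).aestronglyMeasurable
  · exact (by fun_prop : Continuous _).intervalIntegrable _ _
  · exact (by fun_prop : Continuous _).aestronglyMeasurable
  · refine Eventually.of_forall fun s _ x hx => ?_
    rw [norm_mul, norm_cexp_gaussMix]
    refine mul_le_mul_of_nonneg_left (Real.exp_le_exp.2 ?_) (norm_nonneg _)
    rw [Metric.mem_ball, Real.dist_eq] at hx
    have hx' : |x| ≤ |t| + 1 := by
      have := abs_sub_abs_le_abs_sub x t
      linarith
    calc -(π * η) * x ≤ |-(π * η) * x| := le_abs_self _
      _ = |π * η| * |x| := by rw [abs_mul, abs_neg]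
      _ ≤ _ := by gcongr
  · exact (by fun_prop : Continuous _).intervalIntegrable _ _
  · refine Eventually.of_forall fun s _ x _ => ?_
    have h1 : HasDerivAt (fun x : ℝ => -(π * (η - s * Complex.I)) * (x : ℂ))
        (-(π * (η - s * Complex.I))) x := by
      simpa using (Complex.ofRealCLM.hasDerivAt (x := x)).const_mul (-(π * (η - s * Complex.I)))
    refine (h1.cexp.const_mul (k s)).congr_deriv ?_
    ring

lemma iteratedDeriv_gaussMix (b η : ℝ) (n : ℕ) {k : ℝ → ℂ} (hk : Continuous k) :
    iteratedDeriv n (gaussMix b η k)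
      = gaussMix b η (fun s => k s * (-(π * (η - s * Complex.I))) ^ n) := by
  induction n with
  | zero => simp
  | succ n ih =>
    rw [iteratedDeriv_succ, ih]
    funext t
    rw [(hasDerivAt_gaussMix b η (by fun_prop) t).deriv]
    simp only [pow_succ, mul_assoc]

lemma contDiff_gaussMix (b η : ℝ) {k : ℝ → ℂ} (hk : Continuous k) :
    ContDiff ℝ (⊤ : ℕ∞) (gaussMix b η k) := by
  refine contDiff_of_differentiable_iteratedDeriv fun m _ t => ?_
  rw [iteratedDeriv_gaussMix b η m hk]
  exact (hasDerivAt_gaussMix b η (by fun_prop) t).differentiableAt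

lemma exists_one_add_pow_mul_exp_neg_sq_le {a : ℝ} (ha : 0 < a) (p : ℕ) :
    ∃ B : ℝ, ∀ r : ℝ, 0 ≤ r → (1 + r) ^ p * Real.exp (-a * r ^ 2) ≤ B := by
  refine ⟨p.factorial / a ^ p * Real.exp (2 * a), fun r hr => ?_⟩
  have h1 : (a * (1 + r)) ^ p / p.factorial ≤ Real.exp (a * (1 + r)) :=
    Real.pow_div_factorial_le_exp _ (by positivity) p
  have h2 : (1 + r) ^ p ≤ p.factorial / a ^ p * Real.exp (a * (1 + r)) := by
    rw [div_le_iff₀ (by positivity), mul_pow] at h1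
    rw [div_mul_eq_mul_div, le_div_iff₀ (by positivity)]
    linarith
  calc (1 + r) ^ p * Real.exp (-a * r ^ 2)
      ≤ p.factorial / a ^ p * Real.exp (a * (1 + r)) * Real.exp (-a * r ^ 2) := by gcongr
    _ = p.factorial / a ^ p * Real.exp (a * (1 + r) + -a * r ^ 2) := by
        rw [mul_assoc, ← Real.exp_add]
    _ ≤ _ := by
        gcongr
        nlinarith [sq_nonneg (r - 1), mul_nonneg ha.le (sq_nonneg (r - 1)), mul_nonneg ha.le hr]

/-- A smooth profile with exponentially decaying derivatives, evaluated at `‖x‖²`, is Schwartz. -/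
lemma exists_schwartzMap_comp_norm_sq {E : Type*} [NormedAddCommGroup E] [InnerProductSpace ℝ E]
    {F : ℝ → ℂ} (hF : ContDiff ℝ (⊤ : ℕ∞) F) {a : ℝ} (ha : 0 < a)
    (hdec : ∀ n : ℕ, ∃ C : ℝ, ∀ t, 0 ≤ t → ‖iteratedDeriv n F t‖ ≤ C * Real.exp (-a * t)) :
    ∃ f : SchwartzMap E ℂ, ∀ x, f x = F (‖x‖ ^ 2) := by
  have hq : (fun x : E => ‖x‖ ^ 2).HasTemperateGrowth :=
    Function.hasTemperateGrowth_norm_sq E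
  refine ⟨⟨F ∘ fun x => ‖x‖ ^ 2, hF.comp hq.1, fun k n => ?_⟩, fun x => rfl⟩
  choose C hC using hdec
  obtain ⟨j, D, hD0, hD⟩ := hq.norm_iteratedFDeriv_le_uniform n
  obtain ⟨B, hB⟩ := exists_one_add_pow_mul_exp_neg_sq_le ha (k + j * n)
  have hB0 : 0 ≤ B := le_trans (by positivity) (hB 0 le_rfl)
  let S := ∑ i ∈ Finset.range (n + 1), |C i|
  have hS : 0 ≤ S := Finset.sum_nonneg fun _ _ => abs_nonneg _
  refine ⟨n.factorial * S * (1 + D) ^ n * B, fun x => ?_⟩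
  have hcomp : ‖iteratedFDeriv ℝ n (F ∘ fun x : E => ‖x‖ ^ 2) x‖
      ≤ n.factorial * (S * Real.exp (-a * ‖x‖ ^ 2)) * ((1 + D) * (1 + ‖x‖) ^ j) ^ n := by
    refine norm_iteratedFDeriv_comp_le hF hq.1 (by exact_mod_cast le_top) x
      (fun i hi => ?_) (fun i hi hin => ?_)
    · rw [norm_iteratedFDeriv_eq_norm_iteratedDeriv]
      refine (hC i _ (by positivity)).trans ?_
      gcongr
      exact (le_abs_self _).trans
        (Finset.single_le_sum (f := fun i => |C i|) (fun _ _ => abs_nonneg _)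
          (Finset.mem_range.2 (Nat.lt_succ_of_le hi)))
    · have h1 : 1 ≤ (1 + ‖x‖) ^ j := one_le_pow₀ (by linarith [norm_nonneg x])
      have h2 : 1 ≤ (1 + D) * (1 + ‖x‖) ^ j := by nlinarith
      calc _ ≤ D * (1 + ‖x‖) ^ j := hD i hin x
        _ ≤ (1 + D) * (1 + ‖x‖) ^ j := by gcongr; linarith
        _ ≤ _ := le_self_pow₀ h2 (by omega)
  calc ‖x‖ ^ k * ‖iteratedFDeriv ℝ n (F ∘ fun x : E => ‖x‖ ^ 2) x‖
      ≤ (1 + ‖x‖) ^ k *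
        (n.factorial * (S * Real.exp (-a * ‖x‖ ^ 2)) * ((1 + D) * (1 + ‖x‖) ^ j) ^ n) := by
        gcongr
        linarith
    _ = n.factorial * S * (1 + D) ^ n *
        ((1 + ‖x‖) ^ (k + j * n) * Real.exp (-a * ‖x‖ ^ 2)) := by
        rw [mul_pow, ← pow_mul, pow_add]; ring
    _ ≤ _ := by
        gcongr
        exact hB _ (norm_nonneg x)

lemma exists_schwartzMap_eq_gaussMix {E : Type*} [NormedAddCommGroup E] [InnerProductSpace ℝ E]
    {b η : ℝ} (hb : 0 ≤ b) (hη : 0 < η) {k : ℝ → ℂ} (hk : Continuous k) :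
    ∃ f : SchwartzMap E ℂ, ∀ x, f x = gaussMix b η k (‖x‖ ^ 2) :=
  exists_schwartzMap_comp_norm_sq (contDiff_gaussMix b η hk) (mul_pos pi_pos hη) fun n =>
    ⟨_, fun t _ => by
      rw [iteratedDeriv_gaussMix b η n hk]
      exact norm_gaussMix_le hb _ t⟩

/-- The profile of the Fourier transform of `x ↦ gaussMix b η k (‖x‖²)` on a `d`-dimensional
space. -/
noncomputable def gaussMixHat (d : ℕ) (b η : ℝ) (k : ℝ → ℂ) (t : ℝ) : ℂ :=
  ∫ s in -b..b, k s * ((π / (π * (η - s * Complex.I))) ^ (d / 2 : ℂ) *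
    Complex.exp (-π ^ 2 * t / (π * (η - s * Complex.I))))

lemma fourier_gaussMix_norm_sq {E : Type*} [NormedAddCommGroup E] [InnerProductSpace ℝ E]
    [FiniteDimensional ℝ E] [MeasurableSpace E] [BorelSpace E] {b η : ℝ} (hb : 0 ≤ b)
    (hη : 0 < η) {k : ℝ → ℂ} (hk : Continuous k) (ξ : E) :
    𝓕 (fun x : E => gaussMix b η k (‖x‖ ^ 2)) ξ
      = gaussMixHat (Module.finrank ℝ E) b η k (‖ξ‖ ^ 2) := by
  have hbb : -b ≤ b := by linarith
  have hre : ∀ s : ℝ, 0 < ((π * (η - s * Complex.I) : ℂ)).re := fun s => by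
    simpa using mul_pos pi_pos hη
  have hgauss : Integrable fun x : E => Real.exp (-(π * η) * ‖x‖ ^ 2) := by
    have := (GaussianFourier.integrable_cexp_neg_mul_sq_norm_add (V := E)
      (b := (π * η : ℝ)) (by simpa using mul_pos pi_pos hη) 0 0).norm
    refine this.congr (Eventually.of_forall fun x => ?_)
    simp only [Complex.norm_exp]
    congr 1
    simp [← Complex.ofReal_pow]
  have hint : Integrable (Function.uncurry fun (x : E) (s : ℝ) =>
      Real.fourierChar (-inner ℝ x ξ) •
        (k s * Complex.exp (-(π * (η - s * Complex.I)) * ((‖x‖ ^ 2 : ℝ) : ℂ))))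
      (volume.prod (volume.restrict (Set.Ioc (-b) b))) := by
    have hkint : Integrable (fun s => ‖k s‖) (volume.restrict (Set.Ioc (-b) b)) :=
      (hk.norm.integrableOn_Icc).mono_set Set.Ioc_subset_Icc_self
    refine (hgauss.mul_prod hkint).mono' ?_ (Eventually.of_forall fun z => ?_)
    · refine Continuous.aestronglyMeasurable ?_
      simp only [Function.uncurry_def, Circle.smul_def]
      have h1 : Continuous fun z : E × ℝ => ((Real.fourierChar (-inner ℝ z.1 ξ) : Circle) : ℂ) :=
        continuous_subtype_val.comp (Real.continuous_fourierChar.comp (by fun_prop))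
      exact h1.smul (by fun_prop)
    · simp only [Function.uncurry, Circle.norm_smul, norm_mul, norm_cexp_gaussMix]
      rw [mul_comm]
  rw [Real.fourier_eq]
  simp only [gaussMix, gaussMixHat, intervalIntegral.integral_of_le hbb]
  have hpull : ∀ x : E, Real.fourierChar (-inner ℝ x ξ) •
      ∫ s in Set.Ioc (-b) b, k s * Complex.exp (-(π * (η - s * Complex.I)) * ((‖x‖ ^ 2 : ℝ) : ℂ))
      = ∫ s in Set.Ioc (-b) b, Real.fourierChar (-inner ℝ x ξ) •
        (k s * Complex.exp (-(π * (η - s * Complex.I)) * ((‖x‖ ^ 2 : ℝ) : ℂ))) := fun x => by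
    simp only [Circle.smul_def]
    rw [integral_smul]
  simp only [hpull]
  rw [integral_integral_swap hint]
  refine integral_congr_ae (Eventually.of_forall fun s => ?_)
  have hF := fourier_gaussian_innerProductSpace (V := E) (hre s) ξ
  rw [Real.fourier_eq] at hF
  have hcomm : ∀ x : E, Real.fourierChar (-inner ℝ x ξ) •
        (k s * Complex.exp (-(π * (η - s * Complex.I)) * ((‖x‖ ^ 2 : ℝ) : ℂ)))
      = k s * (Real.fourierChar (-inner ℝ x ξ) •
        Complex.exp (-(π * (η - s * Complex.I)) * (‖x‖ : ℂ) ^ 2)) := fun x => by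
    simp only [Circle.smul_def, smul_eq_mul, Complex.ofReal_pow]
    ring
  simp only [hcomm]
  rw [integral_const_mul, hF, Complex.ofReal_pow]

lemma norm_gaussMixHat_le {d : ℕ} {b η : ℝ} (hb : 0 ≤ b) (hη : 0 < η) {k : ℝ → ℂ}
    (hk : Continuous k) {t : ℝ} (ht : 0 ≤ t) :
    ‖gaussMixHat d b η k t‖ ≤ (∫ s in -b..b, ‖k s‖) *
      ((1 / η) ^ (d / 2 : ℝ) * Real.exp (-(π * η / (b ^ 2 + η ^ 2)) * t)) := by
  rw [← intervalIntegral.integral_mul_const]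
  refine intervalIntegral.norm_integral_le_of_norm_le (by linarith)
    (Eventually.of_forall fun s hs => ?_)
    ((by fun_prop : Continuous _).intervalIntegrable _ _)
  have hz : (η - s * Complex.I : ℂ) ≠ 0 := fun h => by
    have := congrArg Complex.re h
    simp at this
    exact hη.ne' this
  have hpi : (π : ℂ) ≠ 0 := by exact_mod_cast pi_ne_zero
  have e1 : (π / (π * (η - s * Complex.I)) : ℂ) = (η - s * Complex.I)⁻¹ := by
    field_simp
  have e2 : (-π ^ 2 * t / (π * (η - s * Complex.I)) : ℂ)
      = ((-(π * t) : ℝ) : ℂ) * (η - s * Complex.I)⁻¹ := by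
    push_cast
    field_simp
  have hsq : s ^ 2 ≤ b ^ 2 := sq_le_sq' hs.1.le hs.2
  have hns : Complex.normSq (η - s * Complex.I) = η ^ 2 + s ^ 2 := by
    simp [Complex.normSq_apply]; ring
  have hn : η ≤ ‖(η - s * Complex.I : ℂ)‖ := by
    have := Complex.re_le_norm (η - s * Complex.I)
    simpa using this
  rw [norm_mul, norm_mul, e1, e2]
  gcongr
  · have : (d / 2 : ℂ) = ((d / 2 : ℝ) : ℂ) := by push_cast; rfl
    rw [this, Complex.norm_cpow_of_ne_zero (inv_ne_zero hz)]
    simp only [Complex.ofReal_re, Complex.ofReal_im, mul_zero, Real.exp_zero, div_one, norm_inv]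
    rw [one_div]
    gcongr
  · rw [Complex.norm_exp]
    gcongr
    rw [Complex.re_ofReal_mul, Complex.inv_re, hns]
    have : ((η - s * Complex.I : ℂ)).re = η := by simp
    rw [this]
    have h1 : η / (b ^ 2 + η ^ 2) ≤ η / (η ^ 2 + s ^ 2) := by
      apply div_le_div_of_nonneg_left hη.le (by positivity) (by linarith)
    have h2 : 0 ≤ π * t := mul_nonneg pi_pos.le ht
    have := mul_le_mul_of_nonneg_left h1 h2
    calc -(π * t) * (η / (η ^ 2 + s ^ 2)) ≤ -(π * t * (η / (b ^ 2 + η ^ 2))) := by linarith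
      _ = _ := by ring

/-- A cosine window on `[-b, b]` modulated to frequency `t`; its `gaussMix` profile is
concentrated near `t`. -/
noncomputable def windowMode (b t s : ℝ) : ℂ :=
  ((π / (4 * b) * Real.cos (π / (2 * b) * s) : ℝ) : ℂ) * Complex.exp (-(π * s * t * Complex.I))

@[fun_prop]
lemma continuous_windowMode (b t : ℝ) : Continuous (windowMode b t) := by
  unfold windowMode
  fun_prop

lemma norm_windowMode_le {b : ℝ} (hb : 0 < b) (t s : ℝ) : ‖windowMode b t s‖ ≤ π / (4 * b) := by
  have h : ‖Complex.exp (-(π * s * t * Complex.I))‖ = 1 := by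
    rw [Complex.norm_exp]; simp
  rw [windowMode, norm_mul, h, mul_one, Complex.norm_real, norm_mul,
    Real.norm_of_nonneg (by positivity)]
  exact mul_le_of_le_one_right (by positivity) (Real.abs_cos_le_one _)

lemma integral_norm_windowMode_le {b : ℝ} (hb : 0 < b) (t : ℝ) :
    ∫ s in -b..b, ‖windowMode b t s‖ ≤ 2 := by
  have h := intervalIntegral.norm_integral_le_of_norm_le_const (a := -b) (b := b)
    (f := fun s => ‖windowMode b t s‖) (C := π / (4 * b))
    fun s _ => by simpa using norm_windowMode_le hb t s
  refine (le_abs_self _).trans (h.trans ?_)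
  rw [show b - -b = 2 * b by ring, abs_of_pos (by positivity)]
  have : π / (4 * b) * (2 * b) = π / 2 := by field_simp; norm_num
  linarith [pi_lt_four]

/-- The Fourier integral of the cosine window, up to the Gaussian factor. -/
lemma gaussMix_windowMode {b : ℝ} (hb : 0 < b) (η t u : ℝ) (h : 1 - (2 * b * (u - t)) ^ 2 ≠ 0) :
    gaussMix b η (windowMode b t) u = Real.exp (-(π * η * u)) *
      ((Complex.exp (π * (u - t) * b * Complex.I) + Complex.exp (-(π * (u - t) * b * Complex.I)))
        / (2 * (1 - (2 * b * (u - t)) ^ 2))) := by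
  set v := u - t with hv
  have hvC : (u : ℂ) - t = (v : ℂ) := by rw [hv]; push_cast; rfl
  have hC : (1 - (2 * b * v) ^ 2 : ℂ) ≠ 0 := by exact_mod_cast h
  have hbC : (b : ℂ) ≠ 0 := by exact_mod_cast hb.ne'
  have hpi : (π : ℂ) ≠ 0 := by exact_mod_cast pi_ne_zero
  let H : ℝ → ℂ := fun s => Complex.exp (π * v * s * Complex.I) *
    ((Complex.I * (2 * b * v)) * Complex.cos (π / (2 * b) * s)
      + Complex.sin (π / (2 * b) * s)) / (2 * (1 - (2 * b * v) ^ 2))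
  have hH : ∀ s : ℝ, HasDerivAt H
      (((π / (4 * b) * Real.cos (π / (2 * b) * s) : ℝ) : ℂ) *
        Complex.exp (π * v * s * Complex.I)) s := by
    intro s
    have h0 : HasDerivAt (fun s : ℝ => (s : ℂ)) 1 s := Complex.ofRealCLM.hasDerivAt
    have h1 : HasDerivAt (fun s : ℝ => (π * v * s * Complex.I : ℂ)) (π * v * Complex.I) s := by
      simpa using (h0.const_mul (π * v : ℂ)).mul_const Complex.I
    have h2 : HasDerivAt (fun s : ℝ => (π / (2 * b) * s : ℂ)) (π / (2 * b)) s := by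
      simpa using h0.const_mul (π / (2 * b) : ℂ)
    have h3 : HasDerivAt (fun s : ℝ => Complex.cos (π / (2 * b) * s))
        (-Complex.sin (π / (2 * b) * s) * (π / (2 * b))) s :=
      (Complex.hasDerivAt_cos _).comp s h2
    have h4 : HasDerivAt (fun s : ℝ => Complex.sin (π / (2 * b) * s))
        (Complex.cos (π / (2 * b) * s) * (π / (2 * b))) s :=
      (Complex.hasDerivAt_sin _).comp s h2
    refine ((h1.cexp.fun_mul ((h3.const_mul (Complex.I * (2 * b * v))).fun_add h4)).div_const
      (2 * (1 - (2 * b * v) ^ 2) : ℂ)).congr_deriv ?_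
    rw [div_eq_iff (mul_ne_zero two_ne_zero hC)]
    push_cast
    generalize Complex.cos (π / (2 * b) * s) = C
    generalize Complex.sin (π / (2 * b) * s) = S
    field_simp
    linear_combination (16 * b ^ 2 * v ^ 2 * C) * Complex.I_sq
  have hint : ∀ s : ℝ, windowMode b t s * Complex.exp (-(π * (η - s * Complex.I)) * u)
      = Real.exp (-(π * η * u)) * (((π / (4 * b) * Real.cos (π / (2 * b) * s) : ℝ) : ℂ) *
        Complex.exp (π * v * s * Complex.I)) := by
    intro s
    rw [windowMode, mul_assoc, ← Complex.exp_add, mul_left_comm, Complex.ofReal_exp,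
      ← Complex.exp_add, ← hvC]
    congr 2
    push_cast
    ring
  rw [gaussMix]
  simp only [hint]
  rw [intervalIntegral.integral_const_mul, intervalIntegral.integral_eq_sub_of_hasDerivAt
    (fun s _ => hH s) ((by fun_prop : Continuous _).intervalIntegrable _ _), hvC]
  congr 1
  have e1 : (π / (2 * b) * b : ℂ) = π / 2 := by field_simp
  have e2 : (π / (2 * b) * ((-b : ℝ) : ℂ) : ℂ) = -(π / 2) := by push_cast; field_simp
  have e3 : (π * v * ((-b : ℝ) : ℂ) * Complex.I : ℂ) = -(π * v * b * Complex.I) := by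
    push_cast; ring
  simp only [H, e1, e2, e3, Complex.cos_neg, Complex.sin_neg, Complex.cos_pi_div_two,
    Complex.sin_pi_div_two]
  ring

lemma gaussMix_windowMode_self {b : ℝ} (hb : 0 < b) (η t : ℝ) :
    gaussMix b η (windowMode b t) t = Real.exp (-(π * η * t)) := by
  rw [gaussMix_windowMode hb η t t (by simp)]
  simp only [sub_self]
  norm_num

lemma norm_gaussMix_windowMode_le {b : ℝ} (hb : 0 < b) (η t u : ℝ)
    (h : 1 < (2 * b * (u - t)) ^ 2) :
    ‖gaussMix b η (windowMode b t) u‖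
      ≤ Real.exp (-(π * η * u)) * (1 / ((2 * b * (u - t)) ^ 2 - 1)) := by
  rw [gaussMix_windowMode hb η t u (by linarith), norm_mul, Complex.norm_real,
    Real.norm_of_nonneg (Real.exp_pos _).le]
  gcongr
  have h2 : (2 * (1 - (2 * b * (u - t)) ^ 2) : ℂ)
      = ((2 * (1 - (2 * b * (u - t)) ^ 2) : ℝ) : ℂ) := by push_cast; ring
  rw [norm_div, h2, Complex.norm_real, Real.norm_of_nonpos (by linarith),
    div_le_div_iff₀ (by linarith) (by linarith)]
  have h3 : ‖Complex.exp (π * (u - t) * b * Complex.I)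
      + Complex.exp (-(π * (u - t) * b * Complex.I))‖ ≤ 2 := by
    refine (norm_add_le _ _).trans ?_
    rw [Complex.norm_exp, Complex.norm_exp]
    simp [← Complex.ofReal_sub]
    norm_num
  nlinarith

lemma integral_tsum_mul_mul {ι : Type*} [Countable ι] {c : ι → ℂ} (hc : Summable fun m => ‖c m‖)
    {e : ι → ℝ → ℂ} (he : ∀ m, Continuous (e m)) {W : ℝ} (hW : ∀ m s, ‖e m s‖ ≤ W)
    {q : ℝ → ℂ} (hq : Continuous q) (a b : ℝ) :
    ∫ s in a..b, (∑' m, c m * e m s) * q s = ∑' m, c m * ∫ s in a..b, e m s * q s := by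
  have : CompactSpace (Set.uIcc a b) := isCompact_iff_compactSpace.1 isCompact_uIcc
  let Q : C(Set.uIcc a b, ℂ) := ⟨fun x => q x, by fun_prop⟩
  let f : ι → C(ℝ, ℂ) := fun m => ⟨fun s => c m * e m s * q s,
    (continuous_const.mul (he m)).mul hq⟩
  have hsum : Summable fun m =>
      ‖(f m).restrict (⟨Set.uIcc a b, isCompact_uIcc⟩ : TopologicalSpace.Compacts ℝ)‖ := by
    refine Summable.of_nonneg_of_le (fun _ => norm_nonneg _) (fun m => ?_)
      (hc.mul_right (W * ‖Q‖))
    have hW0 : 0 ≤ W := (norm_nonneg _).trans (hW m 0)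
    rw [ContinuousMap.norm_le _ (by positivity)]
    intro x
    have hQ : ‖q x‖ ≤ ‖Q‖ := Q.norm_coe_le_norm x
    simp only [f, ContinuousMap.restrict_apply, ContinuousMap.coe_mk, norm_mul]
    rw [mul_assoc]
    have := hW m x
    gcongr
  have := intervalIntegral.tsum_intervalIntegral_eq_of_summable_norm hsum
  simp only [f, ContinuousMap.coe_mk] at this
  simp only [← tsum_mul_right]
  rw [← this]
  refine tsum_congr fun m => ?_
  simp only [mul_assoc]
  rw [intervalIntegral.integral_const_mul]

lemma continuous_tsum_mul {ι : Type*} {c : ι → ℂ} (hc : Summable fun m => ‖c m‖)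
    {e : ι → ℝ → ℂ} (he : ∀ m, Continuous (e m)) {W : ℝ} (hW : ∀ m s, ‖e m s‖ ≤ W) :
    Continuous fun s => ∑' m, c m * e m s :=
  continuous_tsum (fun m => continuous_const.mul (he m)) (hc.mul_right W) fun m s => by
    rw [norm_mul]
    exact mul_le_mul_of_nonneg_left (hW m s) (norm_nonneg _)

lemma gaussMix_tsum {ι : Type*} [Countable ι] {c : ι → ℂ} (hc : Summable fun m => ‖c m‖)
    {e : ι → ℝ → ℂ} (he : ∀ m, Continuous (e m)) {W : ℝ} (hW : ∀ m s, ‖e m s‖ ≤ W)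
    (b η t : ℝ) :
    gaussMix b η (fun s => ∑' m, c m * e m s) t = ∑' m, c m * gaussMix b η (e m) t :=
  integral_tsum_mul_mul hc he hW (by fun_prop) _ _

lemma gaussMixHat_tsum {ι : Type*} [Countable ι] {c : ι → ℂ} (hc : Summable fun m => ‖c m‖)
    {e : ι → ℝ → ℂ} (he : ∀ m, Continuous (e m)) {W : ℝ} (hW : ∀ m s, ‖e m s‖ ≤ W)
    (d : ℕ) (b : ℝ) {η : ℝ} (hη : 0 < η) (t : ℝ) :
    gaussMixHat d b η (fun s => ∑' m, c m * e m s) t = ∑' m, c m * gaussMixHat d b η (e m) t := by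
  refine integral_tsum_mul_mul hc he hW ?_ _ _
  have hre : ∀ s : ℝ, 0 < ((π * (η - s * Complex.I) : ℂ)).re := fun s => by
    simpa using mul_pos pi_pos hη
  have hne : ∀ s : ℝ, (π * (η - s * Complex.I) : ℂ) ≠ 0 := fun s h => by
    have := hre s
    rw [h] at this
    simp at this
  refine Continuous.mul (Continuous.cpow ?_ continuous_const fun s => ?_) ?_
  · exact continuous_const.div (by fun_prop) hne
  · left
    rw [Complex.div_re]
    have h1 := hre s
    have h2 : 0 < Complex.normSq (π * (η - s * Complex.I)) := Complex.normSq_pos.2 (hne s)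
    simp only [Complex.ofReal_re, Complex.ofReal_im, zero_mul, zero_div, add_zero]
    have := pi_pos
    positivity
  · exact Complex.continuous_exp.comp (continuous_const.div (by fun_prop) hne)

lemma one_le_sq_natCast_sub {j m : ℕ} (h : j ≠ m) : (1 : ℝ) ≤ ((j : ℝ) - m) ^ 2 := by
  have h1 : ((j : ℤ) - m) ≠ 0 := by omega
  have h2 : (1 : ℤ) ≤ ((j : ℤ) - m) ^ 2 := by
    have := pow_pos (abs_pos.2 h1) 2
    rw [sq_abs] at this
    omega
  exact_mod_cast h2

lemma mul_sq_sub_le_sq_sub_of_gap {g : ℝ} (hg : 0 ≤ g) {T : ℕ → ℝ}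
    (hT : ∀ k, T k + g ≤ T (k + 1)) (j m : ℕ) :
    g ^ 2 * ((j : ℝ) - m) ^ 2 ≤ (T j - T m) ^ 2 := by
  have key : ∀ m n : ℕ, g * n ≤ T (m + n) - T m := by
    intro m n
    induction n with
    | zero => simp
    | succ n ih =>
      have := hT (m + n)
      rw [← add_assoc]
      push_cast
      linarith
  rw [← mul_pow]
  rcases le_total m j with h | h
  · obtain ⟨n, rfl⟩ := Nat.exists_eq_add_of_le h
    have h1 : ((m + n : ℕ) : ℝ) - m = n := by push_cast; ring
    rw [h1]
    exact pow_le_pow_left₀ (by positivity) (key m n) 2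
  · obtain ⟨n, rfl⟩ := Nat.exists_eq_add_of_le h
    have h1 : (g * ((j : ℝ) - ((j + n : ℕ) : ℝ))) ^ 2 = (g * n) ^ 2 := by push_cast; ring
    rw [h1, ← neg_sq (T j - _), neg_sub]
    exact pow_le_pow_left₀ (by positivity) (key j n) 2

lemma add_mul_le_of_gap {g R : ℝ} {T : ℕ → ℝ} (hT : ∀ k, T k + g ≤ T (k + 1)) (hR : R ≤ T 0)
    (k : ℕ) : R + g * k ≤ T k := by
  induction k with
  | zero => simpa using hR
  | succ n ih =>
    have := hT n
    push_cast
    linarith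

lemma tsum_bool_prod {X F : Type*} [NormedAddCommGroup F] [CompleteSpace F] {f : Bool × X → F}
    (hf : Summable f) : ∑' x, f x = ∑' j, f (true, j) + ∑' j, f (false, j) := by
  rw [hf.tsum_prod, tsum_fintype, Fintype.sum_bool]

/-- Off-diagonal row sums of the window interpolation matrix. -/
lemma summable_window_bound (m : ℕ) :
    (Summable fun j : ℕ => if j = m then (0 : ℝ) else 1 / (4 * ((j : ℝ) - m) ^ 2 - 1)) ∧
      ∑' j : ℕ, (if j = m then (0 : ℝ) else 1 / (4 * ((j : ℝ) - m) ^ 2 - 1)) ≤ 1 := by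
  have h0 : ∀ j : ℕ, 0 ≤ if j = m then (0 : ℝ) else 1 / (4 * ((j : ℝ) - m) ^ 2 - 1) := by
    intro j
    split_ifs with h
    · exact le_rfl
    · have : 0 ≤ 4 * ((j : ℝ) - m) ^ 2 - 1 := by linarith [one_le_sq_natCast_sub h]
      positivity
  have hle : ∀ L, ∑ j ∈ Finset.range L,
      (if j = m then (0 : ℝ) else 1 / (4 * ((j : ℝ) - m) ^ 2 - 1)) ≤ 1 := fun L =>
    (Finset.sum_le_sum_of_subset_of_nonneg (Finset.range_mono (Nat.le_add_right L (m + 1)))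
      fun j _ _ => h0 j).trans (sum_range_inv_four_sq_sub_one_le m (L + (m + 1)) (by omega))
  exact ⟨summable_of_sum_range_le h0 hle, Real.tsum_le_of_sum_range_le h0 hle⟩

lemma norm_gaussMix_windowMode_gap_le {b g : ℝ} (hb : 0 < b) (hg : 0 < g) (hbg : 1 < b * g)
    (η : ℝ) {T : ℕ → ℝ} (hT : ∀ k, T k + g ≤ T (k + 1)) {j m : ℕ} (hjm : j ≠ m) :
    Real.exp (π * η * T j) * ‖gaussMix b η (windowMode b (T m)) (T j)‖
      ≤ 1 / (b * g) ^ 2 * (1 / (4 * ((j : ℝ) - m) ^ 2 - 1)) := by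
  have h1 := one_le_sq_natCast_sub hjm
  have hk : 1 < (b * g) ^ 2 := one_lt_pow₀ hbg two_ne_zero
  have h2 : 4 * ((b * g) ^ 2 * ((j : ℝ) - m) ^ 2) ≤ (2 * b * (T j - T m)) ^ 2 := by
    have := mul_le_mul_of_nonneg_left (mul_sq_sub_le_sq_sub_of_gap hg.le hT j m)
      (by positivity : 0 ≤ 4 * b ^ 2)
    nlinarith
  have h3 : (b * g) ^ 2 * (4 * ((j : ℝ) - m) ^ 2 - 1) ≤ (2 * b * (T j - T m)) ^ 2 - 1 := by
    nlinarith
  have h4 : 0 < 4 * ((j : ℝ) - m) ^ 2 - 1 := by linarith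
  have h5 : 0 < (b * g) ^ 2 * (4 * ((j : ℝ) - m) ^ 2 - 1) := by positivity
  calc Real.exp (π * η * T j) * ‖gaussMix b η (windowMode b (T m)) (T j)‖
      ≤ Real.exp (π * η * T j) *
        (Real.exp (-(π * η * T j)) * (1 / ((2 * b * (T j - T m)) ^ 2 - 1))) := by
        gcongr
        exact norm_gaussMix_windowMode_le hb η _ _ (by linarith)
    _ = 1 / ((2 * b * (T j - T m)) ^ 2 - 1) := by
        rw [← mul_assoc, ← Real.exp_add, add_neg_cancel, Real.exp_zero, one_mul]
    _ ≤ 1 / ((b * g) ^ 2 * (4 * ((j : ℝ) - m) ^ 2 - 1)) := one_div_le_one_div_of_le h5 h3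
    _ = _ := by rw [one_div_mul_one_div]

lemma norm_gaussMixHat_windowMode_le {b η : ℝ} (hb : 0 < b) (hη : 0 < η) (d : ℕ) {t u : ℝ}
    (hu : 0 ≤ u) :
    Real.exp (π * η * u) * ‖gaussMixHat d b η (windowMode b t) u‖
      ≤ 2 * (1 / η) ^ (d / 2 : ℝ) * Real.exp (-(π * η * (1 / (b ^ 2 + η ^ 2) - 1)) * u) := by
  calc Real.exp (π * η * u) * ‖gaussMixHat d b η (windowMode b t) u‖
      ≤ Real.exp (π * η * u) * (2 *
        ((1 / η) ^ (d / 2 : ℝ) * Real.exp (-(π * η / (b ^ 2 + η ^ 2)) * u))) := by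
        gcongr
        refine (norm_gaussMixHat_le hb.le hη (continuous_windowMode b t) hu).trans ?_
        gcongr
        exact integral_norm_windowMode_le hb t
    _ = 2 * (1 / η) ^ (d / 2 : ℝ) *
        (Real.exp (π * η * u) * Real.exp (-(π * η / (b ^ 2 + η ^ 2)) * u)) := by ring
    _ = _ := by
        rw [← Real.exp_add]
        congr 2
        ring

/-- If the squared radii in `T true` and `T false` are sufficiently large and have gaps with
`b g > 1`, then the values of `f` on the spheres `T true` and of `𝓕 f` on the spheres `T false`
can be prescribed by an arbitrary unit vector. -/
lemma exists_schwartzMap_dual (E : Type*) [NormedAddCommGroup E] [InnerProductSpace ℝ E]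
    [FiniteDimensional ℝ E] [MeasurableSpace E] [BorelSpace E] {b η g : ℝ} (hb : 0 < b)
    (hη : 0 < η) (hbη : b ^ 2 + η ^ 2 < 1) (hg : 0 < g) (hbg : 1 < b * g) :
    ∃ R : ℝ, 0 ≤ R ∧ ∀ T : Bool → ℕ → ℝ, (∀ σ k, T σ k + g ≤ T σ (k + 1)) → (∀ σ, R ≤ T σ 0) →
      ∀ p : Bool × ℕ, ∃ (f : SchwartzMap E ℂ) (u : Bool → ℝ → ℂ) (C : ℝ),
        (∀ x, f x = u true (‖x‖ ^ 2)) ∧ (∀ ξ, 𝓕 (⇑f) ξ = u false (‖ξ‖ ^ 2)) ∧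
        (∀ σ t, 0 ≤ t → ‖u σ t‖ ≤ C * Real.exp (-(π * η) * t)) ∧
        ∀ j : Bool × ℕ, Real.exp (π * η * T j.1 j.2) * u j.1 (T j.1 j.2)
          = if j = p then 1 else 0 := by
  set d := Module.finrank ℝ E
  set θ := π * η * (1 / (b ^ 2 + η ^ 2) - 1) with hθdef
  have hinv : 1 < 1 / (b ^ 2 + η ^ 2) := one_lt_one_div (by positivity) hbη
  have hθ : 0 < θ := mul_pos (mul_pos pi_pos hη) (by linarith)
  set D := 2 * (1 / η) ^ (d / 2 : ℝ) with hD
  have hD0 : 0 ≤ D := by positivity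
  have hk : 1 < (b * g) ^ 2 := one_lt_pow₀ hbg two_ne_zero
  set q := 1 / (b * g) ^ 2 with hq
  have hq1 : q < 1 := by rw [hq, div_lt_one (by positivity)]; exact hk
  have hgeo : Summable fun j : ℕ => Real.exp (-(θ * g)) ^ j :=
    summable_geometric_of_lt_one (Real.exp_pos _).le (by
      rw [Real.exp_lt_one_iff]; linarith [mul_pos hθ hg])
  set S := ∑' j : ℕ, Real.exp (-(θ * g)) ^ j
  obtain ⟨R, hRs, hR0⟩ : ∃ R, D * Real.exp (-θ * R) * S ≤ (1 - q) / 2 ∧ 0 ≤ R := by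
    have hlim : Tendsto (fun R : ℝ => D * Real.exp (-θ * R) * S) atTop (nhds (D * 0 * S)) := by
      refine ((tendsto_const_nhds).mul (Real.tendsto_exp_atBot.comp ?_)).mul_const S
      exact tendsto_id.const_mul_atTop_of_neg (by linarith)
    rw [mul_zero, zero_mul] at hlim
    exact ((hlim.eventually_le_const (by linarith : (0 : ℝ) < (1 - q) / 2)).and
      (eventually_ge_atTop 0)).exists
  refine ⟨R, hR0, fun T hT hTR p => ?_⟩
  have hTlow : ∀ σ k, R + g * k ≤ T σ k := fun σ k => add_mul_le_of_gap (hT σ) (hTR σ) k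
  have hT0 : ∀ σ k, 0 ≤ T σ k := fun σ k => le_trans (by positivity) (hTlow σ k)
  let A : Bool × ℕ → Bool × ℕ → ℂ := fun j m => Real.exp (π * η * T j.1 j.2) *
    if j.1 = m.1 then gaussMix b η (windowMode b (T m.1 m.2)) (T j.1 j.2)
    else gaussMixHat d b η (windowMode b (T m.1 m.2)) (T j.1 j.2)
  let B : Bool × ℕ → Bool × ℕ → ℝ := fun m j =>
    if j.1 = m.1 then
      q * (if j.2 = m.2 then (0 : ℝ) else 1 / (4 * ((j.2 : ℝ) - m.2) ^ 2 - 1))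
    else D * Real.exp (-θ * R) * Real.exp (-(θ * g)) ^ j.2
  have hAB : ∀ m j, ‖A j m - if j = m then 1 else 0‖ ≤ B m j := by
    rintro ⟨τ, m⟩ ⟨σ, j⟩
    by_cases hσ : σ = τ
    · subst hσ
      by_cases hjm : j = m
      · subst hjm
        simp only [A, B, if_true, gaussMix_windowMode_self hb, mul_zero]
        rw [← Complex.ofReal_mul, ← Real.exp_add, add_neg_cancel]
        simp
      · have := norm_gaussMix_windowMode_gap_le hb hg hbg η (hT σ) hjm
        have h3 : (σ, j) ≠ (σ, m) := by simp [hjm]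
        simp only [A, B, if_true, hjm, h3, if_false, sub_zero, norm_mul, Complex.norm_real,
          Real.norm_eq_abs, Real.abs_exp]
        exact this
    · have h1 := norm_gaussMixHat_windowMode_le hb hη d (t := T τ m) (hT0 σ j)
      have h2 : D * Real.exp (-θ * T σ j) ≤ D * Real.exp (-θ * R) * Real.exp (-(θ * g)) ^ j := by
        rw [← Real.exp_nat_mul, mul_assoc D (Real.exp (-θ * R)), ← Real.exp_add]
        gcongr
        nlinarith [mul_le_mul_of_nonneg_left (hTlow σ j) hθ.le]
      have h3 : (σ, j) ≠ (τ, m) := fun h => hσ (congrArg Prod.fst h)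
      simp only [A, B, hσ, h3, if_false, sub_zero, norm_mul, Complex.norm_real, Real.norm_eq_abs,
        Real.abs_exp]
      exact h1.trans h2
  have hBsum : ∀ m, Summable (B m) ∧ ∑' j, B m j ≤ (1 + q) / 2 := by
    rintro ⟨τ, m⟩
    obtain ⟨hs, hle⟩ := summable_window_bound m
    have e1 : ∀ j, B (τ, m) (τ, j)
        = q * (if j = m then (0 : ℝ) else 1 / (4 * ((j : ℝ) - m) ^ 2 - 1)) := fun j => by
      simp [B]
    have e2 : ∀ j, B (τ, m) (!τ, j) = D * Real.exp (-θ * R) * Real.exp (-(θ * g)) ^ j :=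
      fun j => by simp [B]
    have s1 : Summable fun j => B (τ, m) (τ, j) := by simpa only [e1] using hs.mul_left q
    have s2 : Summable fun j => B (τ, m) (!τ, j) := by simpa only [e2] using hgeo.mul_left _
    have t1 : ∑' j, B (τ, m) (τ, j) ≤ q := by
      simp only [e1, tsum_mul_left]
      exact mul_le_of_le_one_right (by positivity) hle
    have t2 : ∑' j, B (τ, m) (!τ, j) ≤ (1 - q) / 2 := by
      simp only [e2, tsum_mul_left]
      exact hRs
    have hsum : Summable (B (τ, m)) := by
      refine (summable_prod_of_nonneg fun j => (norm_nonneg _).trans (hAB _ j)).2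
        ⟨fun σ => ?_, (hasSum_fintype _).summable⟩
      rcases Bool.eq_or_eq_not σ τ with rfl | rfl
      · exact s1
      · exact s2
    refine ⟨hsum, ?_⟩
    rw [tsum_bool_prod hsum]
    cases τ <;> simp only [Bool.not_true, Bool.not_false] at t1 t2 <;> linarith
  have hAsum : ∀ m, Summable fun j => ‖A j m - if j = m then 1 else 0‖ := fun m =>
    Summable.of_nonneg_of_le (fun _ => norm_nonneg _) (hAB m) (hBsum m).1
  obtain ⟨c, hc, hcA⟩ := exists_summable_mulVec_eq_single A (by linarith : (1 + q) / 2 < 1) hAsum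
    (fun m => ((hAsum m).tsum_le_tsum (hAB m) (hBsum m).1).trans (hBsum m).2) p
  let k : Bool → ℝ → ℂ := fun σ s => ∑' m, c (σ, m) * windowMode b (T σ m) s
  have hcσ : ∀ σ, Summable fun m => ‖c (σ, m)‖ := fun σ =>
    hc.comp_injective (Prod.mk_right_injective σ)
  have hk : ∀ σ, Continuous (k σ) := fun σ =>
    continuous_tsum_mul (hcσ σ) (fun m => continuous_windowMode b _) fun m =>
      norm_windowMode_le hb _
  obtain ⟨f₁, hf₁⟩ := exists_schwartzMap_eq_gaussMix (E := E) hb.le hη (hk true)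
  obtain ⟨f₂, hf₂⟩ := exists_schwartzMap_eq_gaussMix (E := E) hb.le hη (hk false)
  have hFf₁ : ∀ ξ, (𝓕 f₁) ξ = gaussMixHat d b η (k true) (‖ξ‖ ^ 2) := fun ξ => by
    rw [SchwartzMap.fourier_coe, show ⇑f₁ = _ from funext hf₁,
      fourier_gaussMix_norm_sq hb.le hη (hk true)]
  have hFf₂ : ∀ x, (𝓕⁻ f₂) x = gaussMixHat d b η (k false) (‖x‖ ^ 2) := fun x => by
    rw [SchwartzMap.fourierInv_coe, Real.fourierInv_eq_fourier_neg, show ⇑f₂ = _ from funext hf₂,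
      fourier_gaussMix_norm_sq hb.le hη (hk false), norm_neg]
  refine ⟨f₁ + 𝓕⁻ f₂,
    fun σ t => gaussMix b η (k σ) t + gaussMixHat d b η (k !σ) t,
    ∑ σ : Bool, ((∫ s in -b..b, ‖k σ s‖) + (∫ s in -b..b, ‖k (!σ) s‖) * (1 / η) ^ (d / 2 : ℝ)),
    fun x => ?_, fun ξ => ?_, fun σ t ht => ?_, fun j => ?_⟩
  · simp [hf₁, hFf₂]
  · rw [← SchwartzMap.fourier_coe, FourierTransform.fourier_add,
      FourierTransform.fourier_fourierInv_eq]
    simp [hFf₁, hf₂, add_comm]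
  · have hint : ∀ σ, 0 ≤ ∫ s in -b..b, ‖k σ s‖ := fun σ =>
      intervalIntegral.integral_nonneg (by linarith) fun _ _ => norm_nonneg _
    have hexp : Real.exp (-(π * η / (b ^ 2 + η ^ 2)) * t) ≤ Real.exp (-(π * η) * t) := by
      have : π * η ≤ π * η / (b ^ 2 + η ^ 2) := le_div_self (by positivity) (by positivity) hbη.le
      gcongr
    have h1 := norm_gaussMix_le (η := η) hb.le (k σ) t
    have h2 := norm_gaussMixHat_le (d := d) hb.le hη (hk !σ) ht
    have h3 : (∫ s in -b..b, ‖k σ s‖) + (∫ s in -b..b, ‖k (!σ) s‖) * (1 / η) ^ (d / 2 : ℝ)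
        ≤ ∑ σ : Bool, ((∫ s in -b..b, ‖k σ s‖)
          + (∫ s in -b..b, ‖k (!σ) s‖) * (1 / η) ^ (d / 2 : ℝ)) :=
      Finset.single_le_sum (f := fun σ : Bool => (∫ s in -b..b, ‖k σ s‖)
          + (∫ s in -b..b, ‖k (!σ) s‖) * (1 / η) ^ (d / 2 : ℝ))
        (fun σ _ => add_nonneg (hint σ) (mul_nonneg (hint _) (by positivity)))
        (Finset.mem_univ σ)
    calc _ ≤ ‖gaussMix b η (k σ) t‖ + ‖gaussMixHat d b η (k !σ) t‖ := norm_add_le _ _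
      _ ≤ (∫ s in -b..b, ‖k σ s‖) * Real.exp (-(π * η) * t) + (∫ s in -b..b, ‖k (!σ) s‖) *
          ((1 / η) ^ (d / 2 : ℝ) * Real.exp (-(π * η) * t)) := by
          refine add_le_add h1 (h2.trans ?_)
          have := hint (!σ)
          gcongr
      _ = ((∫ s in -b..b, ‖k σ s‖) + (∫ s in -b..b, ‖k (!σ) s‖) * (1 / η) ^ (d / 2 : ℝ)) *
          Real.exp (-(π * η) * t) := by ring
      _ ≤ _ := by gcongr
  · obtain ⟨σ, j⟩ := j
    have hsumA : Summable fun m => c m * A (σ, j) m := by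
      refine Summable.of_norm_bounded (hc.mul_right ((1 + q) / 2 + 1)) fun m => ?_
      rw [norm_mul]
      gcongr
      have h1 : ‖A (σ, j) m - if (σ, j) = m then 1 else 0‖ ≤ (1 + q) / 2 :=
        ((hAsum m).le_tsum (σ, j) fun _ _ => norm_nonneg _).trans
          (((hAsum m).tsum_le_tsum (hAB m) (hBsum m).1).trans (hBsum m).2)
      have h2 : ‖(if (σ, j) = m then 1 else 0 : ℂ)‖ ≤ 1 := by split_ifs <;> simp
      have h3 := norm_sub_norm_le (A (σ, j) m) (if (σ, j) = m then 1 else 0)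
      linarith
    have hmix : gaussMix b η (k σ) (T σ j)
        = ∑' m, c (σ, m) * gaussMix b η (windowMode b (T σ m)) (T σ j) :=
      gaussMix_tsum (hcσ σ) (fun m => continuous_windowMode b _)
        (fun m => norm_windowMode_le hb _) b η _
    have hhat : gaussMixHat d b η (k !σ) (T σ j)
        = ∑' m, c (!σ, m) * gaussMixHat d b η (windowMode b (T (!σ) m)) (T σ j) :=
      gaussMixHat_tsum (hcσ _) (fun m => continuous_windowMode b _)
        (fun m => norm_windowMode_le hb _) d b hη _
    have hA1 : ∀ m, c (σ, m) * A (σ, j) (σ, m) = Real.exp (π * η * T σ j) *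
        (c (σ, m) * gaussMix b η (windowMode b (T σ m)) (T σ j)) := fun m => by
      simp only [A, if_true]; ring
    have hA2 : ∀ m, c (!σ, m) * A (σ, j) (!σ, m) = Real.exp (π * η * T σ j) *
        (c (!σ, m) * gaussMixHat d b η (windowMode b (T (!σ) m)) (T σ j)) := fun m => by
      simp only [A, Bool.eq_not_self, if_false]; ring
    rw [← hcA (σ, j), tsum_bool_prod hsumA, mul_add, hmix, hhat, ← tsum_mul_left,
      ← tsum_mul_left]
    simp only [← hA1, ← hA2]
    cases σ
    · rw [add_comm]; rfl
    · rfl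

lemma eventually_sq_gap_of_lt_liminf {Λ : ℕ → ℝ} (hmono : StrictMono Λ) (hpos : ∀ i, 0 < Λ i)
    (h : 1 / 2 < liminf (fun i : ℕ => (Λ (i + 1) - Λ i) * Λ i) atTop) :
    ∃ G : ℝ, 1 < G ∧ ∀ᶠ i in atTop, Λ i ^ 2 + G ≤ Λ (i + 1) ^ 2 := by
  obtain ⟨β, hβ, hlt⟩ := exists_between h
  refine ⟨2 * β, by linarith, ?_⟩
  have hbdd : IsBoundedUnder (· ≥ ·) atTop fun i : ℕ => (Λ (i + 1) - Λ i) * Λ i :=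
    isBoundedUnder_of ⟨0, fun i =>
      mul_nonneg (sub_nonneg.2 (hmono.monotone (Nat.le_succ i))) (hpos i).le⟩
  filter_upwards [eventually_lt_of_lt_liminf hlt hbdd] with i hi
  nlinarith [sq_nonneg (Λ (i + 1) - Λ i)]

/-- A sequence with eventual gaps `G > g` can be modified at finitely many places, gaining `n`
extra terms, so that it starts above `R` and all its gaps are at least `g`. -/
lemma exists_shift_of_eventually_gap {g G : ℝ} (hgG : g < G) {t : ℕ → ℝ}
    (ht : ∀ᶠ i in atTop, t i + G ≤ t (i + 1)) (R : ℝ) (n : ℕ) :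
    ∃ (N : ℕ) (T : ℕ → ℝ), (∀ k, T k + g ≤ T (k + 1)) ∧ R ≤ T 0 ∧ ∀ k, N ≤ k → T (k + n) = t k := by
  obtain ⟨N₀, hN₀⟩ := eventually_atTop.1 ht
  have hlow : ∀ k : ℕ, t N₀ + G * k ≤ t (N₀ + k) :=
    add_mul_le_of_gap (T := fun k => t (N₀ + k)) (fun k => hN₀ _ (Nat.le_add_right _ _)) le_rfl
  obtain ⟨K, hK⟩ := exists_nat_ge ((R + g * (N₀ + n) - t N₀) / (G - g))
  rw [div_le_iff₀ (by linarith)] at hK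
  have hNK : R + g * ((N₀ + K + n : ℕ) : ℝ) ≤ t (N₀ + K) := by
    have := hlow K
    push_cast
    linarith
  refine ⟨N₀ + K, fun k => if k < N₀ + K + n then R + g * k else t (k - n), fun k => ?_, ?_,
    fun k hk => ?_⟩
  · beta_reduce
    rcases lt_trichotomy (k + 1) (N₀ + K + n) with h | h | h
    · rw [if_pos (by omega), if_pos h]
      push_cast
      linarith
    · rw [if_pos (by omega), if_neg (by omega), h, Nat.add_sub_cancel]
      rw [← h] at hNK
      push_cast at hNK
      linarith
    · rw [if_neg (by omega), if_neg (by omega), show k + 1 - n = k - n + 1 by omega]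
      linarith [hN₀ (k - n) (by omega)]
  · beta_reduce
    split_ifs with h
    · simp
    · have h0 : N₀ + K = 0 ∧ n = 0 := by omega
      simpa [h0.1, h0.2] using hNK
  · beta_reduce
    rw [if_neg (by omega), Nat.add_sub_cancel]

section SphereVanishing

variable (E : Type*) [NormedAddCommGroup E] [InnerProductSpace ℝ E] [FiniteDimensional ℝ E]
  [MeasurableSpace E] [BorelSpace E]

/-- The identity for `true` and the Fourier transform for `false`. -/
noncomputable def fourierSide (σ : Bool) : SchwartzMap E ℂ →ₗ[ℂ] SchwartzMap E ℂ :=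
  bif σ then LinearMap.id else (FourierTransform.fourierCLM ℂ (SchwartzMap E ℂ)).toLinearMap

/-- The Schwartz functions `f` such that `f` and `𝓕 f` decay like `exp (-α‖x‖²)` and vanish on the
spheres with squared radii `t true i` and `t false i` respectively. -/
noncomputable def sphereVanishing (α : ℝ) (t : Bool → ℕ → ℝ) :
    Submodule ℂ (SchwartzMap E ℂ) where
  carrier := {f | (∃ C : ℝ, ∀ σ x, ‖fourierSide E σ f x‖ ≤ C * Real.exp (-α * ‖x‖ ^ 2)) ∧
    ∀ σ i x, ‖x‖ ^ 2 = t σ i → fourierSide E σ f x = 0}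
  zero_mem' := ⟨⟨0, by simp⟩, by simp⟩
  add_mem' := by
    rintro f g ⟨⟨C, hC⟩, hf⟩ ⟨⟨D, hD⟩, hg⟩
    refine ⟨⟨C + D, fun σ x => ?_⟩, fun σ i x hx => ?_⟩
    · rw [map_add, add_mul]
      exact (norm_add_le _ _).trans (add_le_add (hC σ x) (hD σ x))
    · simp [hf σ i x hx, hg σ i x hx]
  smul_mem' := by
    rintro c f ⟨⟨C, hC⟩, hf⟩
    refine ⟨⟨‖c‖ * C, fun σ x => ?_⟩, fun σ i x hx => ?_⟩
    · rw [map_smul, mul_assoc, _root_.smul_apply, norm_smul]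
      exact mul_le_mul_of_nonneg_left (hC σ x) (norm_nonneg _)
    · simp [hf σ i x hx]

lemma exists_not_finiteDimensional_sphereVanishing [Nontrivial E] {t : Bool → ℕ → ℝ} {G : ℝ}
    (hG : 1 < G) (ht : ∀ σ, ∀ᶠ i in atTop, t σ i + G ≤ t σ (i + 1)) :
    ∃ a₀ : ℝ, 0 < a₀ ∧ ∀ α < a₀, ¬ FiniteDimensional ℂ (sphereVanishing E α t) := by
  set g := (1 + G) / 2 with hgdef
  have hg : 1 < g := by linarith
  have hg1 : 1 / g < 1 := by rw [div_lt_one (by linarith)]; exact hg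
  have hg0 : 0 < 1 / g := by positivity
  set b := (1 + 1 / g) / 2 with hbdef
  have hbg : 1 < b * g := by
    have : b * g = (g + 1) / 2 := by rw [hbdef]; field_simp
    linarith
  have hη : 0 < 1 - b := by linarith
  have hb : 0 < b := by linarith
  obtain ⟨R, hR0, hR⟩ := exists_schwartzMap_dual E hb hη (by nlinarith) (by linarith) hbg
  refine ⟨π * (1 - b), by positivity, fun α hα hfin => ?_⟩
  set n := Module.finrank ℂ (sphereVanishing E α t) + 1
  choose N T hTgap hTR hTt using fun σ =>
    exists_shift_of_eventually_gap (by linarith : g < G) (ht σ) R n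
  have hT0 : ∀ σ k, 0 ≤ T σ k := fun σ k =>
    le_trans (by positivity) (add_mul_le_of_gap (hTgap σ) (hTR σ) k)
  choose f u C hfu hFu hC hdual using hR T hTgap hTR
  have hside : ∀ p σ x, fourierSide E σ (f p) x = u p σ (‖x‖ ^ 2) := by
    rintro p (_ | _) x
    · exact hFu p x
    · exact hfu p x
  let ι : (Σ σ, Fin (N σ + n)) → Bool × ℕ := fun p => (p.1, p.2)
  have hι : Function.Injective ι := by
    rintro ⟨σ, i⟩ ⟨τ, j⟩ h
    obtain ⟨h1, h2⟩ := Prod.mk.inj h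
    dsimp only at h1 h2
    subst h1
    rw [Fin.ext h2]
  let U : Bool → ℝ → ((Σ σ, Fin (N σ + n)) → ℂ) →ₗ[ℂ] ℂ := fun σ s =>
    Fintype.linearCombination ℂ fun p => u (ι p) σ s
  let Φ : ((Σ σ, Fin (N σ + n)) → ℂ) →ₗ[ℂ] SchwartzMap E ℂ :=
    Fintype.linearCombination ℂ fun p => f (ι p)
  have hΦ : ∀ c σ x, fourierSide E σ (Φ c) x = U σ (‖x‖ ^ 2) c := fun c σ x => by
    simp [Φ, U, Fintype.linearCombination_apply, hside]
  have hU : ∀ c (j : Bool × ℕ), Real.exp (π * (1 - b) * T j.1 j.2) * U j.1 (T j.1 j.2) c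
      = ∑ p, c p * if j = ι p then 1 else 0 := fun c j => by
    simp only [U, Fintype.linearCombination_apply, smul_eq_mul, Finset.mul_sum, ← hdual]
    exact Finset.sum_congr rfl fun p _ => by ring
  let L : ((Σ σ, Fin (N σ + n)) → ℂ) →ₗ[ℂ] ((Σ σ, Fin (N σ)) → ℂ) :=
    LinearMap.pi fun q => U q.1 (t q.1 q.2)
  have hmem : ∀ c ∈ LinearMap.ker L, Φ c ∈ sphereVanishing E α t := by
    intro c hc
    refine ⟨⟨∑ p, ‖c p‖ * |C (ι p)|, fun σ x => ?_⟩, fun σ i x hx => ?_⟩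
    · rw [hΦ, Finset.sum_mul]
      simp only [U, Fintype.linearCombination_apply, smul_eq_mul]
      refine norm_sum_le_of_le _ fun p _ => ?_
      rw [norm_mul, mul_assoc]
      gcongr
      refine (hC (ι p) σ _ (sq_nonneg _)).trans ?_
      gcongr
      exact le_abs_self _
    · rw [hΦ, hx]
      rcases lt_or_ge i (N σ) with hi | hi
      · exact congrFun (LinearMap.mem_ker.1 hc) ⟨σ, i, hi⟩
      · have h := hU c (σ, i + n)
        rw [Finset.sum_eq_zero, hTt σ i hi] at h
        · simpa using h
        · intro p _
          rw [if_neg, mul_zero]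
          intro h
          obtain ⟨rfl, h⟩ := Prod.mk.inj h
          have := p.2.2
          omega
  have hinj : Function.Injective Φ := by
    rw [injective_iff_map_eq_zero]
    intro c hc
    ext p
    obtain ⟨x, hx⟩ := exists_norm_eq E (Real.sqrt_nonneg (T p.1 p.2))
    have h := hU c (ι p)
    have h0 : U p.1 (T p.1 p.2) c = 0 := by
      rw [← Real.sq_sqrt (hT0 p.1 p.2), ← hx, ← hΦ, hc, map_zero]
      rfl
    simpa [ι, h0, hι.eq_iff] using h.symm
  have hle := LinearMap.finrank_le_finrank_of_injective
    (f := (Φ.comp (LinearMap.ker L).subtype).codRestrict (sphereVanishing E α t)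
      fun c => hmem c c.2) ((hinj.comp Subtype.val_injective).codRestrict _)
  have hrank := L.finrank_range_add_finrank_ker
  have hrange := (LinearMap.range L).finrank_le
  simp only [Module.finrank_fintype_fun_eq_card, Fintype.card_sigma, Fintype.card_fin,
    Fintype.sum_bool] at hrank hrange
  omega

end SphereVanishing

/-- Theorem 4(II): higher-dimensional supercritical counterexamples. -/
theorem supercritical_counterexample_highdim (d : ℕ) (hd : 1 ≤ d) (Λ Γ : ℕ → ℝ)
    (hΛmono : StrictMono Λ) (hΛpos : ∀ i, 0 < Λ i) (hΛtop : Tendsto Λ atTop atTop)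
    (hΓmono : StrictMono Γ) (hΓpos : ∀ i, 0 < Γ i) (hΓtop : Tendsto Γ atTop atTop)
    (hΛdens : 1 / 2 < liminf (fun i : ℕ => (Λ (i + 1) - Λ i) * Λ i) atTop)
    (hΓdens : 1 / 2 < liminf (fun i : ℕ => (Γ (i + 1) - Γ i) * Γ i) atTop) :
    ∃ a₀ : ℝ, 0 < a₀ ∧
      ∀ α : ℝ, 0 < α → α < a₀ →
        ∃ E : Submodule ℂ (SchwartzMap (EuclideanSpace ℝ (Fin d)) ℂ),
          ¬ FiniteDimensional ℂ ↥E ∧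
          (∀ f ∈ E,
            (∃ Cf : ℝ, ∀ x : EuclideanSpace ℝ (Fin d),
              ‖f x‖ + ‖𝓕 (⇑f) x‖ ≤ Cf * Real.exp (-α * ‖x‖ ^ 2)) ∧
            (∀ i : ℕ, ∀ u : EuclideanSpace ℝ (Fin d), ‖u‖ = 1 → f (Λ i • u) = 0) ∧
            (∀ i : ℕ, ∀ u : EuclideanSpace ℝ (Fin d), ‖u‖ = 1 → 𝓕 (⇑f) (Γ i • u) = 0)) ∧
          ∃ f ∈ E, ∃ g ∈ E,
            (∀ i : ℕ, ∀ u : EuclideanSpace ℝ (Fin d), ‖u‖ = 1 →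
              ‖f (Λ i • u)‖ = ‖g (Λ i • u)‖) ∧
            (∀ i : ℕ, ∀ u : EuclideanSpace ℝ (Fin d), ‖u‖ = 1 →
              ‖𝓕 (⇑f) (Γ i • u)‖ = ‖𝓕 (⇑g) (Γ i • u)‖) ∧
            ¬ (∀ x : EuclideanSpace ℝ (Fin d), ‖f x‖ = ‖g x‖) ∧
            ¬ (∀ ξ : EuclideanSpace ℝ (Fin d), ‖𝓕 (⇑f) ξ‖ = ‖𝓕 (⇑g) ξ‖) := by
  obtain ⟨d, rfl⟩ := Nat.exists_eq_add_of_le' hd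
  obtain ⟨G₁, hG₁, hΛgap⟩ := eventually_sq_gap_of_lt_liminf hΛmono hΛpos hΛdens
  obtain ⟨G₂, hG₂, hΓgap⟩ := eventually_sq_gap_of_lt_liminf hΓmono hΓpos hΓdens
  let t : Bool → ℕ → ℝ := fun σ i => bif σ then Λ i ^ 2 else Γ i ^ 2
  have ht : ∀ σ, ∀ᶠ i in atTop, t σ i + min G₁ G₂ ≤ t σ (i + 1) := by
    rintro (_ | _)
    · filter_upwards [hΓgap] with i hi using (add_le_add_right (min_le_right _ _) _).trans hi
    · filter_upwards [hΛgap] with i hi using (add_le_add_right (min_le_left _ _) _).trans hi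
  obtain ⟨a₀, ha₀, h⟩ := exists_not_finiteDimensional_sphereVanishing
    (EuclideanSpace ℝ (Fin (d + 1))) (lt_min hG₁ hG₂) ht
  refine ⟨a₀, ha₀, fun α _ hα => ⟨sphereVanishing _ α t, h α hα, ?_, ?_⟩⟩
  · rintro f ⟨⟨C, hC⟩, hf⟩
    refine ⟨⟨C + C, fun x => ?_⟩, fun i u hu => ?_, fun i u hu => ?_⟩
    · rw [add_mul]
      exact add_le_add (hC true x) (hC false x)
    · exact hf true i (Λ i • u) (by simp [norm_smul, hu, t])
    · exact hf false i (Γ i • u) (by simp [norm_smul, hu, t])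
  · obtain ⟨f, hf, hf0⟩ : ∃ f ∈ sphereVanishing (EuclideanSpace ℝ (Fin (d + 1))) α t, f ≠ 0 := by
      rw [← Submodule.ne_bot_iff]
      intro hbot
      exact h α hα (hbot ▸ inferInstance)
    have hF0 : 𝓕 (⇑(0 : SchwartzMap (EuclideanSpace ℝ (Fin (d + 1))) ℂ)) = 0 := by
      rw [← SchwartzMap.fourier_coe, FourierTransform.fourier_zero]
      rfl
    refine ⟨f, hf, 0, zero_mem _, fun i u hu => ?_, fun i u hu => ?_, fun hall => hf0 ?_,
      fun hall => hf0 ?_⟩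
    · rw [show f (Λ i • u) = 0 from hf.2 true i _ (by simp [norm_smul, hu, t])]
      simp
    · rw [show 𝓕 (⇑f) (Γ i • u) = 0 from hf.2 false i _ (by simp [norm_smul, hu, t]), hF0]
      simp
    · ext x
      simpa using hall x
    · have hF : 𝓕 f = 0 := by
        ext ξ
        have := hall ξ
        rw [hF0] at this
        simpa [SchwartzMap.fourier_coe] using this
      rw [← FourierTransform.fourierInv_fourier_eq
        (F := SchwartzMap (EuclideanSpace ℝ (Fin (d + 1))) ℂ) f, hF,
        FourierTransform.fourierInv_zero]
end

section
/- Let a < b be real numbers and let f : [a,b] → ℂ be continuously differentiable. Then for every ε > 0 one has ∫_a^b |f(x)|² dx ≤ π⁻²(b−a)²(1+ε)∫_a^b |f′(x)|² dx + (1+ε⁻¹)(b−a)(|f(a)|² + |f(b)|²). -/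
open MeasureTheory Filter Real

/-- A consequence of Jordan's inequality; the constant is twice the Becker-Stark one. -/
lemma tan_mul_pi_sq_sub_le {x : ℝ} (hx₀ : 0 ≤ x) (hx : x < π / 2) :
    tan x * (π ^ 2 - 4 * x ^ 2) ≤ 2 * x * π ^ 2 := by
  have hπ := pi_pos
  have hcos : 0 < cos x := cos_pos_of_mem_Ioo ⟨by linarith, hx⟩
  have hsin : sin x ≤ x := sin_le hx₀
  have hjordan : π - 2 * x ≤ π * cos x := by
    have h := one_sub_mul_le_cos hx₀ hx.le
    have h' := mul_le_mul_of_nonneg_left h hπ.le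
    have : π * (1 - 2 / π * x) = π - 2 * x := by field_simp
    linarith
  rw [tan_eq_sin_div_cos, div_mul_eq_mul_div, div_le_iff₀ hcos]
  calc sin x * (π ^ 2 - 4 * x ^ 2) ≤ x * (π ^ 2 - 4 * x ^ 2) := by
        gcongr
        nlinarith
    _ = x * (π + 2 * x) * (π - 2 * x) := by ring
    _ ≤ x * (π + π) * (π * cos x) := by
        gcongr
        · linarith
        · linarith
    _ = 2 * x * π ^ 2 * cos x := by ring

/-- A Robin-type form of Wirtinger's inequality, obtained by integrating
`0 ≤ ‖f' - p • f‖ ^ 2`, where `p x = -k * tan (k * (x - (a + b) / 2))` solves the Riccati equation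
`p' + p ^ 2 = -k ^ 2`. -/
lemma sq_mul_integral_norm_sq_le {E : Type*} [NormedAddCommGroup E] [InnerProductSpace ℝ E]
    {a b k : ℝ} (hab : a ≤ b) (hk : 0 ≤ k) (hkπ : k * (b - a) < π) {f f' : ℝ → E}
    (hderiv : ∀ x ∈ Set.Icc a b, HasDerivWithinAt f (f' x) (Set.Icc a b) x)
    (hcont : ContinuousOn f' (Set.Icc a b)) :
    k ^ 2 * (∫ x in a..b, ‖f x‖ ^ 2) ≤
      (∫ x in a..b, ‖f' x‖ ^ 2) +
        k * tan (k * (b - a) / 2) * (‖f a‖ ^ 2 + ‖f b‖ ^ 2) := by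
  have hf : ContinuousOn f (Set.Icc a b) := fun x hx ↦ (hderiv x hx).continuousWithinAt
  let p : ℝ → ℝ := fun x ↦ -k * tan (k * (x - (a + b) / 2))
  have hcos : ∀ x ∈ Set.Icc a b, cos (k * (x - (a + b) / 2)) ≠ 0 := by
    intro x hx
    have h₁ := mul_le_mul_of_nonneg_left hx.1 hk
    have h₂ := mul_le_mul_of_nonneg_left hx.2 hk
    exact (cos_pos_of_mem_Ioo ⟨by linarith, by linarith⟩).ne'
  have hp : ∀ x ∈ Set.Icc a b, HasDerivAt p (-k ^ 2 - p x ^ 2) x := by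
    intro x hx
    have h := ((hasDerivAt_tan (hcos x hx)).comp x
      (((hasDerivAt_id x).sub_const ((a + b) / 2)).const_mul k)).const_mul (-k)
    refine h.congr_deriv ?_
    simp only [p]
    have hcosx := hcos x hx
    generalize k * (x - (a + b) / 2) = y at hcosx ⊢
    rw [tan_eq_sin_div_cos]
    field_simp
    linear_combination k ^ 2 * sin_sq_add_cos_sq y
  have hpc : ContinuousOn p (Set.Icc a b) :=
    fun x hx ↦ (hp x hx).continuousAt.continuousWithinAt
  let F : ℝ → ℝ := fun x ↦ p x * ‖f x‖ ^ 2
  let F' : ℝ → ℝ := fun x ↦ (-k ^ 2 - p x ^ 2) * ‖f x‖ ^ 2 + p x * (2 * inner ℝ (f x) (f' x))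
  have hFc : ContinuousOn F (Set.Icc a b) := by fun_prop
  have hF'c : ContinuousOn F' (Set.Icc a b) := by fun_prop
  have hF : ∀ x ∈ Set.Ioo a b, HasDerivAt F (F' x) x := fun x hx ↦
    (hp x (Set.Ioo_subset_Icc_self hx)).mul
      (((hderiv x (Set.Ioo_subset_Icc_self hx)).hasDerivAt (Icc_mem_nhds hx.1 hx.2)).norm_sq)
  have hF'i : IntervalIntegrable F' volume a b := hF'c.intervalIntegrable_of_Icc hab
  have hfi : IntervalIntegrable (fun x ↦ k ^ 2 * ‖f x‖ ^ 2) volume a b :=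
    ContinuousOn.intervalIntegrable_of_Icc hab (by fun_prop)
  have hf'i : IntervalIntegrable (fun x ↦ ‖f' x‖ ^ 2) volume a b :=
    ContinuousOn.intervalIntegrable_of_Icc hab (by fun_prop)
  have hFTC := intervalIntegral.integral_eq_sub_of_hasDerivAt_of_le hab hFc hF hF'i
  have hmono : (∫ x in a..b, (k ^ 2 * ‖f x‖ ^ 2 + F' x)) ≤ ∫ x in a..b, ‖f' x‖ ^ 2 := by
    refine intervalIntegral.integral_mono_on hab (hfi.add hF'i) hf'i fun x _ ↦ ?_
    have h := sq_nonneg ‖f' x - p x • f x‖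
    rw [norm_sub_sq_real, norm_smul, inner_smul_right, real_inner_comm, mul_pow, norm_eq_abs,
      sq_abs] at h
    simp only [F']
    linarith
  rw [intervalIntegral.integral_add hfi hF'i, intervalIntegral.integral_const_mul, hFTC] at hmono
  have hFb : F b = -k * tan (k * (b - a) / 2) * ‖f b‖ ^ 2 := by
    simp only [F, p]
    congr 3
    ring_nf
  have hFa : F a = k * tan (k * (b - a) / 2) * ‖f a‖ ^ 2 := by
    simp only [F, p]
    rw [show k * (a - (a + b) / 2) = -(k * (b - a) / 2) by ring, tan_neg]
    ring
  rw [hFa, hFb] at hmono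
  linarith

/-- Lemma 1, Wirtinger-type inequality: for `f` continuously
differentiable on `[a,b]` and every `ε > 0`,
`∫_a^b |f|² ≤ π⁻²(b−a)²(1+ε)∫_a^b |f′|² + (1+ε⁻¹)(b−a)(|f(a)|²+|f(b)|²)`. -/
theorem wirtinger_with_boundary (a b : ℝ) (hab : a < b) (f f' : ℝ → ℂ)
    (hderiv : ∀ x ∈ Set.Icc a b, HasDerivWithinAt f (f' x) (Set.Icc a b) x)
    (hcont : ContinuousOn f' (Set.Icc a b)) :
    ∀ ε : ℝ, 0 < ε →
      (∫ x in a..b, ‖f x‖ ^ 2) ≤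
        (π ^ 2)⁻¹ * (b - a) ^ 2 * (1 + ε) * (∫ x in a..b, ‖f' x‖ ^ 2) +
          (1 + ε⁻¹) * (b - a) * (‖f a‖ ^ 2 + ‖f b‖ ^ 2) := by
  intro ε hε
  have hπ := pi_pos
  have hL : 0 < b - a := sub_pos.2 hab
  have hs : 1 < √(1 + ε) := lt_sqrt_of_sq_lt (by linarith)
  have hs₂ : √(1 + ε) ^ 2 = 1 + ε := sq_sqrt (by linarith)
  obtain ⟨θ, hθ⟩ : ∃ θ, θ = π / √(1 + ε) := ⟨_, rfl⟩
  have hθ₀ : 0 < θ := by rw [hθ]; positivity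
  have hθπ : θ < π := by rw [hθ]; exact div_lt_self hπ hs
  have hθ₂ : θ ^ 2 * (1 + ε) = π ^ 2 := by rw [hθ, div_pow, hs₂]; field_simp
  have hkL : θ / (b - a) * (b - a) = θ := div_mul_cancel₀ _ hL.ne'
  have hmain := sq_mul_integral_norm_sq_le hab.le (k := θ / (b - a)) (by positivity)
    (by rwa [hkL]) hderiv hcont
  rw [hkL] at hmain
  have htan : tan (θ / 2) ≤ θ * (1 + ε⁻¹) := by
    have h := tan_mul_pi_sq_sub_le (x := θ / 2) (by linarith) (by linarith)
    have h' : θ ^ 2 * (tan (θ / 2) * ε) ≤ θ ^ 2 * (θ * (1 + ε)) := by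
      rw [← hθ₂] at h
      linarith
    have h'' := le_of_mul_le_mul_left h' (by positivity)
    rw [← le_div_iff₀ hε] at h''
    exact h''.trans_eq (by field_simp; ring)
  have hscale := mul_le_mul_of_nonneg_left hmain (by positivity : 0 ≤ ((b - a) / θ) ^ 2)
  have hA : ((b - a) / θ) ^ 2 = (π ^ 2)⁻¹ * (b - a) ^ 2 * (1 + ε) := by
    rw [← hθ₂]
    field_simp
  have hB : ((b - a) / θ) ^ 2 * (θ / (b - a) * tan (θ / 2)) ≤ (1 + ε⁻¹) * (b - a) := by
    calc ((b - a) / θ) ^ 2 * (θ / (b - a) * tan (θ / 2)) = (b - a) / θ * tan (θ / 2) := by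
          field_simp
      _ ≤ (b - a) / θ * (θ * (1 + ε⁻¹)) := by gcongr
      _ = (1 + ε⁻¹) * (b - a) := by field_simp
  calc (∫ x in a..b, ‖f x‖ ^ 2)
      = ((b - a) / θ) ^ 2 * ((θ / (b - a)) ^ 2 * ∫ x in a..b, ‖f x‖ ^ 2) := by field_simp
    _ ≤ _ := hscale
    _ = ((b - a) / θ) ^ 2 * (∫ x in a..b, ‖f' x‖ ^ 2) +
        ((b - a) / θ) ^ 2 * (θ / (b - a) * tan (θ / 2)) * (‖f a‖ ^ 2 + ‖f b‖ ^ 2) := by ring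
    _ ≤ _ := by rw [← hA]; gcongr
end

section
/- For every ε ∈ (0,1) there exists a constant C_ε > 0 with the following property. Let μ > 0 and let (λ_i)_{i∈ℤ} be a strictly increasing real sequence with λ_i → ±∞ as i → ±∞ and λ_{i+1} − λ_i ≤ (1−ε)/(2μ) for all i ∈ ℤ. Then for every Schwartz function f : ℝ → ℂ and every continuously differentiable, nondecreasing, convex function Φ : [0,∞) → ℝ, one has (in the extended reals) Φ(μ²)·∫_ℝ |f(x)|² dx ≤ ∫_ℝ Φ(ξ²)|𝓕f(ξ)|² dξ + C_ε · μ · Φ′(μ²) · Σ_{i∈ℤ} |f(λ_i)|². -/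
open MeasureTheory Filter Real
open scoped FourierTransform

section WirtingerInequality

variable {E : Type*} [NormedAddCommGroup E] [InnerProductSpace ℝ E]

/-- A Wirtinger-type inequality with boundary terms on an interval whose length is less than
`π / κ`. -/
theorem intervalIntegral_wirtinger_le {f f' : ℝ → E} {a b κ θ : ℝ} (hκ : 0 < κ) (hab : a ≤ b)
    (hθ : κ * (b - a) / 2 ≤ θ) (hθπ : θ < π / 2)
    (hf : ∀ x, HasDerivAt f (f' x) x) (hf' : Continuous f') :
    κ ^ 2 * ∫ x in a..b, ‖f x‖ ^ 2 ≤
      (∫ x in a..b, ‖f' x‖ ^ 2) + κ * tan θ * (‖f a‖ ^ 2 + ‖f b‖ ^ 2) := by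
  have hfc : Continuous f := continuous_iff_continuousAt.2 fun x => (hf x).continuousAt
  set τ := κ * (b - a) / 2 with hτ
  have hτ0 : 0 ≤ τ := by
    have := sub_nonneg.2 hab
    positivity
  let u : ℝ → ℝ := fun x => κ * (x - (a + b) / 2)
  have hu : ∀ x ∈ Set.Icc a b, u x ∈ Set.Ioo (-(π / 2)) (π / 2) := fun x hx => by
    have h₁ := mul_le_mul_of_nonneg_left hx.1 hκ.le
    have h₂ := mul_le_mul_of_nonneg_left hx.2 hκ.le
    constructor <;> simp only [u] <;> linarith
  have hcos : ∀ x ∈ Set.Icc a b, cos (u x) ≠ 0 := fun x hx => (cos_pos_of_mem_Ioo (hu x hx)).ne'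
  have hder : ∀ x ∈ Set.Icc a b, HasDerivAt (fun x => -κ * tan (u x) * ‖f x‖ ^ 2)
      (-κ * (1 / cos (u x) ^ 2 * κ) * ‖f x‖ ^ 2 +
        -κ * tan (u x) * (2 * inner ℝ (f x) (f' x))) x := fun x hx => by
    have h₁ : HasDerivAt u κ x := by
      simpa using ((hasDerivAt_id x).sub_const ((a + b) / 2)).const_mul κ
    exact (((Real.hasDerivAt_tan (hcos x hx)).comp x h₁).const_mul (-κ)).mul (hf x).norm_sq
  have key := intervalIntegral.sub_le_integral_of_hasDeriv_right_of_le
    (φ := fun x => ‖f' x‖ ^ 2 - κ ^ 2 * ‖f x‖ ^ 2) hab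
    (fun x hx => (hder x hx).continuousAt.continuousWithinAt)
    (fun x hx => (hder x (Set.Ioo_subset_Icc_self hx)).hasDerivWithinAt)
    (Continuous.integrableOn_Icc (by fun_prop)) (fun x hx => by
      have hc := hcos x (Set.Ioo_subset_Icc_self hx)
      have h₁ : 1 / cos (u x) ^ 2 = 1 + tan (u x) ^ 2 := by
        rw [tan_eq_sin_div_cos]
        field_simp
        linarith [sin_sq_add_cos_sq (u x)]
      have h₂ := sq_nonneg ‖f' x + (κ * tan (u x)) • f x‖
      rw [norm_add_sq_real, norm_smul, inner_smul_right, mul_pow, Real.norm_eq_abs, sq_abs,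
        real_inner_comm] at h₂
      rw [h₁]
      linarith)
  rw [intervalIntegral.integral_sub (Continuous.intervalIntegrable (by fun_prop) _ _)
    (Continuous.intervalIntegrable (by fun_prop) _ _), intervalIntegral.integral_const_mul] at key
  have hua : u a = -τ := by simp only [u, hτ]; ring
  have hub : u b = τ := by simp only [u, hτ]; ring
  rw [hua, hub, tan_neg] at key
  have htan : tan τ ≤ tan θ :=
    strictMonoOn_tan.monotoneOn ⟨by linarith [pi_pos], by linarith⟩
      ⟨by linarith [pi_pos], hθπ⟩ hθ
  have : κ * tan τ * (‖f a‖ ^ 2 + ‖f b‖ ^ 2) ≤ κ * tan θ * (‖f a‖ ^ 2 + ‖f b‖ ^ 2) := by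
    gcongr
  linarith

theorem iUnion_Ioc_int_eq_univ {Λ : ℤ → ℝ} (hmono : StrictMono Λ)
    (htop : Tendsto Λ atTop atTop) (hbot : Tendsto Λ atBot atBot) :
    ⋃ i : ℤ, Set.Ioc (Λ i) (Λ (i + 1)) = Set.univ := by
  refine Set.eq_univ_of_forall fun x => Set.mem_iUnion.2 ?_
  obtain ⟨n, hn⟩ := (htop.eventually_ge_atTop x).exists
  obtain ⟨i, hi, hmax⟩ := Int.exists_greatest_of_bdd (P := fun i => Λ i < x)
    ⟨n, fun z hz => (hmono.lt_iff_lt.1 (hz.trans_le hn)).le⟩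
    (hbot.eventually_lt_atBot x).exists
  exact ⟨i, hi, not_lt.1 fun h => absurd (hmax _ h) (by lia)⟩

/-- The Wirtinger-type inequality on the line, with a sampling term over a sequence of nodes whose
gaps are less than `π / κ`. -/
theorem integral_wirtinger_le {f f' : ℝ → E} {Λ : ℤ → ℝ} {κ θ : ℝ} (hκ : 0 < κ)
    (hmono : StrictMono Λ) (htop : Tendsto Λ atTop atTop) (hbot : Tendsto Λ atBot atBot)
    (hθ : ∀ i, κ * (Λ (i + 1) - Λ i) / 2 ≤ θ) (hθπ : θ < π / 2)
    (hf : ∀ x, HasDerivAt f (f' x) x) (hf' : Continuous f')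
    (hfi : Integrable fun x => ‖f x‖ ^ 2) (hfi' : Integrable fun x => ‖f' x‖ ^ 2)
    (hsum : Summable fun i => ‖f (Λ i)‖ ^ 2) :
    κ ^ 2 * ∫ x, ‖f x‖ ^ 2 ≤
      (∫ x, ‖f' x‖ ^ 2) + 2 * κ * tan θ * ∑' i, ‖f (Λ i)‖ ^ 2 := by
  have hle : ∀ i, Λ i ≤ Λ (i + 1) := fun i => (hmono (lt_add_one i)).le
  have hdecomp : ∀ {g : ℝ → ℝ}, Integrable g →
      HasSum (fun i => ∫ x in Λ i..Λ (i + 1), g x) (∫ x, g x) := fun {g} hg => by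
    have h := hasSum_integral_iUnion (μ := volume) (fun i => measurableSet_Ioc)
      hmono.monotone.pairwise_disjoint_on_Ioc_succ hg.integrableOn
    simp only [Order.succ_eq_add_one, iUnion_Ioc_int_eq_univ hmono htop hbot,
      setIntegral_univ] at h
    simpa only [intervalIntegral.integral_of_le (hle _)] using h
  have hshift : HasSum (fun i => ‖f (Λ (i + 1))‖ ^ 2) (∑' i, ‖f (Λ i)‖ ^ 2) :=
    (Equiv.addRight (1 : ℤ)).hasSum_iff.2 hsum.hasSum
  have := hasSum_le
    (fun i => intervalIntegral_wirtinger_le hκ (hle i) (hθ i) hθπ hf hf')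
    ((hdecomp hfi).mul_left (κ ^ 2))
    ((hdecomp hfi').add ((hsum.hasSum.add hshift).mul_left (κ * tan θ)))
  linarith

end WirtingerInequality

/-- A convex function lies above its tangent lines. -/
theorem ConvexOn.add_derivWithin_mul_sub_le {s : Set ℝ} {Φ : ℝ → ℝ} (hΦ : ConvexOn ℝ s Φ)
    {x y : ℝ} (hx : x ∈ s) (hy : y ∈ s) (hd : DifferentiableWithinAt ℝ Φ s x) :
    Φ x + derivWithin Φ s x * (y - x) ≤ Φ y := by
  rcases lt_trichotomy x y with h | rfl | h
  · have := hΦ.derivWithin_le_slope hx hy h hd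
    rw [slope_def_field, le_div_iff₀ (sub_pos.2 h)] at this
    linarith
  · simp
  · have := hΦ.slope_le_derivWithin hy hx h hd
    rw [slope_def_field, div_le_iff₀ (sub_pos.2 h)] at this
    linarith

namespace SchwartzMap

theorem integrable_norm_sq (f : SchwartzMap ℝ ℂ) : Integrable fun x => ‖f x‖ ^ 2 :=
  (memLp_two_iff_integrable_sq_norm f.continuous.aestronglyMeasurable).1 (f.memLp 2)

theorem norm_sq_fourier_deriv (f : SchwartzMap ℝ ℂ) (ξ : ℝ) :
    ‖𝓕 (derivCLM ℂ ℂ f) ξ‖ ^ 2 = (2 * π) ^ 2 * (ξ ^ 2 * ‖𝓕 (⇑f) ξ‖ ^ 2) := by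
  have hd : ⇑(derivCLM ℂ ℂ f) = deriv f := funext (derivCLM_apply ℂ f)
  have hi : Integrable (deriv f) := hd ▸ (derivCLM ℂ ℂ f).integrable
  rw [fourier_coe, hd, Real.fourier_deriv f.integrable f.differentiable hi]
  simp only [norm_smul, norm_mul, Complex.norm_I, Complex.norm_real, Complex.norm_ofNat,
    Real.norm_eq_abs, mul_pow, sq_abs, mul_one]
  ring

theorem integrable_sq_mul_norm_sq_fourier (f : SchwartzMap ℝ ℂ) :
    Integrable fun ξ : ℝ => ξ ^ 2 * ‖𝓕 (⇑f) ξ‖ ^ 2 := by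
  have h := (𝓕 (derivCLM ℂ ℂ f)).integrable_norm_sq
  simp only [norm_sq_fourier_deriv] at h
  exact (integrable_const_mul_iff (IsUnit.mk0 _ (by positivity)) _).1 h

theorem integral_norm_sq_deriv (f : SchwartzMap ℝ ℂ) :
    ∫ x, ‖derivCLM ℂ ℂ f x‖ ^ 2 = (2 * π) ^ 2 * ∫ ξ : ℝ, ξ ^ 2 * ‖𝓕 (⇑f) ξ‖ ^ 2 := by
  rw [← integral_norm_sq_fourier, ← integral_const_mul]
  simp only [norm_sq_fourier_deriv]

end SchwartzMap

/-- Proposition 2: if a Schwartz function vanishes... more precisely, for a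
`(1−ε)/(2μ)`-dense node sequence `Λ` and every `C¹`, nondecreasing, convex
`Φ : [0,∞) → ℝ`, one has
`Φ(μ²)∫|f|² ≤ ∫Φ(ξ²)|𝓕f(ξ)|² dξ + C_ε μ Φ′(μ²) Σᵢ |f(λᵢ)|²`.
(The inequality is stated here under the finiteness hypotheses on the two right-hand side
terms; when either is infinite the extended-real inequality holds trivially.) -/
theorem wirtinger_convex_weight (ε : ℝ) (hε0 : 0 < ε) (hε1 : ε < 1) :
    ∃ Cε : ℝ, 0 < Cε ∧
      ∀ μ : ℝ, 0 < μ →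
      ∀ Λ : ℤ → ℝ, StrictMono Λ → Tendsto Λ atTop atTop → Tendsto Λ atBot atBot →
        (∀ i : ℤ, Λ (i + 1) - Λ i ≤ (1 - ε) / (2 * μ)) →
      ∀ f : SchwartzMap ℝ ℂ,
      ∀ Φ : ℝ → ℝ, ContDiffOn ℝ 1 Φ (Set.Ici 0) → MonotoneOn Φ (Set.Ici 0) →
        ConvexOn ℝ (Set.Ici 0) Φ →
        Integrable (fun ξ : ℝ => Φ (ξ ^ 2) * ‖𝓕 (⇑f) ξ‖ ^ 2) →
        Summable (fun i : ℤ => ‖f (Λ i)‖ ^ 2) →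
        Φ (μ ^ 2) * (∫ x : ℝ, ‖f x‖ ^ 2) ≤
          (∫ ξ : ℝ, Φ (ξ ^ 2) * ‖𝓕 (⇑f) ξ‖ ^ 2) +
            Cε * μ * derivWithin Φ (Set.Ici 0) (μ ^ 2) * ∑' i : ℤ, ‖f (Λ i)‖ ^ 2 := by
  have hθ0 : 0 < (1 - ε) * π / 2 := by
    have := sub_pos.2 hε1
    positivity
  have hθπ : (1 - ε) * π / 2 < π / 2 := by nlinarith [pi_pos]
  refine ⟨tan ((1 - ε) * π / 2) / π, div_pos (tan_pos_of_pos_of_lt_pi_div_two hθ0 hθπ) pi_pos, ?_⟩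
  intro μ hμ Λ hmono htop hbot hgap f Φ hC1 hΦmono hconv hint hsum
  have hmem : μ ^ 2 ∈ Set.Ici (0 : ℝ) := sq_nonneg μ
  have hgap' : ∀ i, 2 * π * μ * (Λ (i + 1) - Λ i) / 2 ≤ (1 - ε) * π / 2 := fun i => by
    have h := hgap i
    rw [le_div_iff₀ (by positivity)] at h
    nlinarith [pi_pos]
  have hwirt := integral_wirtinger_le (f' := SchwartzMap.derivCLM ℂ ℂ f) (by positivity)
    hmono htop hbot hgap' hθπ f.hasDerivAt (SchwartzMap.derivCLM ℂ ℂ f).continuous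
    f.integrable_norm_sq (SchwartzMap.derivCLM ℂ ℂ f).integrable_norm_sq hsum
  rw [f.integral_norm_sq_deriv] at hwirt
  set S := ∑' i, ‖f (Λ i)‖ ^ 2
  set T := tan ((1 - ε) * π / 2)
  have hsample : μ ^ 2 * ∫ x, ‖f x‖ ^ 2 ≤
      (∫ ξ : ℝ, ξ ^ 2 * ‖𝓕 (⇑f) ξ‖ ^ 2) + T / π * μ * S := by
    refine le_of_mul_le_mul_left ?_ (show 0 < (2 * π) ^ 2 by positivity)
    rw [← mul_assoc, ← mul_pow]
    refine hwirt.trans_eq ?_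
    field_simp
  set D := derivWithin Φ (Set.Ici 0) (μ ^ 2)
  have hD : 0 ≤ D := hΦmono.derivWithin_nonneg
  have hi₀ : Integrable fun ξ : ℝ => ‖𝓕 (⇑f) ξ‖ ^ 2 := (𝓕 f).integrable_norm_sq
  have hi₂ := f.integrable_sq_mul_norm_sq_fourier
  have hplancherel : ∫ ξ : ℝ, ‖𝓕 (⇑f) ξ‖ ^ 2 = ∫ x, ‖f x‖ ^ 2 := f.integral_norm_sq_fourier
  have htangent : ∫ ξ : ℝ, ((Φ (μ ^ 2) - D * μ ^ 2) * ‖𝓕 (⇑f) ξ‖ ^ 2 +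
      D * (ξ ^ 2 * ‖𝓕 (⇑f) ξ‖ ^ 2)) ≤ ∫ ξ : ℝ, Φ (ξ ^ 2) * ‖𝓕 (⇑f) ξ‖ ^ 2 := by
    refine integral_mono ((hi₀.const_mul _).add (hi₂.const_mul _)) hint fun ξ => ?_
    have h := mul_le_mul_of_nonneg_right (hconv.add_derivWithin_mul_sub_le hmem
      (sq_nonneg ξ) (hC1.differentiableOn one_ne_zero _ hmem)) (sq_nonneg ‖𝓕 (⇑f) ξ‖)
    refine le_of_eq_of_le ?_ h
    ring
  rw [integral_add (hi₀.const_mul _) (hi₂.const_mul _), integral_const_mul, integral_const_mul,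
    hplancherel] at htangent
  have := mul_le_mul_of_nonneg_left hsample hD
  linarith
end
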